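/- For every rational α ∈ (0,1/2) there exists a constant C(α) > 0 such that liminf_{d→∞} liminf_{N→∞} ( E_{G(N,d/N)}[MCUT_α] − E_{R(N,d)}[MCUT_α] ) / (√d · N) ≥ C(α), where d ranges over the positive integers and the inner liminf is taken over integers N with αN an integer and Nd even. -/

import Mathlib

open Finset MeasureTheory

noncomputable section

/-- Number of edges of a simple graph on `Fin N`. -/
def numEdges {N : ℕ} (G : SimpleGraph (Fin N)) : ℕ := Nat.card G.edgeSet

/-- Number of edges of `G` with exactly one endpoint in `s` (counted as ordered pairs
with the first coordinate in `s`, so each crossing edge is counted once). -/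
def cutCount {N : ℕ} (G : SimpleGraph (Fin N)) (s : Finset (Fin N)) : ℕ :=
  Nat.card {p : Fin N × Fin N // p.1 ∈ s ∧ p.2 ∉ s ∧ G.Adj p.1 p.2}

/-- `MCUT_α(G)`: the maximum over vertex sets `V₁` of size `αN` of the number of
edges of `G` with exactly one endpoint in `V₁`. -/
def mcut {N : ℕ} (α : ℚ) (G : SimpleGraph (Fin N)) : ℕ :=
  (Finset.powersetCard ⌊α * (N : ℚ)⌋₊ (Finset.univ : Finset (Fin N))).sup fun s => cutCount G s

/-- `α N` is a (nonnegative) integer. -/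
def alphaIntegral (α : ℚ) (N : ℕ) : Prop := ∃ k : ℕ, α * (N : ℚ) = (k : ℚ)

/-- Expectation of `f` under the Erdős–Rényi measure `G(N,p)`: each potential edge is
present independently with probability `p`, so a graph with `e` edges has probability
`p^e (1-p)^(C(N,2) - e)`. -/
def erExp (N : ℕ) (p : ℝ) (f : SimpleGraph (Fin N) → ℝ) : ℝ :=
  ∑ G : SimpleGraph (Fin N),
    p ^ numEdges G * (1 - p) ^ (N.choose 2 - numEdges G) * f G

/-- Probability of an event under the Erdős–Rényi measure `G(N,p)`. -/
def erProb (N : ℕ) (p : ℝ) (E : Set (SimpleGraph (Fin N))) : ℝ :=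
  erExp N p (Set.indicator E fun _ => 1)

/-- `G` is `d`-regular. -/
def IsDReg {N : ℕ} (d : ℕ) (G : SimpleGraph (Fin N)) : Prop :=
  ∀ v, Nat.card (G.neighborSet v) = d

open Classical in
/-- The finite set of simple `d`-regular graphs on `N` labeled vertices. -/
def regFinset (N d : ℕ) : Finset (SimpleGraph (Fin N)) :=
  Finset.univ.filter fun G => IsDReg d G

/-- Expectation of `f` under the uniform measure `R(N,d)` on simple `d`-regular graphs. -/
def regExp (N d : ℕ) (f : SimpleGraph (Fin N) → ℝ) : ℝ :=
  (∑ G ∈ regFinset N d, f G) / ((regFinset N d).card : ℝ)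

/-- Probability of an event under the uniform measure `R(N,d)`. -/
def regProb (N d : ℕ) (E : Set (SimpleGraph (Fin N))) : ℝ :=
  regExp N d (Set.indicator E fun _ => 1)

end


open scoped BigOperators


/-! ### Part 1: exponential moments on the symmetric group -/

lemma exp_le_quad {z : ℝ} (h : |z| ≤ 1) : Real.exp z ≤ 1 + z + z ^ 2 := by
  have := Real.abs_exp_sub_one_sub_id_le h
  have h2 := (abs_le.mp this).2
  linarith

lemma expect_exp_le {ι : Type*} [Fintype ι] [Nonempty ι] (z : ι → ℝ) (b : ℝ)
    (hz : 𝔼 i, z i = 0) (hb : ∀ i, |z i| ≤ b) (hb1 : b ≤ 1) :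
    𝔼 i, Real.exp (z i) ≤ Real.exp (b ^ 2) := by
  calc 𝔼 i, Real.exp (z i) ≤ 𝔼 i, (1 + z i + b ^ 2) := by
        refine expect_le_expect fun i _ => ?_
        have h1 := exp_le_quad ((hb i).trans hb1)
        have h2 : z i ^ 2 ≤ b ^ 2 := by
          rw [← sq_abs (z i)]
          exact pow_le_pow_left₀ (abs_nonneg _) (hb i) 2
        linarith
    _ = 1 + b ^ 2 := by
        rw [expect_add_distrib, expect_add_distrib, hz]
        simp
    _ ≤ Real.exp (b ^ 2) := by
        have := Real.add_one_le_exp (b ^ 2)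
        linarith

lemma expect_perm_option {α : Type*} [Fintype α] [DecidableEq α]
    (F : Equiv.Perm (Option α) → ℝ) :
    𝔼 σ, F σ = 𝔼 i : Option α, 𝔼 σ : Equiv.Perm α,
      F (Equiv.swap none i * Equiv.optionCongr σ) := by
  rw [← Finset.expect_product' univ univ
    (fun (i : Option α) (σ : Equiv.Perm α) => F (Equiv.swap none i * Equiv.optionCongr σ))]
  rw [univ_product_univ]
  refine Fintype.expect_equiv Equiv.Perm.decomposeOption _ _ fun σ => ?_
  have : σ = Equiv.Perm.decomposeOption.symm (Equiv.Perm.decomposeOption σ) := by simp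
  conv_lhs => rw [this]
  rfl

lemma abs_expect_sub_le {ι : Type*} [Fintype ι] [Nonempty ι] (f g : ι → ℝ) (c : ℝ)
    (h : ∀ i, |f i - g i| ≤ c) : |𝔼 i, f i - 𝔼 i, g i| ≤ c := by
  rw [← expect_sub_distrib, abs_le]
  constructor
  · calc -c = 𝔼 _i : ι, (-c) := by simp
      _ ≤ _ := expect_le_expect fun i _ => (abs_le.mp (h i)).1
  · calc 𝔼 i : ι, (f i - g i) ≤ 𝔼 _i : ι, c := expect_le_expect fun i _ => (abs_le.mp (h i)).2
      _ = c := by simp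

lemma Equiv.swap_apply_apply_aux {α β : Type*} [DecidableEq α] [DecidableEq β] (e : α ≃ β)
    (a b x : α) : e (Equiv.swap a b x) = Equiv.swap (e a) (e b) (e x) := by
  simp only [Equiv.swap_apply_def, e.injective.eq_iff]
  split_ifs <;> rfl

lemma perm_mgf_aux (c l : ℝ) (hl : 0 ≤ l) (hc0 : 0 ≤ c) (hlc : l * (2 * c) ≤ 1) (n : ℕ) :
    ∀ (α : Type) [Fintype α] [DecidableEq α] (_ : Fintype.card α = n) (F : Equiv.Perm α → ℝ)
      (_ : ∀ σ a b, |F (σ * Equiv.swap a b) - F σ| ≤ c),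
    𝔼 σ, Real.exp (l * (F σ - 𝔼 τ, F τ)) ≤ Real.exp (n * (l * (2 * c)) ^ 2) := by
  induction n with
  | zero =>
    intro α _ _ hα F hF
    have : IsEmpty α := Fintype.card_eq_zero_iff.mp hα
    have hu : ∀ σ : Equiv.Perm α, σ = 1 := fun σ => Subsingleton.elim _ _
    have h1 : 𝔼 τ, F τ = F 1 := by
      rw [Finset.expect_congr rfl (fun τ _ => by rw [hu τ])]
      simp
    have h2 : ∀ τ ∈ (univ : Finset (Equiv.Perm α)), Real.exp (l * (F τ - 𝔼 τ, F τ)) = 1 := by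
      intro τ _
      rw [hu τ, h1]
      simp
    rw [Finset.expect_congr rfl h2]
    simp
  | succ n ih =>
    intro α _ _ hα F hF
    obtain ⟨e⟩ : Nonempty (Option (Fin n) ≃ α) := by
      refine ⟨Fintype.equivOfCardEq ?_⟩
      simp [hα]
    -- transport to Option (Fin n)
    set F' : Equiv.Perm (Option (Fin n)) → ℝ := fun σ => F (e.permCongr σ) with hF'
    have hF'c : ∀ σ a b, |F' (σ * Equiv.swap a b) - F' σ| ≤ c := by
      intro σ a b
      have : e.permCongr (σ * Equiv.swap a b) = e.permCongr σ * Equiv.swap (e a) (e b) := by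
        ext x
        have hx : Equiv.swap (e a) (e b) x = e (Equiv.swap a b (e.symm x)) := by
          rw [← e.apply_symm_apply x, ← Equiv.swap_apply_apply_aux e a b]
          simp
        simp [Equiv.permCongr_apply, hx]
      simp only [hF', this]
      exact hF _ _ _
    have hmean : 𝔼 τ, F τ = 𝔼 τ, F' τ :=
      (Fintype.expect_equiv e.permCongr _ _ fun σ => rfl).symm
    have hexp : 𝔼 σ, Real.exp (l * (F σ - 𝔼 τ, F τ)) =
        𝔼 σ, Real.exp (l * (F' σ - 𝔼 τ, F' τ)) := by
      rw [hmean]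
      exact (Fintype.expect_equiv e.permCongr _ _ fun σ => rfl).symm
    rw [hexp]
    clear hexp hmean
    have hleft : ∀ a b σ, |F' (Equiv.swap a b * σ) - F' σ| ≤ c := by
      intro a b σ
      rw [Equiv.swap_mul_eq_mul_swap]
      exact hF'c _ _ _
    set G : Option (Fin n) → Equiv.Perm (Fin n) → ℝ :=
      fun i σ => F' (Equiv.swap none i * Equiv.optionCongr σ) with hG
    set g : Option (Fin n) → ℝ := fun i => 𝔼 σ, G i σ with hg
    have hM : 𝔼 τ, F' τ = 𝔼 i, g i := expect_perm_option F'
    have hgd : ∀ i j, |g i - g j| ≤ 2 * c := by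
      intro i j
      refine abs_expect_sub_le _ _ _ fun σ => ?_
      have h1 := hleft none i (Equiv.optionCongr σ)
      have h2 := hleft none j (Equiv.optionCongr σ)
      rw [abs_le] at *
      constructor <;> simp only [hG] <;> linarith [h1.1, h1.2, h2.1, h2.2]
    have hgm : ∀ i, |g i - 𝔼 j, g j| ≤ 2 * c := by
      intro i
      have := abs_expect_sub_le (fun _ : Option (Fin n) => g i) g (2 * c) (fun j => hgd i j)
      simpa using this
    rw [expect_perm_option]
    have key : ∀ i : Option (Fin n), 𝔼 σ : Equiv.Perm (Fin n),
        Real.exp (l * (F' (Equiv.swap none i * Equiv.optionCongr σ) - 𝔼 τ, F' τ))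
        ≤ Real.exp (n * (l * (2 * c)) ^ 2) * Real.exp (l * (g i - 𝔼 j, g j)) := by
      intro i
      have h1 := ih (Fin n) (by simp) (G i) (by
        intro σ a b
        simp only [hG]
        have : Equiv.optionCongr (σ * Equiv.swap a b) =
            Equiv.optionCongr σ * Equiv.swap (some a) (some b) := by
          rw [← Equiv.optionCongr_swap]
          ext1 x
          cases x <;> rfl
        rw [this, ← mul_assoc]
        exact hF'c _ _ _)
      calc _ = (𝔼 σ : Equiv.Perm (Fin n), Real.exp (l * (G i σ - 𝔼 τ, G i τ))) *
            Real.exp (l * (g i - 𝔼 j, g j)) := by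
            rw [expect_mul]
            refine expect_congr rfl fun σ _ => ?_
            rw [← Real.exp_add, hM]
            congr 1
            simp only [hG, hg]
            ring
        _ ≤ _ := mul_le_mul_of_nonneg_right h1 (Real.exp_nonneg _)
    calc _ ≤ 𝔼 i, Real.exp (n * (l * (2 * c)) ^ 2) * Real.exp (l * (g i - 𝔼 j, g j)) :=
          expect_le_expect fun i _ => key i
      _ = Real.exp (n * (l * (2 * c)) ^ 2) * 𝔼 i, Real.exp (l * (g i - 𝔼 j, g j)) := by
          rw [mul_expect]
      _ ≤ Real.exp (n * (l * (2 * c)) ^ 2) * Real.exp ((l * (2 * c)) ^ 2) := by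
          refine mul_le_mul_of_nonneg_left ?_ (Real.exp_nonneg _)
          refine expect_exp_le _ _ ?_ ?_ hlc
          · rw [← mul_expect, expect_sub_distrib]
            simp
          · intro i
            rw [abs_mul, abs_of_nonneg hl]
            exact mul_le_mul_of_nonneg_left (hgm i) hl
      _ = _ := by
          rw [← Real.exp_add]
          congr 1
          push_cast
          ring

/-- Jensen: conditioning a function on the symmetric group on a set of probability at least
`1/Q` changes its mean by at most a small amount. -/
lemma perm_cond_mean {α : Type} [Fintype α] [DecidableEq α] (F : Equiv.Perm α → ℝ)
    (c l Q : ℝ) (hl : 0 < l) (hc0 : 0 ≤ c) (hlc : l * (2 * c) ≤ 1)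
    (hF : ∀ σ a b, |F (σ * Equiv.swap a b) - F σ| ≤ c)
    (A : Finset (Equiv.Perm α)) (hA : A.Nonempty) (hQ : 0 < Q)
    (hAQ : (Fintype.card (Equiv.Perm α) : ℝ) ≤ Q * #A) :
    (∑ σ ∈ A, F σ) / #A ≤ 𝔼 σ, F σ + (Real.log Q + Fintype.card α * (l * (2 * c)) ^ 2) / l := by
  have h1 := perm_mgf_aux c l hl.le hc0 hlc _ α rfl F hF
  set M := 𝔼 τ, F τ
  have hApos : (0 : ℝ) < #A := by exact_mod_cast hA.card_pos
  have h2 : ∑ σ ∈ A, Real.exp (l * (F σ - M)) ≤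
      Fintype.card (Equiv.Perm α) * Real.exp (Fintype.card α * (l * (2 * c)) ^ 2) := by
    calc _ ≤ ∑ σ, Real.exp (l * (F σ - M)) :=
          sum_le_sum_of_subset_of_nonneg (subset_univ _) fun _ _ _ => Real.exp_nonneg _
      _ = Fintype.card (Equiv.Perm α) * 𝔼 σ, Real.exp (l * (F σ - M)) := by
          rw [Fintype.card_mul_expect]
      _ ≤ _ := mul_le_mul_of_nonneg_left h1 (by positivity)
  have h3 : Real.exp (∑ σ ∈ A, (1 / (#A : ℝ)) • (l * (F σ - M))) ≤
      ∑ σ ∈ A, (1 / (#A : ℝ)) • Real.exp (l * (F σ - M)) := by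
    refine convexOn_exp.map_sum_le (fun _ _ => by positivity) ?_ (fun _ _ => Set.mem_univ _)
    simp [hApos.ne']
  have h4 : ∑ σ ∈ A, (1 / (#A : ℝ)) • (l * (F σ - M)) = l * ((∑ σ ∈ A, F σ) / #A - M) := by
    simp only [smul_eq_mul]
    rw [← mul_sum, ← mul_sum, sum_sub_distrib, sum_const, nsmul_eq_mul]
    field_simp
  rw [h4] at h3
  have h5 : ∑ σ ∈ A, (1 / (#A : ℝ)) • Real.exp (l * (F σ - M)) ≤
      Q * Real.exp (Fintype.card α * (l * (2 * c)) ^ 2) := by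
    simp only [smul_eq_mul]
    rw [← mul_sum]
    calc _ ≤ (1 / (#A : ℝ)) * (Fintype.card (Equiv.Perm α) *
            Real.exp (Fintype.card α * (l * (2 * c)) ^ 2)) :=
          mul_le_mul_of_nonneg_left h2 (by positivity)
      _ ≤ (1 / (#A : ℝ)) * ((Q * #A) * Real.exp (Fintype.card α * (l * (2 * c)) ^ 2)) := by
          gcongr
      _ = _ := by field_simp
  have h6 := h3.trans h5
  rw [← Real.exp_log hQ, ← Real.exp_add, Real.exp_le_exp] at h6
  have h7 : (∑ σ ∈ A, F σ) / #A - M ≤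
      (Real.log Q + Fintype.card α * (l * (2 * c)) ^ 2) / l := by
    rw [le_div_iff₀ hl]
    linarith
  linarith


/-! ### Part 2: the configuration model and switchings -/

section Config
variable {m N : ℕ}

/-- The `i`-th (unordered) edge of a sequence of half-edge labels. -/
def ed (x : Fin m × Bool → Fin N) (i : Fin m) : Sym2 (Fin N) := s(x (i, false), x (i, true))

/-- Cut size of the multigraph given by a label sequence. -/
def cutS (x : Fin m × Bool → Fin N) (s : Finset (Fin N)) : ℕ :=
  #{i : Fin m | ¬ (x (i, false) ∈ s ↔ x (i, true) ∈ s)}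

/-- Maximal cut with side of size `n`. -/
def fS (n : ℕ) (x : Fin m × Bool → Fin N) : ℕ := (powersetCard n univ).sup (cutS x)

/-- The simple graph underlying the multigraph. -/
def gam (x : Fin m × Bool → Fin N) : SimpleGraph (Fin N) :=
  SimpleGraph.fromEdgeSet (Set.range (ed x))

open Classical in
/-- Indices of edges that are loops or multiple edges. -/
noncomputable def bad (x : Fin m × Bool → Fin N) : Finset (Fin m) :=
  {i : Fin m | (ed x i).IsDiag ∨ ∃ j, j ≠ i ∧ ed x j = ed x i}

/-- Each label occurs exactly `d` times. -/
def IsBal (d : ℕ) (x : Fin m × Bool → Fin N) : Prop :=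
  ∀ v, #{p : Fin m × Bool | x p = v} = d

/-- The other half-edge. -/
def par (p : Fin m × Bool) : Fin m × Bool := (p.1, !p.2)

lemma mem_bad {x : Fin m × Bool → Fin N} {i : Fin m} :
    i ∈ bad x ↔ x (i, false) = x (i, true) ∨ ∃ j, j ≠ i ∧ ed x j = ed x i := by
  classical
  simp [bad, ed]

lemma IsBal.comp_perm {d : ℕ} {x : Fin m × Bool → Fin N} (h : IsBal d x)
    (σ : Equiv.Perm (Fin m × Bool)) : IsBal d (x ∘ σ) := by
  intro v
  rw [← h v]
  refine card_equiv σ fun p => ?_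
  simp

lemma card_nbr_le {d : ℕ} {x : Fin m × Bool → Fin N} (h : IsBal d x) (v : Fin N) (b : Bool) :
    #{j : Fin m | ∃ l, ed x l = s(x (j, b), v)} ≤ d * d := by
  classical
  have hsub : ({j : Fin m | ∃ l, ed x l = s(x (j, b), v)} : Finset (Fin m)) ⊆
      ({p : Fin m × Bool | x p = v} : Finset _).biUnion
        fun p => ({j : Fin m | x (j, b) = x (par p)} : Finset (Fin m)) := by
    intro j hj
    simp only [mem_filter, mem_univ, true_and] at hj
    obtain ⟨l, hl⟩ := hj
    simp only [ed, Sym2.eq_iff] at hl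
    simp only [mem_biUnion, mem_filter, mem_univ, true_and]
    rcases hl with ⟨h1, h2⟩ | ⟨h1, h2⟩
    · exact ⟨(l, true), h2, by simp [par, h1]⟩
    · exact ⟨(l, false), h1, by simp [par, h2]⟩
  refine (card_le_card hsub).trans ?_
  refine (card_biUnion_le_card_mul _ _ d fun p _ => ?_).trans (by rw [h v])
  rw [← h (x (par p))]
  refine card_le_card_of_injOn (fun j => (j, b)) (fun j hj => ?_) (fun j _ k _ hjk => ?_)
  · simpa using hj
  · simpa using hjk

lemma card_lab_le {d : ℕ} {x : Fin m × Bool → Fin N} (h : IsBal d x) (v : Fin N) (b : Bool) :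
    #{j : Fin m | x (j, b) = v} ≤ d := by
  rw [← h v]
  refine card_le_card_of_injOn (fun j => (j, b)) (fun j hj => ?_) (fun j _ k _ hjk => ?_)
  · simpa using hj
  · simpa using hjk

lemma exists_switch {d K : ℕ} {x : Fin m × Bool → Fin N} (h : IsBal d x) (i : Fin m)
    (hi : i ∈ bad x) (hK : #(bad x) ≤ K) (hm : K + 2 * (d * d) + 3 * d < m) :
    ∃ p q, #(bad (x ∘ Equiv.swap p q)) < #(bad x) := by
  classical
  set u := x (i, false) with hu
  set v := x (i, true) with hv
  set F : Finset (Fin m) := bad x ∪ univ.filter (fun j => ∃ l, ed x l = s(x (j, false), v)) ∪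
    univ.filter (fun j => ∃ l, ed x l = s(x (j, true), u)) ∪
    univ.filter (fun j => x (j, false) = v) ∪
    univ.filter (fun j => x (j, false) = u) ∪ univ.filter (fun j => x (j, true) = u) with hF
  have hFc : #F < Fintype.card (Fin m) := by
    rw [Fintype.card_fin]
    refine lt_of_le_of_lt ?_ hm
    have h1 := card_nbr_le h v false
    have h2 := card_nbr_le h u true
    have h3 := card_lab_le h v false
    have h4 := card_lab_le h u false
    have h5 := card_lab_le h u true
    rw [hF]
    refine (card_union_le _ _).trans ?_
    refine (Nat.add_le_add_right (card_union_le _ _) _).trans ?_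
    refine (Nat.add_le_add_right (Nat.add_le_add_right (card_union_le _ _) _) _).trans ?_
    refine (Nat.add_le_add_right (Nat.add_le_add_right
      (Nat.add_le_add_right (card_union_le _ _) _) _) _).trans ?_
    refine (Nat.add_le_add_right (Nat.add_le_add_right
      (Nat.add_le_add_right (Nat.add_le_add_right (card_union_le _ _) _) _) _) _).trans ?_
    linarith
  obtain ⟨j, hj⟩ : ∃ j, j ∉ F := by
    by_contra hcon
    push Not at hcon
    have : F = univ := by ext; simp [hcon]
    rw [this, card_univ] at hFc
    exact lt_irrefl _ hFc
  simp only [hF, mem_union, mem_filter, mem_univ, true_and, not_or, not_exists] at hj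
  obtain ⟨⟨⟨⟨⟨hjb, hj1⟩, hj2⟩, hj3⟩, hj4⟩, hj5⟩ := hj
  have hij : j ≠ i := fun hh => hjb (hh ▸ hi)
  refine ⟨(i, false), (j, false), ?_⟩
  set x' := x ∘ Equiv.swap (i, false) (j, false) with hx'
  have hei : ed x' i = s(x (j, false), v) := by
    simp only [ed, hx', Function.comp]
    rw [Equiv.swap_apply_left, Equiv.swap_apply_of_ne_of_ne (by simp) (by simp)]
  have hej : ed x' j = s(x (j, true), u) := by
    simp only [ed, hx', Function.comp]
    rw [Equiv.swap_apply_right, Equiv.swap_apply_of_ne_of_ne (by simp) (by simp), Sym2.eq_swap]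
  have hel : ∀ l, l ≠ i → l ≠ j → ed x' l = ed x l := by
    intro l h1 h2
    simp only [ed, hx', Function.comp]
    rw [Equiv.swap_apply_of_ne_of_ne (by simp [h1]) (by simp [h2]),
      Equiv.swap_apply_of_ne_of_ne (by simp) (by simp)]
  have hijne : ed x' i ≠ ed x' j := by
    rw [hei, hej]
    intro hh
    simp only [Sym2.eq_iff] at hh
    rcases hh with ⟨h1, h2⟩ | ⟨h1, h2⟩
    · exact hjb (mem_bad.mpr (Or.inl h1))
    · exact hj4 h1
  have hbd : ∀ l, l ∈ bad x' ↔ (ed x' l).IsDiag ∨ ∃ j, j ≠ l ∧ ed x' j = ed x' l := by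
    intro l; simp [bad]
  have hbd0 : ∀ l, l ∈ bad x ↔ (ed x l).IsDiag ∨ ∃ j, j ≠ l ∧ ed x j = ed x l := by
    intro l; simp [bad]
  have hinb : i ∉ bad x' := by
    rw [hbd]
    rintro (h1 | ⟨l, hl, hl2⟩)
    · rw [hei] at h1
      exact hj3 (by simpa using h1)
    · by_cases hlj : l = j
      · exact hijne (by rw [← hl2, hlj])
      · rw [hel l hl hlj, hei] at hl2
        exact hj1 l hl2
  have hjnb : j ∉ bad x' := by
    rw [hbd]
    rintro (h1 | ⟨l, hl, hl2⟩)
    · rw [hej] at h1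
      exact hj5 (by simpa using h1)
    · by_cases hlj : l = i
      · exact hijne (by rw [← hl2, hlj])
      · rw [hel l hlj hl, hej] at hl2
        exact hj2 l hl2
  refine card_lt_card ?_
  refine (ssubset_iff_of_subset ?_).mpr ⟨i, hi, hinb⟩
  intro l hl
  have hli : l ≠ i := fun hh => hinb (hh ▸ hl)
  have hlj : l ≠ j := fun hh => hjnb (hh ▸ hl)
  have hl' := hl
  rw [hbd, hel l hli hlj] at hl'
  rw [hbd0]
  rcases hl' with h1 | ⟨k, hk, hk2⟩
  · exact Or.inl h1
  · right
    refine ⟨k, hk, ?_⟩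
    have hki : k ≠ i := by
      rintro rfl
      exact hinb ((hbd k).mpr (Or.inr ⟨l, hli, by rw [hk2, hel l hli hlj]⟩))
    have hkj : k ≠ j := by
      rintro rfl
      exact hjnb ((hbd k).mpr (Or.inr ⟨l, hlj, by rw [hk2, hel l hli hlj]⟩))
    rwa [hel k hki hkj] at hk2

open Classical in
lemma card_bad_le_step {d K k : ℕ} {x : Fin m × Bool → Fin N} (h : IsBal d x)
    (hk : k + 1 ≤ K) (hm : K + 2 * (d * d) + 3 * d < m) :
    #{σ : Equiv.Perm (Fin m × Bool) | #(bad (x ∘ σ)) ≤ k + 1} ≤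
      (1 + (2 * m) ^ 2) * #{σ : Equiv.Perm (Fin m × Bool) | #(bad (x ∘ σ)) ≤ k} := by
  set A : Finset (Equiv.Perm (Fin m × Bool)) := {σ | #(bad (x ∘ σ)) ≤ k} with hA
  set B : Finset (Equiv.Perm (Fin m × Bool)) := {σ | #(bad (x ∘ σ)) ≤ k + 1} with hB
  have hsub : B ⊆ A ∪ (univ ×ˢ A).image
      (fun t : (((Fin m × Bool) × (Fin m × Bool)) × Equiv.Perm (Fin m × Bool)) =>
        t.2 * Equiv.swap t.1.1 t.1.2) := by
    intro σ hσ
    simp only [hB, mem_filter, mem_univ, true_and] at hσ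
    rw [mem_union]
    by_cases h1 : #(bad (x ∘ σ)) ≤ k
    · left; simp [hA, h1]
    · right
      have h2 : (bad (x ∘ σ)).Nonempty := by
        rw [← card_pos]; omega
      obtain ⟨i, hi⟩ := h2
      obtain ⟨p, q, hpq⟩ := exists_switch (h.comp_perm σ) i hi (hσ.trans hk) hm
      rw [mem_image]
      refine ⟨((p, q), σ * Equiv.swap p q), ?_, ?_⟩
      · simp only [mem_product, mem_univ, true_and, hA, mem_filter]
        have : x ∘ ⇑(σ * Equiv.swap p q) = (x ∘ σ) ∘ Equiv.swap p q := by
          ext; simp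
        rw [this]
        omega
      · simp [mul_assoc]
  refine (card_le_card hsub).trans ((card_union_le _ _).trans ?_)
  have h3 := card_image_le (s := (univ ×ˢ A))
    (f := fun t : (((Fin m × Bool) × (Fin m × Bool)) × Equiv.Perm (Fin m × Bool)) =>
        t.2 * Equiv.swap t.1.1 t.1.2)
  rw [card_product] at h3
  have h4 : #(univ : Finset ((Fin m × Bool) × (Fin m × Bool))) = (2 * m) ^ 2 := by
    simp [card_univ]; ring
  rw [h4] at h3
  linarith

open Classical in
lemma card_bad_le {d K : ℕ} {x : Fin m × Bool → Fin N} (h : IsBal d x)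
    (hm : K + 2 * (d * d) + 3 * d < m) : ∀ k ≤ K,
    #{σ : Equiv.Perm (Fin m × Bool) | #(bad (x ∘ σ)) ≤ k} ≤
      (1 + (2 * m) ^ 2) ^ k * #{σ : Equiv.Perm (Fin m × Bool) | bad (x ∘ σ) = ∅} := by
  intro k
  induction k with
  | zero => intro _; simp
  | succ k ih =>
    intro hk
    refine (card_bad_le_step h hk hm).trans ?_
    calc _ ≤ (1 + (2 * m) ^ 2) * ((1 + (2 * m) ^ 2) ^ k *
          #{σ : Equiv.Perm (Fin m × Bool) | bad (x ∘ σ) = ∅}) :=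
          Nat.mul_le_mul_left _ (ih (by omega))
      _ = _ := by ring

lemma expect_perm_mul_right {α : Type*} [Fintype α] [DecidableEq α] (F : Equiv.Perm α → ℝ)
    (g : Equiv.Perm α) : 𝔼 σ, F (σ * g) = 𝔼 σ, F σ :=
  Fintype.expect_equiv (Equiv.mulRight g) _ _ fun _ => rfl

lemma expect_perm_mul_left {α : Type*} [Fintype α] [DecidableEq α] (F : Equiv.Perm α → ℝ)
    (g : Equiv.Perm α) : 𝔼 σ, F (g * σ) = 𝔼 σ, F σ :=
  Fintype.expect_equiv (Equiv.mulLeft g) _ _ fun _ => rfl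

/-- indicator of equality of two labels -/
def eqi (x : Fin m × Bool → Fin N) (p q : Fin m × Bool) : ℝ := if x p = x q then 1 else 0

lemma eqi_nonneg (x : Fin m × Bool → Fin N) (p q : Fin m × Bool) : 0 ≤ eqi x p q := by
  unfold eqi; split_ifs <;> norm_num

lemma sum_eqi_le {d : ℕ} {x : Fin m × Bool → Fin N} (h : IsBal d x) (p : Fin m × Bool)
    (A : Finset (Fin m × Bool)) : ∑ q ∈ A, eqi x p q ≤ d := by
  calc ∑ q ∈ A, eqi x p q ≤ ∑ q, eqi x p q :=
        sum_le_sum_of_subset_of_nonneg (subset_univ _) fun _ _ _ => eqi_nonneg _ _ _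
    _ = d := by
        simp only [eqi, sum_boole]
        rw [← h (x p)]
        congr 2
        ext q
        simp [eq_comm]

lemma expect_eqi_le {d : ℕ} {x : Fin m × Bool → Fin N} (h : IsBal d x) {p q : Fin m × Bool}
    (hpq : p ≠ q) : (2 * m - 1 : ℝ) * 𝔼 σ : Equiv.Perm (Fin m × Bool), eqi (x ∘ σ) p q ≤ d := by
  have h1 : ∀ t ∈ univ.erase p, 𝔼 σ : Equiv.Perm (Fin m × Bool), eqi (x ∘ σ) p t =
      𝔼 σ : Equiv.Perm (Fin m × Bool), eqi (x ∘ σ) p q := by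
    intro t ht
    rw [← expect_perm_mul_right _ (Equiv.swap t q)]
    refine expect_congr rfl fun σ _ => ?_
    simp only [eqi, Function.comp, Equiv.Perm.mul_apply, Equiv.swap_apply_left]
    rw [Equiv.swap_apply_of_ne_of_ne (ne_of_mem_erase ht).symm hpq]
  have h2 : (2 * m - 1 : ℝ) * 𝔼 σ : Equiv.Perm (Fin m × Bool), eqi (x ∘ σ) p q =
      ∑ t ∈ univ.erase p, 𝔼 σ : Equiv.Perm (Fin m × Bool), eqi (x ∘ σ) p t := by
    rw [sum_congr rfl h1, sum_const, card_erase_of_mem (mem_univ _), card_univ, nsmul_eq_mul]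
    have : 1 ≤ Fintype.card (Fin m × Bool) := Fintype.card_pos_iff.mpr ⟨p⟩
    rw [Nat.cast_sub this]
    simp
    left; ring
  rw [h2, ← expect_sum_comm]
  calc _ ≤ 𝔼 _σ : Equiv.Perm (Fin m × Bool), (d : ℝ) :=
        expect_le_expect fun σ _ => sum_eqi_le (h.comp_perm σ) _ _
    _ = d := by simp

lemma expect_eqi_mul_le {d : ℕ} {x : Fin m × Bool → Fin N} (h : IsBal d x)
    {p q r s : Fin m × Bool} (hpq : p ≠ q) (hrs : r ≠ s) (hps : p ≠ s) (hqs : q ≠ s)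
    (hpr : p ≠ r) (hqr : q ≠ r) :
    (2 * m - 3 : ℝ) * 𝔼 σ : Equiv.Perm (Fin m × Bool), eqi (x ∘ σ) p q * eqi (x ∘ σ) r s ≤
      d * 𝔼 σ : Equiv.Perm (Fin m × Bool), eqi (x ∘ σ) p q := by
  have h1 : ∀ t ∈ ((univ.erase p).erase q).erase r,
      𝔼 σ : Equiv.Perm (Fin m × Bool), eqi (x ∘ σ) p q * eqi (x ∘ σ) r t =
      𝔼 σ : Equiv.Perm (Fin m × Bool), eqi (x ∘ σ) p q * eqi (x ∘ σ) r s := by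
    intro t ht
    simp only [mem_erase, mem_univ, and_true] at ht
    rw [← expect_perm_mul_right _ (Equiv.swap t s)]
    refine expect_congr rfl fun σ _ => ?_
    have e1 := Equiv.swap_apply_of_ne_of_ne (Ne.symm ht.1) hrs
    have e2 := Equiv.swap_apply_of_ne_of_ne (Ne.symm ht.2.1) hqs
    have e3 := Equiv.swap_apply_of_ne_of_ne (Ne.symm ht.2.2) hps
    simp only [eqi, Function.comp, Equiv.Perm.mul_apply, Equiv.swap_apply_left, e1, e2, e3]
  have hcard : (#(((univ.erase p).erase q).erase r) : ℝ) = 2 * m - 3 := by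
    have e1 : q ∈ univ.erase p := by simp [hpq.symm]
    have e2 : r ∈ (univ.erase p).erase q := by simp [hqr.symm, hpr.symm]
    have h4 := card_erase_add_one e2
    have h5 := card_erase_add_one e1
    have h6 := card_erase_add_one (mem_univ p)
    have h7 : #(univ : Finset (Fin m × Bool)) = 2 * m := by simp [card_univ]; ring
    have : #(((univ.erase p).erase q).erase r) + 3 = 2 * m := by omega
    have h8 : (#(((univ.erase p).erase q).erase r) : ℝ) + 3 = 2 * m := by exact_mod_cast this
    linarith
  have h2 : (2 * m - 3 : ℝ) *
        𝔼 σ : Equiv.Perm (Fin m × Bool), eqi (x ∘ σ) p q * eqi (x ∘ σ) r s =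
      ∑ t ∈ ((univ.erase p).erase q).erase r,
        𝔼 σ : Equiv.Perm (Fin m × Bool), eqi (x ∘ σ) p q * eqi (x ∘ σ) r t := by
    rw [sum_congr rfl h1, sum_const, nsmul_eq_mul, hcard]
  rw [h2, ← expect_sum_comm, mul_expect]
  refine expect_le_expect fun σ _ => ?_
  rw [← mul_sum, mul_comm]
  exact mul_le_mul_of_nonneg_right (sum_eqi_le (h.comp_perm σ) _ _) (eqi_nonneg _ _ _)

/-- number of loops -/
def loops (x : Fin m × Bool → Fin N) : ℝ := ∑ i, eqi x (i, false) (i, true)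

lemma expect_loops_le {d : ℕ} {x : Fin m × Bool → Fin N} (h : IsBal d x) (hm : 1 ≤ m) :
    𝔼 σ : Equiv.Perm (Fin m × Bool), loops (x ∘ σ) ≤ d := by
  have hm' : (1 : ℝ) ≤ m := by exact_mod_cast hm
  simp only [loops]
  rw [expect_sum_comm]
  calc _ ≤ ∑ _i : Fin m, (d : ℝ) / (2 * m - 1) := by
        refine sum_le_sum fun i _ => ?_
        rw [le_div_iff₀ (by linarith), mul_comm]
        exact expect_eqi_le h (by simp)
    _ = m * (d / (2 * m - 1)) := by simp
    _ ≤ d := by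
        rw [mul_div_assoc', div_le_iff₀ (by linarith)]
        have : (0 : ℝ) ≤ d := by positivity
        nlinarith

lemma card_bad_le_eqi (x : Fin m × Bool → Fin N) :
    (#(bad x) : ℝ) ≤ loops x + ∑ i, ∑ j ∈ univ.erase i,
      (eqi x (i, false) (j, false) * eqi x (i, true) (j, true) +
        eqi x (i, false) (j, true) * eqi x (i, true) (j, false)) := by
  classical
  have h0 : (#(bad x) : ℝ) = ∑ i, if i ∈ bad x then (1 : ℝ) else 0 := by simp
  rw [h0, loops, ← sum_add_distrib]
  refine sum_le_sum fun i _ => ?_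
  have hnn : ∀ j, 0 ≤ (eqi x (i, false) (j, false) * eqi x (i, true) (j, true) +
        eqi x (i, false) (j, true) * eqi x (i, true) (j, false)) := by
    intro j
    have := eqi_nonneg x
    have a1 := mul_nonneg (this (i, false) (j, false)) (this (i, true) (j, true))
    have a2 := mul_nonneg (this (i, false) (j, true)) (this (i, true) (j, false))
    linarith
  have hs : 0 ≤ ∑ j ∈ univ.erase i,
      (eqi x (i, false) (j, false) * eqi x (i, true) (j, true) +
        eqi x (i, false) (j, true) * eqi x (i, true) (j, false)) := sum_nonneg fun j _ => hnn j
  split_ifs with hi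
  · rcases mem_bad.mp hi with h1 | ⟨j, hj, h1⟩
    · simp only [eqi, h1] at *
      simp only [if_true] at *
      linarith
    · have h2 := single_le_sum (f := fun j =>
        (eqi x (i, false) (j, false) * eqi x (i, true) (j, true) +
        eqi x (i, false) (j, true) * eqi x (i, true) (j, false))) (fun j _ => hnn j)
        (mem_erase.mpr ⟨hj, mem_univ j⟩)
      have h3 := eqi_nonneg x (i, false) (i, true)
      refine le_trans ?_ (le_add_of_nonneg_left h3)
      refine le_trans ?_ h2
      simp only [ed, Sym2.eq_iff] at h1
      have a1 := mul_nonneg (eqi_nonneg x (i, false) (j, false)) (eqi_nonneg x (i, true) (j, true))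
      have a2 := mul_nonneg (eqi_nonneg x (i, false) (j, true)) (eqi_nonneg x (i, true) (j, false))
      rcases h1 with ⟨h1, h4⟩ | ⟨h1, h4⟩
      · have : eqi x (i, false) (j, false) * eqi x (i, true) (j, true) = 1 := by
          simp [eqi, h1, h4]
        simp only [this]
        linarith
      · have : eqi x (i, false) (j, true) * eqi x (i, true) (j, false) = 1 := by
          simp [eqi, h1, h4]
        simp only [this]
        linarith
  · have := eqi_nonneg x (i, false) (i, true)
    linarith

lemma expect_bad_le {d : ℕ} {x : Fin m × Bool → Fin N} (h : IsBal d x) (hm : 3 ≤ m) :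
    𝔼 σ : Equiv.Perm (Fin m × Bool), (#(bad (x ∘ σ)) : ℝ) ≤ d + 2 * d ^ 2 := by
  have hm' : (3 : ℝ) ≤ m := by exact_mod_cast hm
  have hd0 : (0 : ℝ) ≤ d := by positivity
  have hpair : ∀ {p q r s : Fin m × Bool} (_ : p ≠ q) (_ : r ≠ s) (_ : p ≠ s) (_ : q ≠ s)
    (_ : p ≠ r) (_ : q ≠ r), 𝔼 σ : Equiv.Perm (Fin m × Bool),
      eqi (x ∘ σ) p q * eqi (x ∘ σ) r s ≤ (d : ℝ) ^ 2 / m ^ 2 := by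
    intro p q r s h1 h2 h3 h4 h5 h6
    have a1 := expect_eqi_mul_le h h1 h2 h3 h4 h5 h6
    have a2 := expect_eqi_le h h1
    set E1 := 𝔼 σ : Equiv.Perm (Fin m × Bool), eqi (x ∘ σ) p q * eqi (x ∘ σ) r s
    set E2 := 𝔼 σ : Equiv.Perm (Fin m × Bool), eqi (x ∘ σ) p q
    have hE1 : 0 ≤ E1 := expect_nonneg fun σ _ => mul_nonneg (eqi_nonneg _ _ _) (eqi_nonneg _ _ _)
    rw [le_div_iff₀ (by positivity)]
    have a3 : (2 * m - 1 : ℝ) * (2 * m - 3) * E1 ≤ d ^ 2 := by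
      calc (2 * m - 1 : ℝ) * (2 * m - 3) * E1 = (2 * m - 1 : ℝ) * ((2 * m - 3) * E1) := by ring
        _ ≤ (2 * m - 1 : ℝ) * (d * E2) := mul_le_mul_of_nonneg_left a1 (by linarith)
        _ = d * ((2 * m - 1 : ℝ) * E2) := by ring
        _ ≤ d * d := mul_le_mul_of_nonneg_left a2 hd0
        _ = d ^ 2 := by ring
    refine le_trans ?_ a3
    rw [mul_comm]
    refine mul_le_mul_of_nonneg_right ?_ hE1
    nlinarith
  calc _ ≤ 𝔼 σ : Equiv.Perm (Fin m × Bool), (loops (x ∘ σ) + ∑ i, ∑ j ∈ univ.erase i,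
      (eqi (x ∘ σ) (i, false) (j, false) * eqi (x ∘ σ) (i, true) (j, true) +
        eqi (x ∘ σ) (i, false) (j, true) * eqi (x ∘ σ) (i, true) (j, false))) :=
        expect_le_expect fun σ _ => card_bad_le_eqi _
    _ ≤ d + ∑ i : Fin m, ∑ j ∈ univ.erase i, ((d : ℝ) ^ 2 / m ^ 2 + (d : ℝ) ^ 2 / m ^ 2) := by
        rw [expect_add_distrib]
        refine add_le_add (expect_loops_le h (by omega)) ?_
        rw [expect_sum_comm]
        refine sum_le_sum fun i _ => ?_
        rw [expect_sum_comm]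
        refine sum_le_sum fun j hj => ?_
        have hji : i ≠ j := (ne_of_mem_erase hj).symm
        rw [expect_add_distrib]
        refine add_le_add (hpair ?_ ?_ ?_ ?_ ?_ ?_) (hpair ?_ ?_ ?_ ?_ ?_ ?_) <;>
          simp [hji, hji.symm]
    _ ≤ d + ∑ i : Fin m, ∑ j : Fin m, ((d : ℝ) ^ 2 / m ^ 2 + (d : ℝ) ^ 2 / m ^ 2) := by
        gcongr
        exact subset_univ _
    _ = d + 2 * d ^ 2 := by
        simp only [sum_const, card_univ, Fintype.card_fin, nsmul_eq_mul]
        have : (m : ℝ) ≠ 0 := by linarith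
        field_simp
        ring

open Classical in
/-- A polynomial lower bound for the probability that the configuration model is simple. -/
lemma card_simple_ge {d : ℕ} {x : Fin m × Bool → Fin N} (h : IsBal d x) (hd : 1 ≤ d)
    (hm : 11 * d ^ 2 < m) :
    (Fintype.card (Equiv.Perm (Fin m × Bool)) : ℝ) ≤
      2 * ((1 + (2 * m) ^ 2 : ℕ) : ℝ) ^ (6 * d ^ 2) *
        #{σ : Equiv.Perm (Fin m × Bool) | bad (x ∘ σ) = ∅} := by
  have hdd : d ≤ d ^ 2 := by nlinarith
  have h1 := card_bad_le (K := 6 * d ^ 2) h (by nlinarith) (6 * d ^ 2) le_rfl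
  have h2 := expect_bad_le h (by nlinarith)
  set T := Fintype.card (Equiv.Perm (Fin m × Bool))
  have h3 : ∑ σ : Equiv.Perm (Fin m × Bool), (#(bad (x ∘ σ)) : ℝ) ≤ T * (3 * d ^ 2) := by
    rw [← Fintype.card_mul_expect]
    refine mul_le_mul_of_nonneg_left ?_ (by positivity)
    refine h2.trans ?_
    have : (d : ℝ) ≤ d ^ 2 := by exact_mod_cast hdd
    linarith
  set A : Finset (Equiv.Perm (Fin m × Bool)) := univ.filter fun σ => #(bad (x ∘ σ)) ≤ 6 * d ^ 2
  have h4 : (T : ℝ) ≤ 2 * #A := by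
    have h5 : (#(univ.filter fun σ : Equiv.Perm (Fin m × Bool) => ¬ #(bad (x ∘ σ)) ≤ 6 * d ^ 2) : ℝ)
        * (6 * d ^ 2) ≤ T * (3 * d ^ 2) := by
      refine le_trans ?_ h3
      rw [← nsmul_eq_mul, ← sum_const]
      refine le_trans (sum_le_sum (g := fun σ : Equiv.Perm (Fin m × Bool) =>
        (#(bad (x ∘ σ)) : ℝ)) ?_) (sum_le_sum_of_subset_of_nonneg (subset_univ _) fun _ _ _ => by positivity)
      intro σ hσ
      simp only [mem_filter, mem_univ, true_and, not_le] at hσ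
      exact_mod_cast hσ.le
    have h6 : #A + #(univ.filter fun σ : Equiv.Perm (Fin m × Bool) =>
        ¬ #(bad (x ∘ σ)) ≤ 6 * d ^ 2) = T := by
      rw [card_filter_add_card_filter_not, card_univ]
    have h7 : (#A : ℝ) + #(univ.filter fun σ : Equiv.Perm (Fin m × Bool) =>
        ¬ #(bad (x ∘ σ)) ≤ 6 * d ^ 2) = T := by exact_mod_cast h6
    have hd1 : (0 : ℝ) < 3 * d ^ 2 := by positivity
    have h8 : (#(univ.filter fun σ : Equiv.Perm (Fin m × Bool) =>
      ¬ #(bad (x ∘ σ)) ≤ 6 * d ^ 2) : ℝ) * 2 ≤ T := by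
      refine le_of_mul_le_mul_right ?_ hd1
      linarith
    linarith
  refine h4.trans ?_
  rw [mul_assoc]
  refine mul_le_mul_of_nonneg_left ?_ (by norm_num)
  exact_mod_cast h1

end Config


/-! ### Part 3: uniformity -/

section Unif
variable {m N : ℕ}

lemma gam_adj {x : Fin m × Bool → Fin N} {u v : Fin N} :
    (gam x).Adj u v ↔ (∃ i, ed x i = s(u, v)) ∧ u ≠ v := by
  simp [gam, SimpleGraph.fromEdgeSet_adj]

lemma cutCount_eq (G : SimpleGraph (Fin N)) [DecidableRel G.Adj] (s : Finset (Fin N)) :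
    cutCount G s = #{p : Fin N × Fin N | p.1 ∈ s ∧ p.2 ∉ s ∧ G.Adj p.1 p.2} := by
  rw [cutCount, Nat.card_eq_fintype_card, Fintype.card_subtype]

open Classical in
lemma cutCount_gam_le (x : Fin m × Bool → Fin N) (s : Finset (Fin N)) :
    cutCount (gam x) s ≤ cutS x s := by
  rw [cutCount_eq, cutS]
  rcases isEmpty_or_nonempty (Fin m) with hm | hm
  · refine le_of_eq_of_le (card_eq_zero.mpr ?_) (Nat.zero_le _)
    rw [filter_eq_empty_iff]
    intro p _ h
    obtain ⟨i, hi⟩ := (gam_adj.mp h.2.2).1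
    exact hm.elim i
  have : ∀ p : Fin N × Fin N, ∃ i : Fin m,
      (p.1 ∈ s ∧ p.2 ∉ s ∧ (gam x).Adj p.1 p.2) → ed x i = s(p.1, p.2) := by
    intro p
    by_cases h : (p.1 ∈ s ∧ p.2 ∉ s ∧ (gam x).Adj p.1 p.2)
    · obtain ⟨i, hi⟩ := (gam_adj.mp h.2.2).1
      exact ⟨i, fun _ => hi⟩
    · exact ⟨hm.some, fun hh => absurd hh h⟩
  choose f hf using this
  refine card_le_card_of_injOn f ?_ ?_
  · intro p hp
    simp only [coe_filter, mem_univ, true_and, Set.mem_ofPred_eq] at hp ⊢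
    have := hf p hp
    simp only [ed, Sym2.eq_iff] at this
    rcases this with ⟨h1, h2⟩ | ⟨h1, h2⟩ <;> rw [h1, h2] <;> tauto
  · intro p hp q hq hpq
    simp only [coe_filter, mem_univ, true_and, Set.mem_ofPred_eq] at hp hq
    have h1 := hf p hp
    have h2 := hf q hq
    rw [hpq, h2] at h1
    simp only [Sym2.eq_iff] at h1
    rcases h1 with ⟨h1, h2⟩ | ⟨h1, h2⟩
    · exact Prod.ext h1.symm h2.symm
    · rw [h1] at hq; exact absurd hq.1 hp.2.1

lemma mcut_gam_le {α : ℚ} {n : ℕ} (hn : ⌊α * (N : ℚ)⌋₊ = n) (x : Fin m × Bool → Fin N) :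
    mcut α (gam x) ≤ fS n x := by
  rw [mcut, fS, hn]
  exact sup_mono_fun fun s _ => cutCount_gam_le x s

open Classical in
lemma card_sym2_fiber (z : Sym2 (Fin N)) :
    #{p : Fin N × Fin N | s(p.1, p.2) = z} = if z.IsDiag then 1 else 2 := by
  induction z using Sym2.ind with
  | _ a b =>
    have : ({p : Fin N × Fin N | s(p.1, p.2) = s(a, b)} : Finset _) = {(a, b), (b, a)} := by
      ext ⟨u, v⟩; simp
    rw [this]
    split_ifs with h
    · have : a = b := by simpa using h
      subst this; simp
    · have : a ≠ b := by simpa using h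
      rw [card_pair]; simp [this]

open Classical in
lemma card_ed_fiber (z : Fin m → Sym2 (Fin N)) :
    #{x : Fin m × Bool → Fin N | ed x = z} = ∏ i, if (z i).IsDiag then 1 else 2 := by
  simp_rw [← card_sym2_fiber]
  rw [← Fintype.card_piFinset]
  refine card_bij (fun x _ i => (x (i, false), x (i, true))) ?_ ?_ ?_
  · intro x hx
    simp only [mem_filter, mem_univ, true_and] at hx
    simp only [Fintype.mem_piFinset, mem_filter, mem_univ, true_and]
    intro i
    exact congrFun hx i
  · intro x _ y _ h
    ext1 ⟨i, b⟩
    have := congrFun h i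
    simp only [Prod.mk.injEq] at this
    cases b
    · exact this.1
    · exact this.2
  · intro w hw
    simp only [Fintype.mem_piFinset, mem_filter, mem_univ, true_and] at hw
    refine ⟨fun p => if p.2 then (w p.1).2 else (w p.1).1, ?_, ?_⟩
    · simp only [mem_filter, mem_univ, true_and]
      ext1 i
      simp [ed, hw i]
    · ext1 i; simp

open Classical in
lemma card_ed_perm (π : Equiv.Perm (Sym2 (Fin N))) (hπ : ∀ z, (π z).IsDiag ↔ z.IsDiag)
    (Φ Ψ : (Fin m → Sym2 (Fin N)) → Prop) (h : ∀ z, Φ z ↔ Ψ (π ∘ z)) :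
    #{x : Fin m × Bool → Fin N | Φ (ed x)} = #{x : Fin m × Bool → Fin N | Ψ (ed x)} := by
  have key : ∀ Φ : (Fin m → Sym2 (Fin N)) → Prop, #{x : Fin m × Bool → Fin N | Φ (ed x)} =
      ∑ z : Fin m → Sym2 (Fin N), if Φ z then ∏ i, (if (z i).IsDiag then 1 else 2) else 0 := by
    intro Φ
    rw [card_eq_sum_card_fiberwise (f := ed) (t := univ) (by simp)]
    refine sum_congr rfl fun z _ => ?_
    split_ifs with hz
    · rw [← card_ed_fiber, filter_filter]
      congr 1
      ext x
      simp only [mem_filter, mem_univ, true_and]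
      constructor
      · exact fun h => h.2
      · intro h; exact ⟨h ▸ hz, h⟩
    · rw [card_eq_zero, filter_eq_empty_iff]
      intro x hx h2
      simp only [mem_filter, mem_univ, true_and] at hx
      exact hz (h2 ▸ hx)
  rw [key, key]
  refine Fintype.sum_equiv (Equiv.arrowCongr (Equiv.refl _) π) _ _ fun z => ?_
  simp only [h z]
  have : (Equiv.arrowCongr (Equiv.refl (Fin m)) π) z = π ∘ z := by
    ext1 i; simp
  rw [this]
  simp [hπ]

lemma exists_sym2_perm (G G' : SimpleGraph (Fin N)) (h : numEdges G = numEdges G') :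
    ∃ π : Equiv.Perm (Sym2 (Fin N)), (∀ z, (π z).IsDiag ↔ z.IsDiag) ∧
      ∀ z, z ∈ G.edgeSet ↔ π z ∈ G'.edgeSet := by
  classical
  set W := {z : Sym2 (Fin N) // ¬ z.IsDiag}
  have hc : ∀ G : SimpleGraph (Fin N), Nat.card {z : W // z.1 ∈ G.edgeSet} = numEdges G := by
    intro G
    rw [numEdges]
    refine Nat.card_congr ⟨fun z => ⟨z.1.1, z.2⟩,
      fun z => ⟨⟨z.1, G.not_isDiag_of_mem_edgeSet z.2⟩, z.2⟩, ?_, ?_⟩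
    · intro z; rfl
    · intro z; rfl
  have hc2 : Fintype.card {z : W // z.1 ∈ G.edgeSet} = Fintype.card {z : W // z.1 ∈ G'.edgeSet} := by
    rw [← Nat.card_eq_fintype_card, ← Nat.card_eq_fintype_card, hc, hc, h]
  set e := Fintype.equivOfCardEq hc2
  set ρ : Equiv.Perm W := e.extendSubtype
  set π := Equiv.Perm.ofSubtype ρ
  have h1 : ∀ z (hz : ¬ z.IsDiag), π z = (ρ ⟨z, hz⟩).1 := fun z hz =>
    Equiv.Perm.ofSubtype_apply_of_mem (p := fun z : Sym2 (Fin N) => ¬ z.IsDiag) ρ hz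
  have h2 : ∀ z : Sym2 (Fin N), z.IsDiag → π z = z := fun z hz =>
    Equiv.Perm.ofSubtype_apply_of_not_mem (p := fun z : Sym2 (Fin N) => ¬ z.IsDiag) ρ (by simpa using hz)
  refine ⟨π, ?_, ?_⟩
  · intro z
    by_cases hz : z.IsDiag
    · rw [h2 z hz]
    · rw [h1 z hz]
      have := (ρ ⟨z, hz⟩).2
      tauto
  · intro z
    by_cases hz : z.IsDiag
    · rw [h2 z hz]
      constructor
      · intro h; exact absurd hz (G.not_isDiag_of_mem_edgeSet h)
      · intro h; exact absurd hz (G'.not_isDiag_of_mem_edgeSet h)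
    · rw [h1 z hz]
      by_cases hzG : z ∈ G.edgeSet
      · have := e.extendSubtype_mem ⟨z, hz⟩ hzG
        simp only [hzG, true_iff]
        exact this
      · have := e.extendSubtype_not_mem ⟨z, hz⟩ hzG
        simp only [hzG, false_iff]
        exact this

lemma gam_eq_iff (x : Fin m × Bool → Fin N) (G : SimpleGraph (Fin N)) :
    gam x = G ↔ ∀ z : Sym2 (Fin N), z ∈ G.edgeSet ↔ z ∈ Set.range (ed x) ∧ ¬ z.IsDiag := by
  rw [gam, ← SimpleGraph.edgeSet_inj, SimpleGraph.edgeSet_fromEdgeSet, Set.ext_iff]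
  refine forall_congr' fun z => ?_
  have : z ∈ Sym2.diagSet ↔ z.IsDiag := by induction z using Sym2.ind; simp
  simp only [Set.mem_sdiff, this]
  tauto

/-- property of the edge sequence -/
def gamP (G : SimpleGraph (Fin N)) (w : Fin m → Sym2 (Fin N)) : Prop :=
  ∀ z : Sym2 (Fin N), z ∈ G.edgeSet ↔ z ∈ Set.range w ∧ ¬ z.IsDiag

/-- property of the edge sequence -/
def simP (w : Fin m → Sym2 (Fin N)) : Prop :=
  ∀ i, ¬ (w i).IsDiag ∧ ∀ j, j ≠ i → w j ≠ w i

lemma gamP_perm {G G' : SimpleGraph (Fin N)} {π : Equiv.Perm (Sym2 (Fin N))}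
    (h1 : ∀ z, (π z).IsDiag ↔ z.IsDiag) (h2 : ∀ z, z ∈ G.edgeSet ↔ π z ∈ G'.edgeSet)
    (w : Fin m → Sym2 (Fin N)) : gamP G w ↔ gamP G' (π ∘ w) := by
  unfold gamP
  rw [← π.forall_congr_right (q := fun z => z ∈ G'.edgeSet ↔ z ∈ Set.range (π ∘ w) ∧ ¬ z.IsDiag)]
  refine forall_congr' fun z => ?_
  rw [h1, ← h2]
  simp

lemma simP_perm {π : Equiv.Perm (Sym2 (Fin N))}
    (h1 : ∀ z, (π z).IsDiag ↔ z.IsDiag) 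
    (w : Fin m → Sym2 (Fin N)) : simP w ↔ simP (π ∘ w) := by
  simp [simP, h1]

lemma bad_eq_empty_iff (x : Fin m × Bool → Fin N) : bad x = ∅ ↔ simP (ed x) := by
  classical
  rw [bad, filter_eq_empty_iff, simP]
  simp only [mem_univ, true_implies, not_or, not_exists, not_and, ne_eq]

open Classical in
/-- number of sequences with given graph depends only on the number of edges -/
lemma card_gam_eq (G G' : SimpleGraph (Fin N)) (h : numEdges G = numEdges G') :
    #{x : Fin m × Bool → Fin N | gam x = G} = #{x : Fin m × Bool → Fin N | gam x = G'} := by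
  obtain ⟨π, h1, h2⟩ := exists_sym2_perm G G' h
  have hh : ∀ (G : SimpleGraph (Fin N)) (x : Fin m × Bool → Fin N),
    gam x = G ↔ gamP G (ed x) := fun G x => gam_eq_iff x G
  simp_rw [hh]
  exact card_ed_perm π h1 (gamP G) (gamP G') (gamP_perm h1 h2)

open Classical in
lemma card_simple_gam_eq (G G' : SimpleGraph (Fin N)) (h : numEdges G = numEdges G') :
    #{x : Fin m × Bool → Fin N | bad x = ∅ ∧ gam x = G} =
      #{x : Fin m × Bool → Fin N | bad x = ∅ ∧ gam x = G'} := by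
  obtain ⟨π, h1, h2⟩ := exists_sym2_perm G G' h
  have hh : ∀ (G : SimpleGraph (Fin N)) (x : Fin m × Bool → Fin N),
    gam x = G ↔ gamP G (ed x) := fun G x => gam_eq_iff x G
  simp_rw [hh, bad_eq_empty_iff]
  convert card_ed_perm π h1 (fun w => simP w ∧ gamP G w) (fun w => simP w ∧ gamP G' w)
    fun w => and_congr (simP_perm h1 w) (gamP_perm h1 h2 w)

lemma card_nbr_gam {x : Fin m × Bool → Fin N} (hx : bad x = ∅) (v : Fin N) :
    Nat.card ((gam x).neighborSet v) = #{p : Fin m × Bool | x p = v} := by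
  classical
  rw [bad_eq_empty_iff] at hx
  rw [Nat.card_eq_fintype_card, ← Set.toFinset_card]
  symm
  have hed : ∀ p : Fin m × Bool, ed x p.1 = s(x p, x (par p)) := by
    rintro ⟨i, b⟩
    cases b
    · simp [ed, par]
    · simp [ed, par, Sym2.eq_swap]
  refine card_bij (fun p _ => x (par p)) ?_ ?_ ?_
  · intro p hp
    simp only [mem_filter, mem_univ, true_and] at hp
    simp only [Set.mem_toFinset, SimpleGraph.mem_neighborSet, gam_adj]
    refine ⟨⟨p.1, by rw [hed, hp]⟩, ?_⟩
    have := (hx p.1).1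
    rw [hed, hp] at this
    simpa using this
  · intro p hp q hq hpq
    simp only [mem_filter, mem_univ, true_and] at hp hq
    have h1 : ed x p.1 = ed x q.1 := by rw [hed, hed, hp, hq, hpq]
    have h2 : p.1 = q.1 := by
      by_contra hne
      exact (hx q.1).2 p.1 hne h1
    by_contra hne
    have h3 : q = par p := by
      apply Prod.ext
      · simp [par, h2]
      · have : p.2 ≠ q.2 := fun h => hne (Prod.ext h2 h)
        simp only [par]
        revert this
        cases p.2 <;> cases q.2 <;> simp
    have := (hx p.1).1
    rw [hed, ← h3, hp, hq] at this
    simp at this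
  · intro u hu
    simp only [Set.mem_toFinset, SimpleGraph.mem_neighborSet, gam_adj] at hu
    obtain ⟨⟨i, hi⟩, hne⟩ := hu
    simp only [ed, Sym2.eq_iff] at hi
    rcases hi with ⟨h1, h2⟩ | ⟨h1, h2⟩
    · exact ⟨(i, false), by simpa using h1, by simpa [par] using h2⟩
    · exact ⟨(i, true), by simpa using h2, by simpa [par] using h1⟩

lemma numEdges_of_reg {d : ℕ} {G : SimpleGraph (Fin N)} (h : IsDReg d G) :
    2 * numEdges G = N * d := by
  classical
  have h1 := G.sum_degrees_eq_twice_card_edges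
  have h2 : numEdges G = #G.edgeFinset := by
    rw [numEdges, Nat.card_eq_fintype_card, ← Set.toFinset_card]; rfl
  rw [h2, ← h1]
  have : ∀ v, G.degree v = d := by
    intro v
    rw [← h v, Nat.card_eq_fintype_card, SimpleGraph.card_neighborSet_eq_degree]
  simp [this]

lemma exists_perm_of_bal {d : ℕ} {x y : Fin m × Bool → Fin N} (hx : IsBal d x) (hy : IsBal d y) :
    ∃ τ : Equiv.Perm (Fin m × Bool), x ∘ τ = y := by
  classical
  have hc : ∀ v, Fintype.card {p // y p = v} = Fintype.card {p // x p = v} := by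
    intro v
    rw [Fintype.card_subtype, Fintype.card_subtype, hx v, hy v]
  refine ⟨(Equiv.sigmaFiberEquiv y).symm.trans ((Equiv.sigmaCongrRight fun v =>
    Fintype.equivOfCardEq (hc v)).trans (Equiv.sigmaFiberEquiv x)), ?_⟩
  ext1 p
  simp only [Function.comp, Equiv.trans_apply, Equiv.sigmaFiberEquiv, Equiv.coe_fn_symm_mk,
    Equiv.sigmaCongrRight_apply, Equiv.coe_fn_mk]
  exact (Fintype.equivOfCardEq (hc (y p)) ⟨p, rfl⟩).2

open Classical in
lemma card_perm_fiber {d : ℕ} {x y : Fin m × Bool → Fin N} (hx : IsBal d x) (hy : IsBal d y) :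
    #{σ : Equiv.Perm (Fin m × Bool) | x ∘ σ = y} = #{σ : Equiv.Perm (Fin m × Bool) | x ∘ σ = x} := by
  obtain ⟨τ, hτ⟩ := exists_perm_of_bal hx hy
  refine card_equiv (Equiv.mulRight τ⁻¹) fun σ => ?_
  simp only [mem_filter, mem_univ, true_and, Equiv.coe_mulRight]
  rw [← hτ]
  constructor
  · intro h
    ext1 p
    have := congrFun h (τ⁻¹ p)
    simpa using this
  · intro h
    ext1 p
    have := congrFun h (τ p)
    simpa using this

open Classical in
/-- Uniformity of the conditioned configuration model. -/
lemma sum_simple_eq {d : ℕ} {x : Fin m × Bool → Fin N} (hx : IsBal d x)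
    (hne : ({σ : Equiv.Perm (Fin m × Bool) | bad (x ∘ σ) = ∅} : Finset _).Nonempty)
    (φ : SimpleGraph (Fin N) → ℝ) :
    (regFinset N d).Nonempty ∧
    regExp N d φ = (∑ σ ∈ ({σ : Equiv.Perm (Fin m × Bool) | bad (x ∘ σ) = ∅} : Finset _),
      φ (gam (x ∘ σ))) / #({σ : Equiv.Perm (Fin m × Bool) | bad (x ∘ σ) = ∅} : Finset _) := by
  set A : Finset (Equiv.Perm (Fin m × Bool)) := {σ | bad (x ∘ σ) = ∅} with hA
  have hreg : ∀ σ ∈ A, gam (x ∘ σ) ∈ regFinset N d := by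
    intro σ hσ
    simp only [hA, mem_filter, mem_univ, true_and] at hσ
    simp only [regFinset, mem_filter, mem_univ, true_and]
    intro v
    rw [card_nbr_gam hσ]
    exact hx.comp_perm σ v
  have hT : ∀ G ∈ regFinset N d, #(A.filter fun σ : Equiv.Perm (Fin m × Bool) => gam (x ∘ σ) = G) =
      #{y : Fin m × Bool → Fin N | bad y = ∅ ∧ gam y = G} *
        #{σ : Equiv.Perm (Fin m × Bool) | x ∘ σ = x} := by
    intro G hG
    simp only [regFinset, mem_filter, mem_univ, true_and] at hG
    rw [card_eq_sum_card_fiberwise (f := fun σ : Equiv.Perm (Fin m × Bool) => x ∘ σ)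
      (t := {y : Fin m × Bool → Fin N | bad y = ∅ ∧ gam y = G})]
    · rw [← smul_eq_mul, ← sum_const]
      refine sum_congr rfl fun y hy => ?_
      simp only [mem_filter, mem_univ, true_and] at hy
      have hyb : IsBal d y := by
        intro v
        rw [← card_nbr_gam hy.1, hy.2]
        exact hG v
      rw [← card_perm_fiber hx hyb, hA, filter_filter, filter_filter]
      congr 1
      ext σ
      simp only [mem_filter, mem_univ, true_and]
      constructor
      · exact fun h => h.2.2
      · intro h; rw [h]; exact ⟨hy.1, hy.2, rfl⟩
    · intro σ hσ
      simpa [hA] using hσ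
  obtain ⟨σ0, hσ0⟩ := hne
  have hG0 := hreg σ0 hσ0
  set G0 := gam (x ∘ σ0) with hG0d
  set c := #(A.filter fun σ : Equiv.Perm (Fin m × Bool) => gam (x ∘ σ) = G0) with hc
  have hconst : ∀ G ∈ regFinset N d, #(A.filter fun σ : Equiv.Perm (Fin m × Bool) => gam (x ∘ σ) = G) = c := by
    intro G hG
    rw [hT G hG, hc, hT G0 hG0]
    congr 1
    apply card_simple_gam_eq
    have h1 := numEdges_of_reg (G := G) (d := d) (by simpa [regFinset] using hG)
    have h2 := numEdges_of_reg (G := G0) (d := d) (by simpa [regFinset] using hG0)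
    omega
  have hcpos : 0 < c := by
    rw [hc, card_pos]
    exact ⟨σ0, by simp only [mem_filter]; exact ⟨hσ0, rfl⟩⟩
  have hsum : ∑ σ ∈ A, φ (gam (x ∘ σ)) = c * ∑ G ∈ regFinset N d, φ G := by
    rw [← sum_fiberwise_of_maps_to hreg, mul_sum]
    refine sum_congr rfl fun G hG => ?_
    rw [← hconst G hG, ← nsmul_eq_mul, ← sum_const]
    refine sum_congr rfl fun σ hσ => ?_
    rw [(mem_filter.mp hσ).2]
  have hcard : (#A : ℝ) = c * #(regFinset N d) := by
    have := card_eq_sum_card_fiberwise hreg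
    rw [sum_congr rfl hconst, sum_const, smul_eq_mul] at this
    rw [this]; push_cast; ring
  refine ⟨⟨_, hG0⟩, ?_⟩
  rw [regExp, hsum, hcard]
  have : (c : ℝ) ≠ 0 := by positivity
  rw [mul_div_mul_left _ _ this]

end Unif


/-! ### Part 4: comparison of the regular graph with the configuration model -/

section RegConf
variable {m N : ℕ}

lemma cutS_le_add (I : Finset (Fin m)) {x y : Fin m × Bool → Fin N}
    (h : ∀ i ∉ I, ∀ b, x (i, b) = y (i, b)) (s : Finset (Fin N)) :
    cutS y s ≤ cutS x s + #I := by
  rw [cutS, cutS]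
  refine (card_le_card (t := ({i : Fin m | ¬ (x (i, false) ∈ s ↔ x (i, true) ∈ s)} : Finset _) ∪ I)
    ?_).trans (card_union_le _ _)
  intro i hi
  rw [mem_union]
  by_cases hI : i ∈ I
  · exact Or.inr hI
  · left
    simp only [mem_filter, mem_univ, true_and] at hi ⊢
    rwa [h i hI, h i hI]

lemma fS_le_add (n : ℕ) (I : Finset (Fin m)) {x y : Fin m × Bool → Fin N}
    (h : ∀ i ∉ I, ∀ b, x (i, b) = y (i, b)) :
    fS n y ≤ fS n x + #I := by
  rw [fS]
  refine Finset.sup_le fun s hs => ?_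
  refine (cutS_le_add I h s).trans ?_
  gcongr
  exact le_sup (f := cutS x) hs

lemma fS_swap (n : ℕ) (x : Fin m × Bool → Fin N) (p q : Fin m × Bool) :
    |(fS n (x ∘ Equiv.swap p q) : ℝ) - fS n x| ≤ 2 := by
  have h : ∀ i ∉ ({p.1, q.1} : Finset (Fin m)), ∀ b, x (i, b) = (x ∘ Equiv.swap p q) (i, b) := by
    intro i hi b
    simp only [mem_insert, mem_singleton, not_or] at hi
    have e1 : (i, b) ≠ p := fun h => hi.1 (by rw [← h])
    have e2 : (i, b) ≠ q := fun h => hi.2 (by rw [← h])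
    simp [Equiv.swap_apply_of_ne_of_ne e1 e2]
  have h1 := fS_le_add n _ h
  have h2 := fS_le_add n _ (fun i hi b => (h i hi b).symm)
  have h3 : #({p.1, q.1} : Finset (Fin m)) ≤ 2 := card_le_two
  have h4 : (fS n (x ∘ Equiv.swap p q) : ℝ) ≤ fS n x + 2 := by exact_mod_cast h1.trans (by omega)
  have h5 : (fS n x : ℝ) ≤ fS n (x ∘ Equiv.swap p q) + 2 := by exact_mod_cast h2.trans (by omega)
  rw [abs_le]
  constructor <;> linarith

lemma fS_le (n : ℕ) (x : Fin m × Bool → Fin N) : fS n x ≤ m := by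
  refine Finset.sup_le fun s _ => ?_
  refine (card_le_univ _).trans ?_
  simp

/-- The upper bound for the random regular graph. -/
lemma regExp_le {α : ℚ} {n d : ℕ} (hn : ⌊α * (N : ℚ)⌋₊ = n) {x : Fin m × Bool → Fin N}
    (hx : IsBal d x) (hd : 1 ≤ d) (hm : 11 * d ^ 2 < m) (l : ℝ) (hl : 0 < l) (hl4 : l * 4 ≤ 1) :
    (regFinset N d).Nonempty ∧
    regExp N d (fun G => (mcut α G : ℝ)) ≤
      𝔼 σ : Equiv.Perm (Fin m × Bool), (fS n (x ∘ σ) : ℝ) +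
        (Real.log (2 * ((1 + (2 * m) ^ 2 : ℕ) : ℝ) ^ (6 * d ^ 2)) +
          ((2 * m : ℕ) : ℝ) * (l * 4) ^ 2) / l := by
  classical
  have hs := card_simple_ge hx hd hm
  set A : Finset (Equiv.Perm (Fin m × Bool)) := {σ | bad (x ∘ σ) = ∅} with hA
  have hAne : A.Nonempty := by
    rw [nonempty_iff_ne_empty]
    intro h0
    rw [h0, card_empty, Nat.cast_zero, mul_zero] at hs
    have : (0 : ℝ) < Fintype.card (Equiv.Perm (Fin m × Bool)) := by
      exact_mod_cast Fintype.card_pos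
    linarith
  obtain ⟨h1, h2⟩ := sum_simple_eq hx hAne (fun G => (mcut α G : ℝ))
  refine ⟨h1, ?_⟩
  have h3 := perm_cond_mean (fun σ : Equiv.Perm (Fin m × Bool) => (fS n (x ∘ σ) : ℝ)) 2 l _ hl
    (by norm_num) (by linarith) (fun σ a b => by
      have : x ∘ ⇑(σ * Equiv.swap a b) = (x ∘ σ) ∘ Equiv.swap a b := by ext; simp
      simp only [this]
      exact fS_swap n _ _ _) A hAne (by positivity) hs
  have h4 : Fintype.card (Fin m × Bool) = 2 * m := by simp; ring
  rw [h4] at h3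
  rw [h2]
  calc _ ≤ (∑ σ ∈ A, (fS n (x ∘ σ) : ℝ)) / #A := by
        gcongr with σ hσ
        exact mcut_gam_le hn _
    _ ≤ _ := by
        refine h3.trans (le_of_eq ?_)
        norm_num

end RegConf


/-! ### Part 5: averaging over permutations of the vertices -/

section Avg
variable {m N : ℕ}

lemma exists_pair_perm {t : Finset (Fin N)} {u u' v v' : Fin N} (hu : u ∈ t) (hu' : u' ∈ t)
    (hv : v ∈ t) (hv' : v' ∈ t) (huu : u ≠ u') (hvv : v ≠ v') :
    ∃ π : Equiv.Perm (Fin N), (∀ w, π w ∈ t ↔ w ∈ t) ∧ π v = u ∧ π v' = u' := by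
  have hsw : ∀ a ∈ t, ∀ b ∈ t, ∀ w, Equiv.swap a b w ∈ t ↔ w ∈ t := by
    intro a ha b hb w
    rw [Equiv.swap_apply_def]
    split_ifs with h1 h2
    · simp [h1, ha, hb]
    · simp [h2, ha, hb]
    · rfl
  have h1 : Equiv.swap v u v' ∈ t := (hsw v hv u hu v').mpr hv'
  refine ⟨Equiv.swap (Equiv.swap v u v') u' * Equiv.swap v u, ?_, ?_, ?_⟩
  · intro w
    rw [Equiv.Perm.mul_apply, hsw _ h1 _ hu', hsw v hv u hu]
  · rw [Equiv.Perm.mul_apply, Equiv.swap_apply_left]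
    refine Equiv.swap_apply_of_ne_of_ne ?_ huu
    intro h
    have h2 : Equiv.swap v u v = Equiv.swap v u v' := by rw [Equiv.swap_apply_left]; exact h
    exact hvv ((Equiv.swap v u).injective h2)
  · rw [Equiv.Perm.mul_apply, Equiv.swap_apply_left]

lemma exists_cross_perm {t : Finset (Fin N)} {u u' v v' : Fin N} (hu : u ∈ t) (hu' : u' ∉ t)
    (hv : v ∈ t) (hv' : v' ∉ t) :
    ∃ π : Equiv.Perm (Fin N), (∀ w, π w ∈ t ↔ w ∈ t) ∧ π v = u ∧ π v' = u' := by
  have hsw : ∀ a b, (a ∈ t ↔ b ∈ t) → ∀ w, Equiv.swap a b w ∈ t ↔ w ∈ t := by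
    intro a b hab w
    rw [Equiv.swap_apply_def]
    split_ifs with h1 h2
    · rw [h1, hab]
    · rw [h2, hab]
    · rfl
  refine ⟨Equiv.swap v' u' * Equiv.swap v u, ?_, ?_, ?_⟩
  · intro w
    rw [Equiv.Perm.mul_apply, hsw _ _ (by tauto), hsw _ _ (by tauto)]
  · rw [Equiv.Perm.mul_apply, Equiv.swap_apply_left]
    refine Equiv.swap_apply_of_ne_of_ne ?_ ?_
    · rintro rfl; exact hv' hu
    · rintro rfl; exact hu' hu
  · have h1 : Equiv.swap v u v' = v' := by
      refine Equiv.swap_apply_of_ne_of_ne ?_ ?_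
      · rintro rfl; exact hv' hv
      · rintro rfl; exact hv' hu
    rw [Equiv.Perm.mul_apply, h1, Equiv.swap_apply_left]

lemma pair_avg_le {s t : Finset (Fin N)} (hst : ∀ π : Equiv.Perm (Fin N), (∀ w, π w ∈ t ↔ w ∈ t) →
      ∀ w, π w ∈ s ↔ w ∈ s)
    (zf : Equiv.Perm (Fin N) → Fin N → ℝ) (h0 : ∀ τ v, 0 ≤ zf τ v)
    (hinv : ∀ τ π : Equiv.Perm (Fin N), (∀ w, π w ∈ s ↔ w ∈ s) → ∀ v, zf (τ * π) v = zf τ (π v))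
    {v v' : Fin N} (hv : v ∈ t) (hv' : v' ∈ t) (hvv : v ≠ v') :
    (#t : ℝ) * (#t - 1) * 𝔼 τ, zf τ v * zf τ v' ≤ 𝔼 τ, (∑ u ∈ t, zf τ u) ^ 2 := by
  have hc : ∀ u ∈ t, ∀ u' ∈ t.erase u, 𝔼 τ, zf τ u * zf τ u' = 𝔼 τ, zf τ v * zf τ v' := by
    intro u hu u' hu'
    obtain ⟨π, hπ, h1, h2⟩ := exists_pair_perm hu (mem_of_mem_erase hu') hv hv'
      (ne_of_mem_erase hu').symm hvv
    rw [← expect_perm_mul_right (fun τ => zf τ v * zf τ v') π]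
    refine expect_congr rfl fun τ _ => ?_
    rw [hinv τ π (hst π hπ), hinv τ π (hst π hπ), h1, h2]
  have ht : 1 ≤ #t := card_pos.mpr ⟨v, hv⟩
  calc _ = ∑ u ∈ t, ∑ u' ∈ t.erase u, 𝔼 τ, zf τ u * zf τ u' := by
        rw [sum_congr rfl fun u hu => sum_congr rfl (hc u hu)]
        rw [sum_congr rfl fun u hu => (by
          rw [sum_const, card_erase_of_mem hu] :
          ∑ u' ∈ t.erase u, 𝔼 τ, zf τ v * zf τ v' = (#t - 1) • 𝔼 τ, zf τ v * zf τ v')]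
        rw [sum_const, nsmul_eq_mul, nsmul_eq_mul, Nat.cast_sub ht]
        push_cast; ring
    _ ≤ ∑ u ∈ t, ∑ u' ∈ t, 𝔼 τ, zf τ u * zf τ u' := by
        refine sum_le_sum fun u _ => ?_
        refine sum_le_sum_of_subset_of_nonneg (erase_subset _ _) fun u' _ _ => ?_
        exact expect_nonneg fun τ _ => mul_nonneg (h0 _ _) (h0 _ _)
    _ = 𝔼 τ, (∑ u ∈ t, zf τ u) ^ 2 := by
        simp_rw [← expect_sum_comm]
        refine expect_congr rfl fun τ _ => ?_
        rw [sq, sum_mul_sum]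

lemma cross_avg_eq {s : Finset (Fin N)}
    (zf : Equiv.Perm (Fin N) → Fin N → ℝ) 
    (hinv : ∀ τ π : Equiv.Perm (Fin N), (∀ w, π w ∈ s ↔ w ∈ s) → ∀ v, zf (τ * π) v = zf τ (π v))
    {v v' : Fin N} (hv : v ∈ s) (hv' : v' ∉ s) :
    (#s : ℝ) * #sᶜ * 𝔼 τ, zf τ v * zf τ v' = 𝔼 τ, (∑ u ∈ s, zf τ u) * (∑ u ∈ sᶜ, zf τ u) := by
  have hc : ∀ u ∈ s, ∀ u' ∈ sᶜ, 𝔼 τ, zf τ u * zf τ u' = 𝔼 τ, zf τ v * zf τ v' := by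
    intro u hu u' hu'
    obtain ⟨π, hπ, h1, h2⟩ := exists_cross_perm hu (mem_compl.mp hu') hv hv'
    rw [← expect_perm_mul_right (fun τ => zf τ v * zf τ v') π]
    refine expect_congr rfl fun τ _ => ?_
    rw [hinv τ π hπ, hinv τ π hπ, h1, h2]
  calc _ = ∑ u ∈ s, ∑ u' ∈ sᶜ, 𝔼 τ, zf τ u * zf τ u' := by
        rw [sum_congr rfl fun u hu => sum_congr rfl (hc u hu)]
        simp only [sum_const, nsmul_eq_mul]; ring
    _ = _ := by
        simp_rw [← expect_sum_comm]
        refine expect_congr rfl fun τ _ => ?_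
        rw [sum_mul_sum]

/-- number of edges inside -/
def insS (x : Fin m × Bool → Fin N) (s : Finset (Fin N)) : ℕ :=
  #{i : Fin m | x (i, false) ∈ s ∧ x (i, true) ∈ s}

lemma sum_half {x : Fin m × Bool → Fin N} {d : ℕ} (hx : IsBal d x) (φ : Fin N → ℝ) :
    ∑ i : Fin m, (φ (x (i, false)) + φ (x (i, true))) = d * ∑ v, φ v := by
  have h1 : ∑ i : Fin m, (φ (x (i, false)) + φ (x (i, true))) = ∑ p, φ (x p) := by
    rw [Fintype.sum_prod_type]
    refine sum_congr rfl fun i _ => ?_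
    rw [Fintype.sum_bool]; ring
  rw [h1, ← sum_fiberwise univ x, mul_sum]
  refine sum_congr rfl fun v _ => ?_
  rw [← hx v, ← nsmul_eq_mul, ← sum_const]
  refine sum_congr rfl fun p hp => ?_
  rw [(mem_filter.mp hp).2]

lemma two_ins_add_cut {x : Fin m × Bool → Fin N} {d : ℕ} (hx : IsBal d x) (s : Finset (Fin N)) :
    2 * (insS x s : ℝ) + cutS x s = d * #s := by
  have h := sum_half hx (fun v => if v ∈ s then (1 : ℝ) else 0)
  simp only [sum_ite_mem, univ_inter, sum_const, nsmul_eq_mul, mul_one] at h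
  rw [← h, insS, cutS, ← sum_boole, ← sum_boole, mul_sum, ← sum_add_distrib]
  refine sum_congr rfl fun i _ => ?_
  by_cases h1 : x (i, false) ∈ s <;> by_cases h2 : x (i, true) ∈ s <;> simp [h1, h2] <;> norm_num

lemma cutS_compl (x : Fin m × Bool → Fin N) (s : Finset (Fin N)) : cutS x sᶜ = cutS x s := by
  rw [cutS, cutS]
  congr 1
  ext i
  simp only [mem_compl, mem_filter, mem_univ, true_and]
  tauto

/-- Second moments over vertex permutations. -/
lemma sum_pair_avg_le {x : Fin m × Bool → Fin N} {d n : ℕ} (hx : IsBal d x) {s : Finset (Fin N)}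
    (hs : #s = n) (hn : 2 ≤ n) (hN : n + 2 ≤ N)
    (zf : Equiv.Perm (Fin N) → Fin N → ℝ) (h0 : ∀ τ v, 0 ≤ zf τ v) (h1 : ∀ τ v, zf τ v ≤ 1)
    (hinv : ∀ τ π : Equiv.Perm (Fin N), (∀ w, π w ∈ s ↔ w ∈ s) → ∀ v, zf (τ * π) v = zf τ (π v)) :
    𝔼 τ, ∑ i, zf τ (x (i, false)) * zf τ (x (i, true)) ≤
      𝔼 τ, ((d * n - cutS x s) / 2 * ((∑ u ∈ s, zf τ u) / n) ^ 2 +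
        cutS x s * ((∑ u ∈ s, zf τ u) / n * ((∑ u ∈ sᶜ, zf τ u) / (N - n))) +
        (d * (N - n) - cutS x s) / 2 * ((∑ u ∈ sᶜ, zf τ u) / (N - n)) ^ 2) + 2 * d + loops x := by
  have hsc : (#sᶜ : ℝ) = N - n := by
    rw [card_compl, hs, Fintype.card_fin, Nat.cast_sub (by omega)]
  have hn' : (2 : ℝ) ≤ n := by exact_mod_cast hn
  have hN' : (n : ℝ) + 2 ≤ N := by exact_mod_cast hN
  set E1 := 𝔼 τ, ((∑ u ∈ s, zf τ u) / n) ^ 2 with hE1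
  set E0 := 𝔼 τ, ((∑ u ∈ sᶜ, zf τ u) / (N - n : ℝ)) ^ 2 with hE0
  set E2 := 𝔼 τ, ((∑ u ∈ s, zf τ u) / n * ((∑ u ∈ sᶜ, zf τ u) / (N - n : ℝ))) with hE2
  have key : ∀ (t : Finset (Fin N)) (k : ℝ), (#t : ℝ) = k → 2 ≤ k →
      (∀ π : Equiv.Perm (Fin N), (∀ w, π w ∈ t ↔ w ∈ t) → ∀ w, π w ∈ s ↔ w ∈ s) →
      ∀ v ∈ t, ∀ v' ∈ t, v ≠ v' → 𝔼 τ, zf τ v * zf τ v' ≤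
        𝔼 τ, ((∑ u ∈ t, zf τ u) / k) ^ 2 + 1 / (k - 1) := by
    intro t k hk hk2 hst v hv v' hv' hvv
    have a1 := pair_avg_le hst zf h0 hinv hv hv' hvv
    rw [hk] at a1
    have a2 : ∀ τ, (∑ u ∈ t, zf τ u) ^ 2 = k ^ 2 * ((∑ u ∈ t, zf τ u) / k) ^ 2 := by
      intro τ; field_simp
    simp_rw [a2] at a1
    rw [← mul_expect] at a1
    have a3 : 𝔼 τ, ((∑ u ∈ t, zf τ u) / k) ^ 2 ≤ 1 := by
      calc _ ≤ 𝔼 _τ : Equiv.Perm (Fin N), (1 : ℝ) := by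
            refine expect_le_expect fun τ _ => ?_
            have b1 : 0 ≤ ∑ u ∈ t, zf τ u := sum_nonneg fun u _ => h0 τ u
            have b2 : ∑ u ∈ t, zf τ u ≤ k := by
              rw [← hk]
              calc _ ≤ ∑ u ∈ t, (1 : ℝ) := sum_le_sum fun u _ => h1 τ u
                _ = _ := by simp
            have b3 : (∑ u ∈ t, zf τ u) / k ≤ 1 := by
              rw [div_le_one (by linarith)]; exact b2
            exact pow_le_one₀ (by positivity) b3
        _ = 1 := by simp
    set X := 𝔼 τ, ((∑ u ∈ t, zf τ u) / k) ^ 2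
    set Y := 𝔼 τ, zf τ v * zf τ v'
    have a4 : (k - 1) * Y ≤ k * X := by
      have : k * ((k - 1) * Y) ≤ k * (k * X) := by nlinarith
      exact le_of_mul_le_mul_left this (by linarith)
    have hk1 : 0 < k - 1 := by linarith
    have : Y ≤ k * X / (k - 1) := by rw [le_div_iff₀ hk1]; linarith
    refine this.trans ?_
    rw [div_le_iff₀ hk1, add_mul, one_div, inv_mul_cancel₀ hk1.ne']
    nlinarith
  have hcross : ∀ v ∈ s, ∀ v' ∉ s, 𝔼 τ, zf τ v * zf τ v' = E2 := by
    intro v hv v' hv'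
    have a1 := cross_avg_eq zf hinv hv hv'
    rw [hsc, hs] at a1
    have a2 : ∀ τ, (∑ u ∈ s, zf τ u) / n * ((∑ u ∈ sᶜ, zf τ u) / (N - n : ℝ)) =
        (n * (N - n : ℝ))⁻¹ * ((∑ u ∈ s, zf τ u) * (∑ u ∈ sᶜ, zf τ u)) := by
      intro τ
      rw [div_mul_div_comm, div_eq_inv_mul]
    rw [hE2]
    simp_rw [a2]
    rw [← mul_expect, ← a1, inv_mul_cancel_left₀]
    have : (0 : ℝ) < n * (N - n : ℝ) := mul_pos (by linarith) (by linarith)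
    exact this.ne'
  have key1 := key s n (by rw [hs]) hn' (fun π hπ => hπ)
  have key0 := key sᶜ (N - n) hsc (by linarith) (fun π hπ w => by
    have := hπ w
    simp only [mem_compl] at this
    tauto)
  have hEdge : ∀ i : Fin m, 𝔼 τ, zf τ (x (i, false)) * zf τ (x (i, true)) ≤
      (if x (i, false) ∈ s ∧ x (i, true) ∈ s then (E1 + 1 / (n - 1 : ℝ)) else 0) +
      (if x (i, false) ∈ sᶜ ∧ x (i, true) ∈ sᶜ then (E0 + 1 / (N - n - 1 : ℝ)) else 0) +
      (if ¬ (x (i, false) ∈ s ↔ x (i, true) ∈ s) then E2 else 0) +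
      eqi x (i, false) (i, true) := by
    intro i
    have p1 : 0 ≤ E1 := expect_nonneg fun τ _ => by positivity
    have p0 : 0 ≤ E0 := expect_nonneg fun τ _ => by positivity
    have q1 : 0 ≤ 1 / (n - 1 : ℝ) := by apply div_nonneg <;> linarith
    have q0 : 0 ≤ 1 / (N - n - 1 : ℝ) := by apply div_nonneg <;> linarith
    by_cases hl : x (i, false) = x (i, true)
    · have e1 : eqi x (i, false) (i, true) = 1 := by simp [eqi, hl]
      have e2 : 𝔼 τ, zf τ (x (i, false)) * zf τ (x (i, true)) ≤ 1 := by
        calc _ ≤ 𝔼 _τ : Equiv.Perm (Fin N), (1 : ℝ) := expect_le_expect fun τ _ =>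
                mul_le_one₀ (h1 _ _) (h0 _ _) (h1 _ _)
          _ = 1 := by simp
      rw [e1]
      refine e2.trans ?_
      rw [hl]
      simp only [iff_self, not_true, if_false]
      split_ifs <;> linarith
    · have e1 : eqi x (i, false) (i, true) = 0 := by simp [eqi, hl]
      rw [e1]
      by_cases hf : x (i, false) ∈ s <;> by_cases ht : x (i, true) ∈ s
      · have := key1 _ hf _ ht hl
        simpa [hf, ht] using this
      · have := hcross _ hf _ ht
        simp [hf, ht, this]
      · have := hcross _ ht _ hf
        simp_rw [mul_comm (zf _ (x (i, false)))]
        simp [hf, ht, this]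
      · have := key0 _ (mem_compl.mpr hf) _ (mem_compl.mpr ht) hl
        simpa [hf, ht] using this
  have hb1 := two_ins_add_cut hx s
  have hb0 := two_ins_add_cut hx sᶜ
  rw [cutS_compl, hsc] at hb0
  rw [hs] at hb1
  rw [expect_sum_comm]
  refine (sum_le_sum fun i _ => hEdge i).trans ?_
  rw [sum_add_distrib, sum_add_distrib, sum_add_distrib, ← sum_filter, ← sum_filter, ← sum_filter,
    sum_const, sum_const, sum_const]
  change insS x s • _ + insS x sᶜ • _ + cutS x s • _ + loops x ≤ _
  rw [expect_add_distrib, expect_add_distrib, ← mul_expect, ← mul_expect, ← mul_expect, ← hE1, ← hE2,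
    ← hE0]
  simp only [nsmul_eq_mul]
  have hd0 : (0 : ℝ) ≤ d := by positivity
  have i1 : (insS x s : ℝ) * (1 / (n - 1 : ℝ)) ≤ d := by
    rw [mul_one_div, div_le_iff₀ (by linarith)]
    have : (0 : ℝ) ≤ cutS x s := by positivity
    nlinarith
  have i0 : (insS x sᶜ : ℝ) * (1 / (N - n - 1 : ℝ)) ≤ d := by
    rw [mul_one_div, div_le_iff₀ (by linarith)]
    have : (0 : ℝ) ≤ cutS x s := by positivity
    nlinarith
  have r1 : (insS x s : ℝ) = (d * n - cutS x s) / 2 := by linarith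
  have r0 : (insS x sᶜ : ℝ) = (d * (N - n) - cutS x s) / 2 := by linarith
  rw [mul_add, mul_add, ← r1, ← r0]
  linarith

end Avg


/-! ### Part 6: ingredients for the coupling -/

section Ingr
variable {m N d : ℕ}

lemma expect_perm_apply {β : Type*} [Fintype β] [DecidableEq β] (φ : β → ℝ) (u : β) :
    𝔼 τ : Equiv.Perm β, φ (τ u) = 𝔼 v, φ v := by
  have h1 : ∀ u', 𝔼 τ : Equiv.Perm β, φ (τ u') = 𝔼 τ : Equiv.Perm β, φ (τ u) := by
    intro u'
    rw [← expect_perm_mul_right (fun τ => φ (τ u)) (Equiv.swap u u')]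
    simp
  have : Nonempty β := ⟨u⟩
  calc _ = 𝔼 u' : β, 𝔼 τ : Equiv.Perm β, φ (τ u') := by
        rw [expect_congr rfl fun u' _ => h1 u']; simp
    _ = 𝔼 τ : Equiv.Perm β, 𝔼 u' : β, φ (τ u') := expect_comm _ _ _
    _ = 𝔼 τ : Equiv.Perm β, 𝔼 v, φ v := by
        refine expect_congr rfl fun τ _ => ?_
        exact Fintype.expect_equiv τ _ _ fun _ => rfl
    _ = _ := by simp

lemma expect_perm_pair (Φ : Fin N → Fin N → ℝ) {u u' : Fin N} (h : u ≠ u') :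
    (N : ℝ) * (N - 1) * 𝔼 τ : Equiv.Perm (Fin N), Φ (τ u) (τ u') =
      ∑ p ∈ (univ : Finset (Fin N)).offDiag, Φ p.1 p.2 := by
  have h1 : ∀ p ∈ (univ : Finset (Fin N)).offDiag, 𝔼 τ : Equiv.Perm (Fin N), Φ (τ p.1) (τ p.2) =
      𝔼 τ : Equiv.Perm (Fin N), Φ (τ u) (τ u') := by
    intro p hp
    obtain ⟨π, -, h2, h3⟩ := exists_pair_perm (mem_univ p.1) (mem_univ p.2) (mem_univ u)
      (mem_univ u') (mem_offDiag.mp hp).2.2 h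
    rw [← expect_perm_mul_right (fun τ => Φ (τ u) (τ u')) π]
    simp [h2, h3]
  have h2 : ∑ p ∈ (univ : Finset (Fin N)).offDiag, 𝔼 τ : Equiv.Perm (Fin N), Φ (τ p.1) (τ p.2) =
      (N : ℝ) * (N - 1) * 𝔼 τ : Equiv.Perm (Fin N), Φ (τ u) (τ u') := by
    rw [sum_congr rfl h1, sum_const, offDiag_card, nsmul_eq_mul, card_univ, Fintype.card_fin,
      Nat.cast_sub (by nlinarith)]
    push_cast; ring
  rw [← h2, ← expect_sum_comm]
  have h3 : ∀ τ : Equiv.Perm (Fin N), ∑ p ∈ (univ : Finset (Fin N)).offDiag, Φ (τ p.1) (τ p.2) =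
      ∑ p ∈ (univ : Finset (Fin N)).offDiag, Φ p.1 p.2 := by
    intro τ
    refine sum_equiv (Equiv.prodCongr τ τ) ?_ ?_
    · intro p; simp
    · intro p _; simp
  simp [h3]

/-- degree in a sequence -/
def deg (y : Fin m × Bool → Fin N) (v : Fin N) : ℕ := #{p : Fin m × Bool | y p = v}

lemma exists_arrange (y : Fin m × Bool → Fin N) (hc : 2 * m = N * d) :
    ∃ θ : (Fin N × Fin d) ≃ (Fin m × Bool), ∀ v (i : Fin d), (i : ℕ) < deg y v → y (θ (v, i)) = v := by
  classical
  have hcard : Fintype.card (Fin N × Fin d) = Fintype.card (Fin m × Bool) := by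
    simp; omega
  rcases isEmpty_or_nonempty (Fin m × Bool) with hP | hP
  · refine ⟨Fintype.equivOfCardEq hcard, ?_⟩
    intro v i
    exact hP.elim (Fintype.equivOfCardEq hcard (v, i))
  · set F : Fin N → Finset (Fin m × Bool) := fun v => {p | y p = v} with hF
    set f : Fin N × Fin d → Fin m × Bool := fun q => if h : (q.2 : ℕ) < #(F q.1) then
      ((F q.1).equivFin.symm ⟨q.2, h⟩ : Fin m × Bool) else Classical.arbitrary _ with hf
    have hfv : ∀ q : Fin N × Fin d, (q.2 : ℕ) < #(F q.1) → y (f q) = q.1 := by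
      intro q hq
      rw [hf]
      simp only [hq, dif_pos]
      have := ((F q.1).equivFin.symm ⟨q.2, hq⟩).2
      exact (mem_filter.mp this).2
    obtain ⟨g, hg⟩ := Set.MapsTo.exists_equiv_extend_of_card_eq (t := univ)
      (s := {q : Fin N × Fin d | (q.2 : ℕ) < #(F q.1)}) (f := f) (by rw [hcard, card_univ])
      (fun q _ => by simp) (by
        intro q hq q' hq' hqq
        simp only [Set.mem_ofPred_eq] at hq hq'
        have h1 := hfv q hq
        have h2 := hfv q' hq'
        rw [hqq, h2] at h1
        obtain ⟨v, i⟩ := q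
        obtain ⟨v', i'⟩ := q'
        simp only at h1
        subst h1
        simp only [hf] at hqq hq hq'
        rw [dif_pos hq, dif_pos hq'] at hqq
        have h3 := (F v').equivFin.symm.injective (Subtype.ext hqq)
        simp only [Fin.mk.injEq] at h3
        rw [Fin.ext h3])
    refine ⟨g.trans ((Equiv.subtypeUnivEquiv (fun _ => mem_univ _))), ?_⟩
    intro v i hi
    have := hg (v, i) hi
    simp only [Equiv.trans_apply, Equiv.subtypeUnivEquiv_apply]
    rw [this]
    exact hfv (v, i) hi

variable [NeZero d]

lemma expect_shift_one (φ : Fin d → ℝ) (v : Fin N) (i : Fin d) :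
    𝔼 ρ : Fin N → Fin d, φ (i + ρ v) = 𝔼 j, φ j := by
  have h1 : ∀ r : Fin d, 𝔼 ρ : Fin N → Fin d, φ (i + (ρ + (Pi.single v r : Fin N → Fin d)) v) =
      𝔼 ρ : Fin N → Fin d, φ (i + ρ v) := fun r =>
    Fintype.expect_equiv (Equiv.addRight (Pi.single v r : Fin N → Fin d)) _ _ fun _ => rfl
  calc _ = 𝔼 r : Fin d, 𝔼 ρ : Fin N → Fin d, φ (i + (ρ + (Pi.single v r : Fin N → Fin d)) v) := by
        rw [expect_congr rfl fun r _ => h1 r]; simp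
    _ = 𝔼 ρ : Fin N → Fin d, 𝔼 r : Fin d, φ (i + (ρ + (Pi.single v r : Fin N → Fin d)) v) := expect_comm _ _ _
    _ = 𝔼 ρ : Fin N → Fin d, 𝔼 j, φ j := by
        refine expect_congr rfl fun ρ _ => ?_
        refine Fintype.expect_equiv (Equiv.addLeft (i + ρ v)) _ _ fun r => ?_
        simp [add_assoc]
    _ = _ := by simp

lemma expect_shift_two (φ ψ : Fin d → ℝ) {v v' : Fin N} (h : v ≠ v') (i i' : Fin d) :
    𝔼 ρ : Fin N → Fin d, φ (i + ρ v) * ψ (i' + ρ v') = (𝔼 j, φ j) * 𝔼 j, ψ j := by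
  have h1 : ∀ r : Fin d, 𝔼 ρ : Fin N → Fin d, φ (i + (ρ + (Pi.single v r : Fin N → Fin d)) v) *
        ψ (i' + (ρ + (Pi.single v r : Fin N → Fin d)) v') =
      𝔼 ρ : Fin N → Fin d, φ (i + ρ v) * ψ (i' + ρ v') := fun r =>
    Fintype.expect_equiv (Equiv.addRight (Pi.single v r : Fin N → Fin d)) _ _ fun _ => rfl
  calc _ = 𝔼 r : Fin d, 𝔼 ρ : Fin N → Fin d, φ (i + (ρ + (Pi.single v r : Fin N → Fin d)) v) *
        ψ (i' + (ρ + (Pi.single v r : Fin N → Fin d)) v') := by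
        rw [expect_congr rfl fun r _ => h1 r]; simp
    _ = 𝔼 ρ : Fin N → Fin d, 𝔼 r : Fin d, φ (i + (ρ + (Pi.single v r : Fin N → Fin d)) v) *
        ψ (i' + (ρ + (Pi.single v r : Fin N → Fin d)) v') := expect_comm _ _ _
    _ = 𝔼 ρ : Fin N → Fin d, (𝔼 j, φ j) * ψ (i' + ρ v') := by
        refine expect_congr rfl fun ρ _ => ?_
        simp only [Pi.add_apply, Pi.single_eq_same, Pi.single_eq_of_ne h.symm, add_zero]
        rw [← expect_mul]
        congr 1
        refine Fintype.expect_equiv (Equiv.addLeft (i + ρ v)) _ _ fun r => ?_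
        simp [add_assoc]
    _ = _ := by
        rw [← mul_expect, expect_shift_one]

/-- The vertex permutation plus shift of half-edges. -/
def gsh (τ : Equiv.Perm (Fin N)) (ρ : Fin N → Fin d) : Equiv.Perm (Fin N × Fin d) where
  toFun q := (τ q.1, q.2 + ρ q.1)
  invFun q := (τ.symm q.1, q.2 - ρ (τ.symm q.1))
  left_inv q := by simp
  right_inv q := by simp

/-- Fraction of the half-edges at `a` whose label is in `S`. -/
noncomputable def zet (b : Fin N × Fin d → Fin N) (S : Finset (Fin N)) (a : Fin N) : ℝ :=
  𝔼 i : Fin d, if b (a, i) ∈ S then (1 : ℝ) else 0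

lemma zet_nonneg (b : Fin N × Fin d → Fin N) (S : Finset (Fin N)) (a : Fin N) : 0 ≤ zet b S a :=
  expect_nonneg fun i _ => by split_ifs <;> norm_num

lemma zet_le_one (b : Fin N × Fin d → Fin N) (S : Finset (Fin N)) (a : Fin N) : zet b S a ≤ 1 := by
  calc _ ≤ 𝔼 _i : Fin d, (1 : ℝ) := expect_le_expect fun i _ => by split_ifs <;> norm_num
    _ = 1 := by simp

lemma expect_cut_shift (E : (Fin m × Bool) ≃ (Fin N × Fin d)) (b : Fin N × Fin d → Fin N)
    (τ : Equiv.Perm (Fin N)) (S : Finset (Fin N)) (x : Fin m × Bool → Fin N)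
    (hx : ∀ p, x p = (E p).1) :
    ∑ i, (zet b S (τ (x (i, false))) + zet b S (τ (x (i, true)))) -
      2 * ∑ i, zet b S (τ (x (i, false))) * zet b S (τ (x (i, true))) - loops x ≤
    𝔼 ρ : Fin N → Fin d, (cutS (fun p => b (gsh τ ρ (E p))) S : ℝ) := by
  have h1 : ∀ ρ : Fin N → Fin d, (cutS (fun p => b (gsh τ ρ (E p))) S : ℝ) =
      ∑ i, (if ¬ (b (gsh τ ρ (E (i, false))) ∈ S ↔ b (gsh τ ρ (E (i, true))) ∈ S) then (1 : ℝ)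
        else 0) := by
    intro ρ
    rw [cutS, sum_boole]
  simp_rw [h1]
  rw [expect_sum_comm, mul_sum, ← sum_sub_distrib, loops, ← sum_sub_distrib]
  refine sum_le_sum fun i _ => ?_
  have z0 := zet_nonneg b S (τ (x (i, false)))
  have z1 := zet_le_one b S (τ (x (i, false)))
  have z0' := zet_nonneg b S (τ (x (i, true)))
  have z1' := zet_le_one b S (τ (x (i, true)))
  by_cases hl : x (i, false) = x (i, true)
  · have e1 : eqi x (i, false) (i, true) = 1 := by simp [eqi, hl]
    rw [e1]
    refine le_trans ?_ (expect_nonneg fun ρ _ => by split_ifs <;> norm_num)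
    nlinarith
  · have e1 : eqi x (i, false) (i, true) = 0 := by simp [eqi, hl]
    rw [e1, sub_zero]
    set φ : Fin d → ℝ := fun j => if b (τ (x (i, false)), j) ∈ S then (1 : ℝ) else 0 with hφ
    set ψ : Fin d → ℝ := fun j => if b (τ (x (i, true)), j) ∈ S then (1 : ℝ) else 0 with hψ
    have h2 : ∀ ρ : Fin N → Fin d,
        (if ¬ (b (gsh τ ρ (E (i, false))) ∈ S ↔ b (gsh τ ρ (E (i, true))) ∈ S) then (1 : ℝ) else 0)
        = φ ((E (i, false)).2 + ρ (x (i, false))) + ψ ((E (i, true)).2 + ρ (x (i, true))) -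
          2 * (φ ((E (i, false)).2 + ρ (x (i, false))) * ψ ((E (i, true)).2 + ρ (x (i, true)))) := by
      intro ρ
      simp only [hφ, hψ, gsh, Equiv.coe_fn_mk, hx]
      by_cases c1 : b (τ (E (i, false)).1, (E (i, false)).2 + ρ (E (i, false)).1) ∈ S <;>
        by_cases c2 : b (τ (E (i, true)).1, (E (i, true)).2 + ρ (E (i, true)).1) ∈ S <;>
        simp [c1, c2] <;> norm_num
    simp_rw [h2]
    rw [expect_sub_distrib, expect_add_distrib, ← mul_expect, expect_shift_one, expect_shift_one,
      expect_shift_two _ _ hl]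
    exact le_of_eq rfl

end Ingr


/-! ### Part 7: the coupling -/

section Coup
variable {m N d n : ℕ}

lemma exists_exchange (L H : Finset (Fin N)) (hLH : Disjoint L H) (δ : Fin N → ℝ) (Δ : ℝ)
    (hL : ∀ v ∈ L, δ v ≤ -Δ) (hH : ∀ v ∈ H, Δ ≤ δ v) (S : Finset (Fin N)) :
    ∃ S' : Finset (Fin N), #S' = #S ∧
      ∑ v ∈ S, δ v + 2 * Δ * (min #(L ∩ S) #(H \ S) : ℕ) ≤ ∑ v ∈ S', δ v ∧
      #(S \ S') ≤ min #(L ∩ S) #(H \ S) ∧ #(S' \ S) ≤ min #(L ∩ S) #(H \ S) := by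
  set k := min #(L ∩ S) #(H \ S) with hk
  obtain ⟨A, hA, hAk⟩ := exists_subset_card_eq (s := L ∩ S) (n := k) (min_le_left _ _)
  obtain ⟨B, hB, hBk⟩ := exists_subset_card_eq (s := H \ S) (n := k) (min_le_right _ _)
  have hAS : A ⊆ S := hA.trans inter_subset_right
  have hdis : Disjoint (S \ A) B := by
    rw [disjoint_left]
    intro v hv hvB
    exact (mem_sdiff.mp (hB hvB)).2 (mem_sdiff.mp hv).1
  have hcA := card_sdiff_add_card_eq_card hAS
  refine ⟨S \ A ∪ B, ?_, ?_, ?_, ?_⟩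
  · rw [card_union_of_disjoint hdis]; omega
  · rw [sum_union hdis]
    have h1 := sum_sdiff (f := δ) hAS
    have h2 : ∑ v ∈ A, δ v ≤ k * (-Δ) := by
      rw [← hAk, ← nsmul_eq_mul, ← sum_const]
      exact sum_le_sum fun v hv => hL v (mem_inter.mp (hA hv)).1
    have h3 : k * Δ ≤ ∑ v ∈ B, δ v := by
      rw [← hBk, ← nsmul_eq_mul, ← sum_const]
      exact sum_le_sum fun v hv => hH v (mem_sdiff.mp (hB hv)).1
    linarith
  · rw [← hAk]
    refine card_le_card fun v hv => ?_
    simp only [mem_sdiff, mem_union, not_or, not_and, not_not] at hv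
    exact hv.2.1 hv.1
  · rw [← hBk]
    refine card_le_card fun v hv => ?_
    simp only [mem_sdiff, mem_union] at hv
    tauto

/-- density inside -/
noncomputable def pIn (b : Fin N × Fin d → Fin N) (Ψ : Finset (Fin N) → Finset (Fin N))
    (n : ℕ) (S : Finset (Fin N)) : ℝ := (∑ a ∈ S, zet b (Ψ S) a) / n

/-- density outside -/
noncomputable def pOut (b : Fin N × Fin d → Fin N) (Ψ : Finset (Fin N) → Finset (Fin N))
    (n : ℕ) (S : Finset (Fin N)) : ℝ := (∑ a ∈ Sᶜ, zet b (Ψ S) a) / (N - n)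

lemma coupling_step [NeZero d] (E : (Fin m × Bool) ≃ (Fin N × Fin d)) (b : Fin N × Fin d → Fin N)
    (Ψ : Finset (Fin N) → Finset (Fin N)) (hΨ : ∀ S, #(Ψ S) = #S)
    (hn : 2 ≤ n) (hN : n + 2 ≤ N) (x : Fin m × Bool → Fin N) (hx : ∀ p, x p = (E p).1)
    (hxb : IsBal d x) (s : Finset (Fin N)) (hs : #s = n) :
    𝔼 τ : Equiv.Perm (Fin N), (d * n * (pIn b Ψ n (s.map τ.toEmbedding) -
        pIn b Ψ n (s.map τ.toEmbedding) ^ 2) +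
      d * (N - n) * (pOut b Ψ n (s.map τ.toEmbedding) - pOut b Ψ n (s.map τ.toEmbedding) ^ 2) +
      cutS x s * (pIn b Ψ n (s.map τ.toEmbedding) - pOut b Ψ n (s.map τ.toEmbedding)) ^ 2) -
      4 * d - 3 * loops x ≤
    𝔼 τ : Equiv.Perm (Fin N), 𝔼 ρ : Fin N → Fin d, (fS n (fun p => b (gsh τ ρ (E p))) : ℝ) := by
  have hn' : (2 : ℝ) ≤ n := by exact_mod_cast hn
  have hN' : (n : ℝ) + 2 ≤ N := by exact_mod_cast hN
  set zf : Equiv.Perm (Fin N) → Fin N → ℝ := fun τ v => zet b (Ψ (s.map τ.toEmbedding)) (τ v)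
    with hzf
  have hinv : ∀ τ π : Equiv.Perm (Fin N), (∀ w, π w ∈ s ↔ w ∈ s) →
      ∀ v, zf (τ * π) v = zf τ (π v) := by
    intro τ π hπ v
    have h1 : s.map (τ * π).toEmbedding = s.map τ.toEmbedding := by
      ext w
      simp only [mem_map_equiv]
      rw [← hπ]
      simp [Equiv.Perm.mul_def]
    simp only [hzf, h1, Equiv.Perm.mul_apply]
  have hmain := sum_pair_avg_le hxb hs hn hN zf (fun τ v => zet_nonneg _ _ _)
    (fun τ v => zet_le_one _ _ _) hinv
  have hIn : ∀ τ : Equiv.Perm (Fin N), (∑ u ∈ s, zf τ u) / n = pIn b Ψ n (s.map τ.toEmbedding) := by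
    intro τ
    rw [pIn, sum_map]; rfl
  have hOut : ∀ τ : Equiv.Perm (Fin N), (∑ u ∈ sᶜ, zf τ u) / (N - n : ℝ) =
      pOut b Ψ n (s.map τ.toEmbedding) := by
    intro τ
    have : (s.map τ.toEmbedding)ᶜ = sᶜ.map τ.toEmbedding := by
      ext w; simp only [mem_compl, mem_map_equiv]
    rw [pOut, this, sum_map]; rfl
  simp_rw [hIn, hOut] at hmain
  have hτ : ∀ τ : Equiv.Perm (Fin N),
      d * (n * pIn b Ψ n (s.map τ.toEmbedding) + (N - n) * pOut b Ψ n (s.map τ.toEmbedding)) -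
      2 * ∑ i, zf τ (x (i, false)) * zf τ (x (i, true)) - loops x ≤
      𝔼 ρ : Fin N → Fin d, (fS n (fun p => b (gsh τ ρ (E p))) : ℝ) := by
    intro τ
    have h1 := expect_cut_shift E b τ (Ψ (s.map τ.toEmbedding)) x hx
    have h2 := sum_half hxb (fun v => zf τ v)
    have h3 : ∑ v, zf τ v = n * pIn b Ψ n (s.map τ.toEmbedding) +
        (N - n) * pOut b Ψ n (s.map τ.toEmbedding) := by
      rw [← hIn, ← hOut, mul_div_cancel₀, mul_div_cancel₀, sum_add_sum_compl]
      · linarith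
      · linarith
    rw [h3] at h2
    have h4 : 𝔼 ρ : Fin N → Fin d, (cutS (fun p => b (gsh τ ρ (E p))) (Ψ (s.map τ.toEmbedding)) : ℝ) ≤
        𝔼 ρ : Fin N → Fin d, (fS n (fun p => b (gsh τ ρ (E p))) : ℝ) := by
      refine expect_le_expect fun ρ _ => ?_
      have : cutS (fun p => b (gsh τ ρ (E p))) (Ψ (s.map τ.toEmbedding)) ≤
        fS n (fun p => b (gsh τ ρ (E p))) := by
        refine le_sup (f := cutS _) ?_
        rw [mem_powersetCard_univ, hΨ, card_map, hs]
      exact_mod_cast this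
    refine le_trans ?_ h4
    refine le_trans ?_ h1
    rw [← h2]
  have hsum := expect_le_expect (s := univ) fun τ _ => hτ τ
  refine le_trans ?_ hsum
  have h2e : 𝔼 τ : Equiv.Perm (Fin N), 2 * ∑ i, zf τ (x (i, false)) * zf τ (x (i, true)) =
      2 * 𝔼 τ : Equiv.Perm (Fin N), ∑ i, zf τ (x (i, false)) * zf τ (x (i, true)) :=
    (mul_expect _ _ _).symm
  rw [expect_sub_distrib, expect_sub_distrib, h2e]
  have hl : 𝔼 _τ : Equiv.Perm (Fin N), loops x = loops x := by simp
  rw [hl]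
  have heq : 𝔼 τ : Equiv.Perm (Fin N), (d * n * (pIn b Ψ n (s.map τ.toEmbedding) -
        pIn b Ψ n (s.map τ.toEmbedding) ^ 2) +
      d * (N - n) * (pOut b Ψ n (s.map τ.toEmbedding) - pOut b Ψ n (s.map τ.toEmbedding) ^ 2) +
      cutS x s * (pIn b Ψ n (s.map τ.toEmbedding) - pOut b Ψ n (s.map τ.toEmbedding)) ^ 2) =
      𝔼 τ : Equiv.Perm (Fin N), d * (n * pIn b Ψ n (s.map τ.toEmbedding) +
        (N - n) * pOut b Ψ n (s.map τ.toEmbedding)) - 2 *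
      𝔼 τ : Equiv.Perm (Fin N), ((d * n - cutS x s) / 2 * pIn b Ψ n (s.map τ.toEmbedding) ^ 2 +
        cutS x s * (pIn b Ψ n (s.map τ.toEmbedding) * pOut b Ψ n (s.map τ.toEmbedding)) +
        (d * (N - n) - cutS x s) / 2 * pOut b Ψ n (s.map τ.toEmbedding) ^ 2) := by
    rw [mul_expect, ← expect_sub_distrib]
    refine expect_congr rfl fun τ _ => ?_
    ring
  rw [heq]
  linarith

lemma expect_map_eq (h : Finset (Fin N) → ℝ) {s s0 : Finset (Fin N)} (hs : #s = #s0) :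
    𝔼 τ : Equiv.Perm (Fin N), h (s.map τ.toEmbedding) =
      𝔼 τ : Equiv.Perm (Fin N), h (s0.map τ.toEmbedding) := by
  classical
  have hc : Fintype.card {v // v ∈ s} = Fintype.card {v // v ∈ s0} := by simpa using hs
  set π : Equiv.Perm (Fin N) := (Fintype.equivOfCardEq hc).extendSubtype with hπ
  have h1 : s.map π.toEmbedding = s0 := by
    refine eq_of_subset_of_card_le ?_ (by rw [card_map, hs])
    intro v hv
    obtain ⟨u, hu, rfl⟩ := mem_map.mp hv
    exact (Fintype.equivOfCardEq hc).extendSubtype_mem u hu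
  rw [← expect_perm_mul_right (fun τ => h (s.map τ.toEmbedding)) π]
  refine expect_congr rfl fun τ _ => ?_
  rw [← h1, map_map]
  rfl

lemma coupling_sum [NeZero d] (e : (Fin m × Bool) ≃ (Fin N × Fin d)) (y : Fin m × Bool → Fin N)
    (θ : (Fin N × Fin d) ≃ (Fin m × Bool))
    (Ψ : Finset (Fin N) → Finset (Fin N)) (hΨ : ∀ S, #(Ψ S) = #S)
    (hn : 2 ≤ n) (hN : n + 2 ≤ N) (hm : 1 ≤ m) (hbal : IsBal d (fun p => (e p).1))
    (s0 : Finset (Fin N)) (hs0 : #s0 = n) :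
    𝔼 τ : Equiv.Perm (Fin N), (d * n * (pIn (y ∘ θ) Ψ n (s0.map τ.toEmbedding) -
        pIn (y ∘ θ) Ψ n (s0.map τ.toEmbedding) ^ 2) +
      d * (N - n) * (pOut (y ∘ θ) Ψ n (s0.map τ.toEmbedding) -
        pOut (y ∘ θ) Ψ n (s0.map τ.toEmbedding) ^ 2)) +
      (𝔼 σ : Equiv.Perm (Fin m × Bool), (fS n ((fun p => (e p).1) ∘ σ) : ℝ)) *
      (𝔼 τ : Equiv.Perm (Fin N), (pIn (y ∘ θ) Ψ n (s0.map τ.toEmbedding) -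
        pOut (y ∘ θ) Ψ n (s0.map τ.toEmbedding)) ^ 2) - 7 * d ≤
    𝔼 σ : Equiv.Perm (Fin m × Bool), (fS n (y ∘ σ) : ℝ) := by
  set b := y ∘ θ with hb
  set x0 : Fin m × Bool → Fin N := fun p => (e p).1 with hx0
  have hg : ∀ (τ : Equiv.Perm (Fin N)) (ρ : Fin N → Fin d),
      𝔼 σ : Equiv.Perm (Fin m × Bool), (fS n (fun p => b (gsh τ ρ (e (σ p)))) : ℝ) =
      𝔼 σ : Equiv.Perm (Fin m × Bool), (fS n (y ∘ σ) : ℝ) := by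
    intro τ ρ
    rw [← expect_perm_mul_left (fun σ : Equiv.Perm (Fin m × Bool) => (fS n (y ∘ σ) : ℝ))
      (e.trans ((gsh τ ρ).trans θ))]
    rfl
  have h1 : 𝔼 σ : Equiv.Perm (Fin m × Bool), (fS n (y ∘ σ) : ℝ) =
      𝔼 σ : Equiv.Perm (Fin m × Bool), 𝔼 τ : Equiv.Perm (Fin N), 𝔼 ρ : Fin N → Fin d,
        (fS n (fun p => b (gsh τ ρ (e (σ p)))) : ℝ) := by
    rw [expect_comm]
    rw [expect_congr rfl fun τ _ => expect_comm _ _ _]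
    simp_rw [hg]
    simp
  rw [h1]
  have h2 : ∀ σ : Equiv.Perm (Fin m × Bool),
      𝔼 τ : Equiv.Perm (Fin N), (d * n * (pIn b Ψ n (s0.map τ.toEmbedding) -
        pIn b Ψ n (s0.map τ.toEmbedding) ^ 2) +
      d * (N - n) * (pOut b Ψ n (s0.map τ.toEmbedding) -
        pOut b Ψ n (s0.map τ.toEmbedding) ^ 2)) +
      fS n (x0 ∘ σ) * (𝔼 τ : Equiv.Perm (Fin N), (pIn b Ψ n (s0.map τ.toEmbedding) -
        pOut b Ψ n (s0.map τ.toEmbedding)) ^ 2) - 4 * d - 3 * loops (x0 ∘ σ) ≤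
      𝔼 τ : Equiv.Perm (Fin N), 𝔼 ρ : Fin N → Fin d,
        (fS n (fun p => b (gsh τ ρ (e (σ p)))) : ℝ) := by
    intro σ
    obtain ⟨s, hs, hsf⟩ := exists_mem_eq_sup (powersetCard n (univ : Finset (Fin N)))
      ⟨s0, by rw [mem_powersetCard_univ, hs0]⟩ (cutS (x0 ∘ σ))
    rw [mem_powersetCard_univ] at hs
    have h3 := coupling_step (σ.trans e) b Ψ hΨ hn hN (x0 ∘ σ) (fun p => rfl)
      (hbal.comp_perm σ) s hs
    rw [expect_map_eq (fun S => d * n * (pIn b Ψ n S - pIn b Ψ n S ^ 2) +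
      d * (N - n) * (pOut b Ψ n S - pOut b Ψ n S ^ 2) +
      cutS (x0 ∘ σ) s * (pIn b Ψ n S - pOut b Ψ n S) ^ 2) (s0 := s0) (by rw [hs, hs0])] at h3
    rw [expect_add_distrib, ← mul_expect] at h3
    have h4 : fS n (x0 ∘ σ) = cutS (x0 ∘ σ) s := hsf
    rw [h4]
    exact h3
  refine le_trans ?_ (expect_le_expect fun σ _ => h2 σ)
  have h5 := expect_loops_le hbal hm
  generalize 𝔼 τ : Equiv.Perm (Fin N), (d * n * (pIn b Ψ n (s0.map τ.toEmbedding) -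
        pIn b Ψ n (s0.map τ.toEmbedding) ^ 2) +
      d * (N - n) * (pOut b Ψ n (s0.map τ.toEmbedding) -
        pOut b Ψ n (s0.map τ.toEmbedding) ^ 2)) = MM
  generalize 𝔼 τ : Equiv.Perm (Fin N), (pIn b Ψ n (s0.map τ.toEmbedding) -
        pOut b Ψ n (s0.map τ.toEmbedding)) ^ 2 = RR
  have h6 : 𝔼 _σ : Equiv.Perm (Fin m × Bool), (4 * d : ℝ) = 4 * d := by simp
  have h7 : 𝔼 σ : Equiv.Perm (Fin m × Bool), 3 * loops (x0 ∘ σ) =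
      3 * 𝔼 σ : Equiv.Perm (Fin m × Bool), loops (x0 ∘ σ) := (mul_expect _ _ _).symm
  have h8 : 𝔼 σ : Equiv.Perm (Fin m × Bool), (fS n (x0 ∘ σ) : ℝ) * RR =
      (𝔼 σ : Equiv.Perm (Fin m × Bool), (fS n (x0 ∘ σ) : ℝ)) * RR := (expect_mul _ _ _).symm
  rw [expect_sub_distrib, expect_sub_distrib, expect_add_distrib, h6, h7, h8,
    expect_const (univ_nonempty)]
  linarith

end Coup


/-! ### Part 8: lower bound from the coupling -/

section Coup2
variable {m N d n : ℕ}

lemma mul_zet [NeZero d] (b : Fin N × Fin d → Fin N) (S : Finset (Fin N)) (a : Fin N) :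
    (d : ℝ) * zet b S a = ∑ i, if b (a, i) ∈ S then (1 : ℝ) else 0 := by
  rw [zet, Fintype.expect_eq_sum_div_card, Fintype.card_fin, mul_div_cancel₀]
  exact_mod_cast NeZero.ne d

lemma sum_zet [NeZero d] (y : Fin m × Bool → Fin N) (θ : (Fin N × Fin d) ≃ (Fin m × Bool))
    (S : Finset (Fin N)) : (d : ℝ) * ∑ a, zet (y ∘ θ) S a = ∑ v ∈ S, (deg y v : ℝ) := by
  rw [mul_sum]
  simp_rw [mul_zet]
  rw [← Fintype.sum_prod_type' (f := fun a i => if (y ∘ θ) (a, i) ∈ S then (1 : ℝ) else 0)]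
  have h1 : ∑ x : Fin N × Fin d, (if (y ∘ θ) (x.1, x.2) ∈ S then (1 : ℝ) else 0) =
      ∑ p : Fin m × Bool, if y p ∈ S then (1 : ℝ) else 0 :=
    Fintype.sum_equiv θ _ _ fun x => rfl
  rw [h1, sum_boole]
  have h2 := card_eq_sum_card_fiberwise (f := y) (s := univ.filter fun p => y p ∈ S) (t := S)
    (fun p hp => by simpa using hp)
  rw [h2]
  push_cast
  refine sum_congr rfl fun v hv => ?_
  rw [deg, filter_filter]
  congr 2
  ext p
  simp only [mem_filter, mem_univ, true_and]
  constructor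
  · exact fun h => h.2
  · rintro rfl; exact ⟨hv, rfl⟩

lemma card_mismatch_le (y : Fin m × Bool → Fin N) (θ : (Fin N × Fin d) ≃ (Fin m × Bool))
    (hθ : ∀ v (i : Fin d), (i : ℕ) < deg y v → y (θ (v, i)) = v) (a : Fin N) :
    ∑ i, (if y (θ (a, i)) ≠ a then (1 : ℝ) else 0) ≤ |(deg y a : ℝ) - d| := by
  rw [sum_boole]
  have h1 : #{i : Fin d | y (θ (a, i)) ≠ a} ≤ d - deg y a := by
    have : (univ.filter fun i : Fin d => y (θ (a, i)) ≠ a) ⊆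
        univ.filter fun i : Fin d => deg y a ≤ (i : ℕ) := by
      intro i hi
      simp only [mem_filter, mem_univ, true_and] at hi ⊢
      by_contra hlt
      exact hi (hθ a i (by omega))
    refine (card_le_card this).trans ?_
    have h2 : #(univ.filter fun i : Fin d => deg y a ≤ (i : ℕ)) ≤ #(Finset.Ico (deg y a) d) := by
      refine card_le_card_of_injOn (fun i => (i : ℕ)) (fun i hi => ?_) (fun i _ j _ h => Fin.ext h)
      have := i.2
      simp at hi ⊢
      omega
    simpa using h2
  have h3 : ((d - deg y a : ℕ) : ℝ) ≤ |(deg y a : ℝ) - d| := by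
    rcases le_total (deg y a) d with h | h
    · rw [Nat.cast_sub h, abs_sub_comm]; exact le_abs_self _
    · rw [Nat.sub_eq_zero_of_le h]; simp
  exact le_trans (by exact_mod_cast h1) h3

lemma zet_in [NeZero d] (y : Fin m × Bool → Fin N) (θ : (Fin N × Fin d) ≃ (Fin m × Bool))
    (hθ : ∀ v (i : Fin d), (i : ℕ) < deg y v → y (θ (v, i)) = v) (S S' : Finset (Fin N)) :
    (d : ℝ) * (#S - ∑ a ∈ S, zet (y ∘ θ) S' a) ≤ ∑ a ∈ S, |(deg y a : ℝ) - d| + d * #(S \ S') := by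
  have h1 : (#(S \ S') : ℝ) = ∑ a ∈ S, if a ∉ S' then (1 : ℝ) else 0 := by
    rw [sum_boole, filter_notMem_eq_sdiff]
  rw [h1, mul_sum, ← sum_add_distrib, mul_sub, mul_sum]
  have h2 : (d : ℝ) * #S = ∑ a ∈ S, (d : ℝ) := by simp [mul_comm]
  rw [h2, ← sum_sub_distrib]
  refine sum_le_sum fun a _ => ?_
  refine le_trans ?_ (add_le_add (card_mismatch_le y θ hθ a) le_rfl)
  rw [mul_zet]
  have h3 : (d : ℝ) = ∑ _i : Fin d, (1 : ℝ) := by simp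
  have h4 : (d : ℝ) * (if a ∉ S' then (1 : ℝ) else 0) = ∑ _i : Fin d, (if a ∉ S' then (1 : ℝ) else 0) := by
    simp
  rw [h4, ← sum_add_distrib]
  nth_rewrite 1 [h3]
  rw [← sum_sub_distrib]
  refine sum_le_sum fun i _ => ?_
  simp only [Function.comp]
  by_cases h5 : y (θ (a, i)) = a
  · by_cases h6 : a ∈ S' <;> simp [h5, h6]
  · by_cases h6 : a ∈ S' <;> by_cases h7 : y (θ (a, i)) ∈ S' <;> simp [h5, h6, h7]

lemma zet_out [NeZero d] (y : Fin m × Bool → Fin N) (θ : (Fin N × Fin d) ≃ (Fin m × Bool))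
    (hθ : ∀ v (i : Fin d), (i : ℕ) < deg y v → y (θ (v, i)) = v) (S S' : Finset (Fin N)) :
    (d : ℝ) * (∑ a ∈ Sᶜ, zet (y ∘ θ) S' a) ≤ ∑ a ∈ Sᶜ, |(deg y a : ℝ) - d| + d * #(S' \ S) := by
  have h1 : (#(S' \ S) : ℝ) = ∑ a ∈ Sᶜ, if a ∈ S' then (1 : ℝ) else 0 := by
    rw [sum_boole]
    congr 2
    ext v
    simp [and_comm]
  rw [h1, mul_sum, mul_sum, ← sum_add_distrib]
  refine sum_le_sum fun a _ => ?_
  refine le_trans ?_ (add_le_add (card_mismatch_le y θ hθ a) le_rfl)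
  rw [mul_zet]
  have h4 : (d : ℝ) * (if a ∈ S' then (1 : ℝ) else 0) = ∑ _i : Fin d, (if a ∈ S' then (1 : ℝ) else 0) := by
    simp
  rw [h4, ← sum_add_distrib]
  refine sum_le_sum fun i _ => ?_
  simp only [Function.comp]
  by_cases h5 : y (θ (a, i)) = a
  · by_cases h6 : a ∈ S' <;> simp [h5, h6]
  · by_cases h6 : a ∈ S' <;> by_cases h7 : y (θ (a, i)) ∈ S' <;> simp [h5, h6, h7]

lemma pIn_mem [NeZero d] (b : Fin N × Fin d → Fin N) (Ψ : Finset (Fin N) → Finset (Fin N))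
    (S : Finset (Fin N)) (hS : #S = n) : 0 ≤ pIn b Ψ n S ∧ pIn b Ψ n S ≤ 1 := by
  refine ⟨div_nonneg (sum_nonneg fun a _ => zet_nonneg _ _ _) (by positivity), ?_⟩
  refine div_le_one_of_le₀ ?_ (by positivity)
  calc _ ≤ ∑ a ∈ S, (1 : ℝ) := sum_le_sum fun a _ => zet_le_one _ _ _
    _ = n := by simp [hS]

lemma pOut_mem [NeZero d] (b : Fin N × Fin d → Fin N) (Ψ : Finset (Fin N) → Finset (Fin N))
    (S : Finset (Fin N)) (hS : (#Sᶜ : ℝ) = N - n) : 0 ≤ pOut b Ψ n S ∧ pOut b Ψ n S ≤ 1 := by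
  have h0 : (0 : ℝ) ≤ N - n := by rw [← hS]; positivity
  refine ⟨div_nonneg (sum_nonneg fun a _ => zet_nonneg _ _ _) h0, ?_⟩
  refine div_le_one_of_le₀ ?_ h0
  calc _ ≤ ∑ a ∈ Sᶜ, (1 : ℝ) := sum_le_sum fun a _ => zet_le_one _ _ _
    _ = N - n := by rw [← hS]; simp

lemma coupling_alg {N n d P1 P0 K k T Q g : ℝ} (hd : 0 < d) (hn : 0 < n) (hN : n < N)
    (hK : 0 ≤ K) (h10 : 0 ≤ P1) (h11 : P1 ≤ 1) (h00 : 0 ≤ P0) (h01 : P0 ≤ 1)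
    (hg : d * (n * P1 + (N - n) * P0) = d * n + g) (hgQ : g ^ 2 ≤ N * Q)
    {T1 T2 : ℝ} (hT : T1 + T2 = T) (hT1 : 0 ≤ T1) (hT2 : 0 ≤ T2)
    (h1 : d * (n - n * P1) ≤ T1 + d * k) (h2 : d * ((N - n) * P0) ≤ T2 + d * k) :
    d * n * (N - n) / N + (1 - 2 * n / N) * g - Q / d - 2 * K * (T / d + k) * (N / (n * (N - n))) ≤
      (d * n * (P1 - P1 ^ 2) + d * (N - n) * (P0 - P0 ^ 2)) + d * n * (N - n) / N * (P1 - P0) ^ 2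
        - K * (1 - (P1 - P0) ^ 2) := by
  have hN0 : 0 < N := hn.trans hN
  have hNn : 0 < N - n := by linarith
  have hid : (d * n * (P1 - P1 ^ 2) + d * (N - n) * (P0 - P0 ^ 2)) + d * n * (N - n) / N * (P1 - P0) ^ 2
      = d * n * (N - n) / N + (1 - 2 * n / N) * g - g ^ 2 / (d * N) := by
    have hg' : g = d * (n * P1 + (N - n) * P0) - d * n := by linarith
    subst hg'
    field_simp
    ring
  have hq : g ^ 2 / (d * N) ≤ Q / d := by
    rw [div_le_div_iff₀ (by positivity) hd]
    nlinarith
  have hp1 : 1 - P1 ≤ (T1 / d + k) / n := by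
    rw [le_div_iff₀ hn]
    have : d * ((1 - P1) * n) ≤ d * (T1 / d + k) := by
      rw [mul_add, mul_div_cancel₀ _ hd.ne']; linarith
    exact le_of_mul_le_mul_left this hd
  have hp0 : P0 ≤ (T2 / d + k) / (N - n) := by
    rw [le_div_iff₀ hNn]
    have : d * (P0 * (N - n)) ≤ d * (T2 / d + k) := by
      rw [mul_add, mul_div_cancel₀ _ hd.ne']; linarith
    exact le_of_mul_le_mul_left this hd
  have hsum : (T1 / d + k) / n + (T2 / d + k) / (N - n) ≤ (T / d + k) * (N / (n * (N - n))) := by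
    have e1 : (T / d + k) * (N / (n * (N - n))) - ((T1 / d + k) / n + (T2 / d + k) / (N - n)) =
      (T1 / d) / (N - n) + (T2 / d) / n := by
      subst hT
      field_simp
      ring
    have : 0 ≤ (T1 / d) / (N - n) + (T2 / d) / n := by positivity
    linarith
  have hx : 1 - (P1 - P0) ^ 2 ≤ 2 * ((1 - P1) + P0) := by nlinarith
  have hfin : K * (1 - (P1 - P0) ^ 2) ≤ K * (2 * ((T / d + k) * (N / (n * (N - n))))) :=
    mul_le_mul_of_nonneg_left (by linarith) hK
  rw [hid]
  linarith

lemma expect_lin_le {ι : Type*} [Fintype ι] [Nonempty ι] (X Y Z V : ι → ℝ) (c0 c1 c2 c3 : ℝ)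
    (h : ∀ τ, c0 + c1 * Z τ + c2 * V τ ≤ X τ + c3 * Y τ) :
    c0 + c1 * 𝔼 τ, Z τ + c2 * 𝔼 τ, V τ ≤ 𝔼 τ, X τ + c3 * 𝔼 τ, Y τ := by
  have h1 := expect_le_expect (s := univ) fun τ _ => h τ
  rw [expect_add_distrib, expect_add_distrib, expect_add_distrib, ← mul_expect, ← mul_expect,
    ← mul_expect, expect_const univ_nonempty] at h1
  exact h1

/-- the number of exchanges -/
noncomputable def kap (L H S : Finset (Fin N)) : ℝ := ((min #(L ∩ S) #(H \ S) : ℕ) : ℝ)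

theorem coupling_main [NeZero d] (e : (Fin m × Bool) ≃ (Fin N × Fin d)) (y : Fin m × Bool → Fin N)
    (hc : 2 * m = N * d) (L H : Finset (Fin N)) (Δ : ℝ)
    (hL : ∀ v ∈ L, (deg y v : ℝ) - d ≤ -Δ) (hH : ∀ v ∈ H, Δ ≤ (deg y v : ℝ) - d)
    (hLH : Disjoint L H)
    (hn : 2 ≤ n) (hN : 2 * n ≤ N) (hm : 1 ≤ m) (hbal : IsBal d (fun p => (e p).1))
    (s0 : Finset (Fin N)) (hs0 : #s0 = n) (K R : ℝ) (hK : 0 ≤ K)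
    (hR : R = 𝔼 σ : Equiv.Perm (Fin m × Bool), (fS n ((fun p => (e p).1) ∘ σ) : ℝ))
    (hRK : R ≤ d * n * (N - n) / N + K) :
    R + (𝔼 τ : Equiv.Perm (Fin N), kap L H (s0.map τ.toEmbedding)) *
        ((1 - 2 * n / N) * (2 * Δ) - 2 * K * (N / (n * (N - n)))) -
      (∑ v, ((deg y v : ℝ) - d) ^ 2) / d -
      2 * K * ((∑ v, |(deg y v : ℝ) - d|) / d) * (N / (n * (N - n))) - 7 * d ≤
    𝔼 σ : Equiv.Perm (Fin m × Bool), (fS n (y ∘ σ) : ℝ) := by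
  obtain ⟨θ, hθ⟩ := exists_arrange y hc
  choose Ψ hΨ1 hΨ2 hΨ3 hΨ4 using exists_exchange L H hLH (fun v => (deg y v : ℝ) - d) Δ hL hH
  have hco := coupling_sum e y θ Ψ hΨ1 hn (by omega) hm hbal s0 hs0
  rw [← hR] at hco
  refine le_trans ?_ hco
  have hn' : (2 : ℝ) ≤ n := by exact_mod_cast hn
  have hN' : 2 * (n : ℝ) ≤ N := by exact_mod_cast hN
  have hd : (0 : ℝ) < d := by exact_mod_cast Nat.pos_of_ne_zero (NeZero.ne d)
  set Q := ∑ v, ((deg y v : ℝ) - d) ^ 2 with hQ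
  set T := ∑ v, |(deg y v : ℝ) - d| with hT
  -- pointwise inequality
  have hpt : ∀ τ : Equiv.Perm (Fin N),
      d * n * (N - n) / N + (1 - 2 * n / N) * (∑ v ∈ s0.map τ.toEmbedding, ((deg y v : ℝ) - d) +
        2 * Δ * kap L H (s0.map τ.toEmbedding)) - Q / d -
        2 * K * (T / d + kap L H (s0.map τ.toEmbedding)) * (N / (n * (N - n))) ≤
      (d * n * (pIn (y ∘ θ) Ψ n (s0.map τ.toEmbedding) -
        pIn (y ∘ θ) Ψ n (s0.map τ.toEmbedding) ^ 2) +
      d * (N - n) * (pOut (y ∘ θ) Ψ n (s0.map τ.toEmbedding) -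
        pOut (y ∘ θ) Ψ n (s0.map τ.toEmbedding) ^ 2)) + (d * n * (N - n) / N) *
        (pIn (y ∘ θ) Ψ n (s0.map τ.toEmbedding) - pOut (y ∘ θ) Ψ n (s0.map τ.toEmbedding)) ^ 2 -
      K * (1 - (pIn (y ∘ θ) Ψ n (s0.map τ.toEmbedding) -
        pOut (y ∘ θ) Ψ n (s0.map τ.toEmbedding)) ^ 2) := by
    intro τ
    set S := s0.map τ.toEmbedding with hS
    have hSn : #S = n := by rw [hS, card_map, hs0]
    have hScn : (#Sᶜ : ℝ) = N - n := by
      rw [card_compl, Fintype.card_fin, hSn, Nat.cast_sub (by omega)]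
    have hin : n * pIn (y ∘ θ) Ψ n S = ∑ a ∈ S, zet (y ∘ θ) (Ψ S) a := by
      rw [pIn, mul_div_cancel₀]; linarith
    have hout : (N - n) * pOut (y ∘ θ) Ψ n S = ∑ a ∈ Sᶜ, zet (y ∘ θ) (Ψ S) a := by
      rw [pOut, mul_div_cancel₀]; linarith
    set g := ∑ v ∈ Ψ S, ((deg y v : ℝ) - d) with hg
    have hk : (((min #(L ∩ S) #(H \ S) : ℕ) : ℕ) : ℝ) = kap L H S := rfl
    have key := coupling_alg (N := N) (n := n) (d := d) (P1 := pIn (y ∘ θ) Ψ n S)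
      (P0 := pOut (y ∘ θ) Ψ n S) (K := K) (k := kap L H S) (T := T) (Q := Q) (g := g)
      (T1 := ∑ v ∈ S, |(deg y v : ℝ) - d|) (T2 := ∑ v ∈ Sᶜ, |(deg y v : ℝ) - d|)
      hd (by linarith) (by linarith) hK
      (pIn_mem _ _ _ hSn).1 (pIn_mem _ _ _ hSn).2 (pOut_mem _ _ _ hScn).1 (pOut_mem _ _ _ hScn).2
      (by
        rw [hin, hout, sum_add_sum_compl, sum_zet, hg, sum_sub_distrib]
        simp [hΨ1, hSn]; ring)
      (by
        have h1 := sq_sum_le_card_mul_sum_sq (s := Ψ S) (f := fun v => (deg y v : ℝ) - d)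
        rw [hΨ1, hSn] at h1
        refine h1.trans ?_
        have h2 : ∑ v ∈ Ψ S, ((deg y v : ℝ) - d) ^ 2 ≤ Q :=
          sum_le_sum_of_subset_of_nonneg (subset_univ _) fun v _ _ => sq_nonneg _
        have h3 : 0 ≤ ∑ v ∈ Ψ S, ((deg y v : ℝ) - d) ^ 2 := sum_nonneg fun v _ => sq_nonneg _
        exact mul_le_mul (by linarith) h2 h3 (by linarith))
      (by rw [sum_add_sum_compl])
      (sum_nonneg fun v _ => abs_nonneg _) (sum_nonneg fun v _ => abs_nonneg _)
      (by
        rw [hin]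
        have h1 := zet_in y θ hθ S (Ψ S)
        rw [hSn] at h1
        refine h1.trans (add_le_add le_rfl (mul_le_mul_of_nonneg_left ?_ hd.le))
        rw [← hk]; exact_mod_cast hΨ3 S)
      (by
        rw [hout]
        refine (zet_out y θ hθ S (Ψ S)).trans (add_le_add le_rfl (mul_le_mul_of_nonneg_left ?_ hd.le))
        rw [← hk]; exact_mod_cast hΨ4 S)
    refine le_trans ?_ key
    have h5 : ∑ v ∈ S, ((deg y v : ℝ) - d) + 2 * Δ * kap L H S ≤ g := by
      rw [← hk]; exact hΨ2 S
    have h6 : 0 ≤ 1 - 2 * (n : ℝ) / N := by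
      rw [sub_nonneg, div_le_one (by linarith)]; exact hN'
    have := mul_le_mul_of_nonneg_left h5 h6
    linarith
  have hzero : 𝔼 τ : Equiv.Perm (Fin N), ∑ v ∈ s0.map τ.toEmbedding, ((deg y v : ℝ) - d) = 0 := by
    simp_rw [sum_map]
    rw [expect_sum_comm]
    refine sum_eq_zero fun u _ => ?_
    have h1 := expect_perm_apply (fun v => (deg y v : ℝ) - d) u
    refine Eq.trans h1 ?_
    rw [Fintype.expect_eq_sum_div_card, sum_sub_distrib]
    have h2 : ∑ v, (deg y v : ℝ) = N * d := by
      have := card_eq_sum_card_fiberwise (f := y) (s := univ) (t := univ) (fun p _ => by simp)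
      rw [card_univ] at this
      simp only [Fintype.card_prod, Fintype.card_fin, Fintype.card_bool] at this
      have h3 : (∑ v, deg y v) = N * d := by rw [← hc, mul_comm, this]; rfl
      exact_mod_cast h3
    rw [h2]; simp
  set κ := 𝔼 τ : Equiv.Perm (Fin N), kap L H (s0.map τ.toEmbedding) with hκ
  have hY1 : ∀ τ : Equiv.Perm (Fin N), (pIn (y ∘ θ) Ψ n (s0.map τ.toEmbedding) -
      pOut (y ∘ θ) Ψ n (s0.map τ.toEmbedding)) ^ 2 ≤ 1 := by
    intro τ
    set S := s0.map τ.toEmbedding with hS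
    have hSn : #S = n := by rw [hS, card_map, hs0]
    have hScn : (#Sᶜ : ℝ) = N - n := by
      rw [card_compl, Fintype.card_fin, hSn, Nat.cast_sub (by omega)]
    have h1 := pIn_mem (y ∘ θ) Ψ S hSn
    have h2 := pOut_mem (y ∘ θ) Ψ S hScn
    rw [sq_le_one_iff_abs_le_one, abs_le]
    constructor <;> linarith
  have hEY : 𝔼 τ : Equiv.Perm (Fin N), (pIn (y ∘ θ) Ψ n (s0.map τ.toEmbedding) -
      pOut (y ∘ θ) Ψ n (s0.map τ.toEmbedding)) ^ 2 ≤ 1 := by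
    refine (expect_le_expect fun τ _ => hY1 τ).trans ?_
    simp
  have hex := expect_lin_le (ι := Equiv.Perm (Fin N))
    (fun τ => d * n * (pIn (y ∘ θ) Ψ n (s0.map τ.toEmbedding) -
        pIn (y ∘ θ) Ψ n (s0.map τ.toEmbedding) ^ 2) +
      d * (N - n) * (pOut (y ∘ θ) Ψ n (s0.map τ.toEmbedding) -
        pOut (y ∘ θ) Ψ n (s0.map τ.toEmbedding) ^ 2))
    (fun τ => (pIn (y ∘ θ) Ψ n (s0.map τ.toEmbedding) -
      pOut (y ∘ θ) Ψ n (s0.map τ.toEmbedding)) ^ 2)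
    (fun τ => ∑ v ∈ s0.map τ.toEmbedding, ((deg y v : ℝ) - d))
    (fun τ => kap L H (s0.map τ.toEmbedding))
    (d * n * (N - n) / N - Q / d - 2 * K * (T / d) * (N / (n * (N - n))) + K)
    (1 - 2 * n / N)
    ((1 - 2 * n / N) * (2 * Δ) - 2 * K * (N / (n * (N - n))))
    (d * n * (N - n) / N + K)
    (fun τ => by have := hpt τ; linarith)
  rw [hzero, ← hκ] at hex
  have hfin := mul_le_mul_of_nonneg_left hEY (sub_nonneg.mpr hRK)
  linarith

/-- lower bound for the number of exchanges -/
lemma kap_ge (L H : Finset (Fin N)) (hLH : Disjoint L H) (s0 : Finset (Fin N)) (hs0 : #s0 = n)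
    (hN : 2 ≤ N) :
    (#L : ℝ) * #H * (n * (N - n)) / N ^ 3 ≤
      𝔼 τ : Equiv.Perm (Fin N), kap L H (s0.map τ.toEmbedding) := by
  have hN' : (2 : ℝ) ≤ N := by exact_mod_cast hN
  have h1 : ∀ τ : Equiv.Perm (Fin N), (∑ u ∈ s0, ∑ u' ∈ s0ᶜ,
      (if τ u ∈ L then (1 : ℝ) else 0) * (if τ u' ∈ H then (1 : ℝ) else 0)) / N ≤
      kap L H (s0.map τ.toEmbedding) := by
    intro τ
    have e1 : ∑ u ∈ s0, (if τ u ∈ L then (1 : ℝ) else 0) = #(L ∩ s0.map τ.toEmbedding) := by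
      have : L ∩ s0.map τ.toEmbedding = (s0.filter fun u => τ u ∈ L).map τ.toEmbedding := by
        ext v; simp [mem_map_equiv, and_comm]
      rw [this, card_map, sum_boole]
    have e2 : ∑ u ∈ s0ᶜ, (if τ u ∈ H then (1 : ℝ) else 0) = #(H \ s0.map τ.toEmbedding) := by
      have : H \ s0.map τ.toEmbedding = (s0ᶜ.filter fun u => τ u ∈ H).map τ.toEmbedding := by
        ext v; simp [mem_map_equiv, and_comm]
      rw [this, card_map, sum_boole]
    rw [← sum_mul_sum, e1, e2, kap, div_le_iff₀ (by linarith)]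
    have b1 : #(L ∩ s0.map τ.toEmbedding) ≤ N := (card_le_univ _).trans (by simp)
    have b2 : #(H \ s0.map τ.toEmbedding) ≤ N := (card_le_univ _).trans (by simp)
    have : #(L ∩ s0.map τ.toEmbedding) * #(H \ s0.map τ.toEmbedding) ≤
        min #(L ∩ s0.map τ.toEmbedding) #(H \ s0.map τ.toEmbedding) * N := by
      rcases le_total #(L ∩ s0.map τ.toEmbedding) #(H \ s0.map τ.toEmbedding) with h | h
      · rw [min_eq_left h]; gcongr
      · rw [min_eq_right h, mul_comm]; gcongr
    exact_mod_cast this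
  refine le_trans ?_ (expect_le_expect fun τ _ => h1 τ)
  rw [← expect_div]
  rw [expect_sum_comm]
  simp_rw [expect_sum_comm]
  have h2 : ∀ u ∈ s0, ∀ u' ∈ s0ᶜ, (#L : ℝ) * #H / N ^ 2 ≤ 𝔼 τ : Equiv.Perm (Fin N),
      (if τ u ∈ L then (1 : ℝ) else 0) * (if τ u' ∈ H then (1 : ℝ) else 0) := by
    intro u hu u' hu'
    have hne : u ≠ u' := by rintro rfl; exact (mem_compl.mp hu') hu
    have h3 := expect_perm_pair (fun v w => (if v ∈ L then (1 : ℝ) else 0) *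
      (if w ∈ H then (1 : ℝ) else 0)) hne
    have h4 : ∑ p ∈ (univ : Finset (Fin N)).offDiag, ((if p.1 ∈ L then (1 : ℝ) else 0) *
      (if p.2 ∈ H then (1 : ℝ) else 0)) = #L * #H := by
      have : ∑ p ∈ (univ : Finset (Fin N)).offDiag, ((if p.1 ∈ L then (1 : ℝ) else 0) *
        (if p.2 ∈ H then (1 : ℝ) else 0)) = ∑ p : Fin N × Fin N, ((if p.1 ∈ L then (1 : ℝ) else 0) *
        (if p.2 ∈ H then (1 : ℝ) else 0)) := by
        refine sum_subset (subset_univ _) fun p _ hp => ?_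
        have : p.1 = p.2 := by simpa using hp
        rw [this]
        by_cases h5 : p.2 ∈ L
        · simp [disjoint_left.mp hLH h5]
        · simp [h5]
      rw [this, Fintype.sum_prod_type]
      refine (sum_mul_sum univ univ (fun v : Fin N => if v ∈ L then (1 : ℝ) else 0)
        (fun v : Fin N => if v ∈ H then (1 : ℝ) else 0)).symm.trans ?_
      simp
    rw [h4] at h3
    have h0 : 0 ≤ 𝔼 τ : Equiv.Perm (Fin N),
      (if τ u ∈ L then (1 : ℝ) else 0) * (if τ u' ∈ H then (1 : ℝ) else 0) :=
      expect_nonneg fun τ _ => by positivity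
    rw [div_le_iff₀ (by positivity), ← h3]
    nlinarith
  have h5 : (n : ℝ) * (N - n) * ((#L : ℝ) * #H / N ^ 2) ≤ ∑ u ∈ s0, ∑ u' ∈ s0ᶜ, 𝔼 τ : Equiv.Perm (Fin N),
      (if τ u ∈ L then (1 : ℝ) else 0) * (if τ u' ∈ H then (1 : ℝ) else 0) := by
    refine le_trans ?_ (sum_le_sum fun u hu => sum_le_sum fun u' hu' => h2 u hu u' hu')
    have hle : n ≤ N := by rw [← hs0]; exact (card_le_univ _).trans (by simp)
    simp only [sum_const, nsmul_eq_mul, card_compl, Fintype.card_fin, hs0, Nat.cast_sub hle]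
    rw [mul_assoc]
  rw [le_div_iff₀ (by linarith)]
  refine le_trans (le_of_eq ?_) h5
  field_simp

end Coup2


/-! ### Part 9: comparison of label sequences with the Erdős–Rényi graph -/

section ER
variable {m N n : ℕ}

/-- Potential edges. -/
abbrev EE (N : ℕ) := {e : Sym2 (Fin N) // ¬ e.IsDiag}

/-- graph from a set of potential edges -/
def toG (s : Finset (EE N)) : SimpleGraph (Fin N) := SimpleGraph.fromEdgeSet (Subtype.val '' (s : Set (EE N)))

lemma edgeSet_toG (s : Finset (EE N)) : (toG s).edgeSet = Subtype.val '' (s : Set (EE N)) := by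
  rw [toG, SimpleGraph.edgeSet_fromEdgeSet]
  ext e
  simp only [Set.mem_sdiff, Set.mem_image, mem_coe]
  constructor
  · exact fun h => h.1
  · rintro ⟨e', he', rfl⟩
    exact ⟨⟨e', he', rfl⟩, e'.2⟩

lemma numEdges_toG (s : Finset (EE N)) : numEdges (toG s) = #s := by
  rw [numEdges, edgeSet_toG, Nat.card_image_of_injective Subtype.val_injective]
  simp

lemma toG_adj (s : Finset (EE N)) {a b : Fin N} :
    (toG s).Adj a b ↔ ∃ h, (⟨s(a, b), h⟩ : EE N) ∈ s := by
  rw [← SimpleGraph.mem_edgeSet, edgeSet_toG]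
  simp

lemma toG_bij : Function.Bijective (toG : Finset (EE N) → SimpleGraph (Fin N)) := by
  classical
  constructor
  · intro s t h
    have := congrArg SimpleGraph.edgeSet h
    rw [edgeSet_toG, edgeSet_toG] at this
    exact_mod_cast Subtype.val_injective.image_injective this
  · intro G
    refine ⟨univ.filter fun e => e.1 ∈ G.edgeSet, ?_⟩
    rw [← SimpleGraph.edgeSet_inj, edgeSet_toG]
    ext e
    simp only [Set.mem_image, coe_filter, mem_univ, true_and]
    constructor
    · rintro ⟨e', he', rfl⟩; exact he'
    · intro he; exact ⟨⟨e, G.not_isDiag_of_mem_edgeSet he⟩, he, rfl⟩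

lemma card_EE : Fintype.card (EE N) = N.choose 2 := by
  rw [Sym2.card_subtype_not_diag, Fintype.card_fin]

open Classical in
lemma sum_graph_eq (W : SimpleGraph (Fin N) → ℝ) :
    ∑ G : SimpleGraph (Fin N), W G = ∑ s : Finset (EE N), W (toG s) :=
  (Fintype.sum_bijective toG toG_bij _ _ fun _ => rfl).symm

/-- the first `k` potential edges -/
noncomputable def Sk (N k : ℕ) : Finset (EE N) := univ.filter fun e => ((Fintype.equivFin (EE N)) e : ℕ) < k

lemma card_Sk {k : ℕ} (hk : k ≤ N.choose 2) : #(Sk N k) = k := by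
  rw [Sk, card_equiv (t := univ.filter fun i : Fin (Fintype.card (EE N)) => (i : ℕ) < k)
    (Fintype.equivFin (EE N)) (by simp)]
  rw [Fin.card_filter_val_lt, card_EE, min_eq_right hk]

lemma card_Sk_sdiff {k l : ℕ} (hl : l ≤ N.choose 2) : #(Sk N l \ Sk N k) ≤ l - k := by
  rcases le_total k l with h | h
  · have hs : Sk N k ⊆ Sk N l := by
      intro e he
      simp only [Sk, mem_filter, mem_univ, true_and] at he ⊢
      omega
    rw [card_sdiff_of_subset hs, card_Sk hl, card_Sk (h.trans hl)]
  · have hs : Sk N l ⊆ Sk N k := by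
      intro e he
      simp only [Sk, mem_filter, mem_univ, true_and] at he ⊢
      omega
    simp [sdiff_eq_empty_iff_subset.mpr hs]

/-- symmetrised function of the number of edges -/
noncomputable def gsym (f : SimpleGraph (Fin N) → ℝ) (k : ℕ) : ℝ :=
  𝔼 π : Equiv.Perm (EE N), f (toG ((Sk N k).map π.toEmbedding))

lemma expect_map_eq' {β : Type*} [Fintype β] [DecidableEq β] (h : Finset β → ℝ) {s s0 : Finset β}
    (hs : #s = #s0) :
    𝔼 τ : Equiv.Perm β, h (s.map τ.toEmbedding) =
      𝔼 τ : Equiv.Perm β, h (s0.map τ.toEmbedding) := by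
  have hc : Fintype.card {v // v ∈ s} = Fintype.card {v // v ∈ s0} := by simpa using hs
  set π : Equiv.Perm β := (Fintype.equivOfCardEq hc).extendSubtype with hπ
  have h1 : s.map π.toEmbedding = s0 := by
    refine eq_of_subset_of_card_le ?_ (by rw [card_map, hs])
    intro v hv
    obtain ⟨u, hu, rfl⟩ := mem_map.mp hv
    exact (Fintype.equivOfCardEq hc).extendSubtype_mem u hu
  rw [← expect_perm_mul_right (fun τ => h (s.map τ.toEmbedding)) π]
  refine expect_congr rfl fun τ _ => ?_
  rw [← h1, map_map]
  rfl

open Classical in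
lemma sum_sym (W f : SimpleGraph (Fin N) → ℝ) (hW : ∀ G G', numEdges G = numEdges G' → W G = W G') :
    ∑ G : SimpleGraph (Fin N), W G * f G = ∑ G : SimpleGraph (Fin N), W G * gsym f (numEdges G) := by
  rw [sum_graph_eq, sum_graph_eq]
  have h1 : ∀ π : Equiv.Perm (EE N), ∑ s : Finset (EE N), W (toG s) * f (toG s) =
      ∑ s : Finset (EE N), W (toG s) * f (toG (s.map π.toEmbedding)) := by
    intro π
    refine (Fintype.sum_equiv π.finsetCongr _ _ fun s => ?_).symm
    have : π.finsetCongr s = s.map π.toEmbedding := rfl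
    rw [this, hW (toG (s.map π.toEmbedding)) (toG s) (by simp [numEdges_toG])]
  have h2 : ∑ s : Finset (EE N), W (toG s) * f (toG s) = 𝔼 π : Equiv.Perm (EE N),
      ∑ s : Finset (EE N), W (toG s) * f (toG (s.map π.toEmbedding)) := by
    rw [← expect_congr rfl fun π _ => h1 π, expect_const univ_nonempty]
  rw [h2, expect_sum_comm]
  refine sum_congr rfl fun s _ => ?_
  rw [← mul_expect]
  congr 1
  rw [gsym, numEdges_toG]
  refine expect_map_eq' (fun s => f (toG s)) ?_
  rw [card_Sk]
  rw [← card_EE]; exact card_le_univ _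

open Classical in
lemma cutCount_toG_le (s t : Finset (EE N)) (S : Finset (Fin N)) :
    cutCount (toG s) S ≤ cutCount (toG t) S + #(s \ t) := by
  rw [cutCount_eq, cutCount_eq]
  have hsub : (univ.filter fun p : Fin N × Fin N => p.1 ∈ S ∧ p.2 ∉ S ∧ (toG s).Adj p.1 p.2) ⊆
    (univ.filter fun p : Fin N × Fin N => p.1 ∈ S ∧ p.2 ∉ S ∧ (toG t).Adj p.1 p.2) ∪
    (univ.filter fun p : Fin N × Fin N => p.1 ∈ S ∧ p.2 ∉ S ∧ (toG (s \ t)).Adj p.1 p.2) := by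
    intro p hp
    simp only [mem_union, mem_filter, mem_univ, true_and, toG_adj, mem_sdiff] at hp ⊢
    obtain ⟨h1, h2, h, h3⟩ := hp
    by_cases h4 : (⟨s(p.1, p.2), h⟩ : EE N) ∈ t
    · exact Or.inl ⟨h1, h2, h, h4⟩
    · exact Or.inr ⟨h1, h2, h, h3, h4⟩
  refine (card_le_card hsub).trans ((card_union_le _ _).trans (Nat.add_le_add_left ?_ _))
  refine le_trans ?_ (card_map (⟨Subtype.val, Subtype.val_injective⟩ : EE N ↪ Sym2 (Fin N))).le
  refine card_le_card_of_injOn (fun p => s(p.1, p.2)) ?_ ?_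
  · intro p hp
    simp only [coe_filter, mem_univ, true_and, toG_adj] at hp
    obtain ⟨h1, h2, h, h3⟩ := hp
    simp only [mem_coe, mem_map]
    exact ⟨_, h3, rfl⟩
  · intro p hp q hq h
    simp only [coe_filter, mem_univ, true_and] at hp hq
    have h' : s(p.1, p.2) = s(q.1, q.2) := h
    rw [Sym2.eq_iff] at h'
    rcases h' with ⟨h1, h2⟩ | ⟨h1, h2⟩
    · exact Prod.ext h1 h2
    · exact absurd (h1 ▸ hp.1) hq.2.1

lemma mcut_toG_le (α : ℚ) (s t : Finset (EE N)) : mcut α (toG s) ≤ mcut α (toG t) + #(s \ t) := by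
  classical
  refine Finset.sup_le fun S hS => ?_
  refine (cutCount_toG_le s t S).trans ?_
  exact Nat.add_le_add_right (le_sup (f := fun s => cutCount (toG t) s) hS) _

lemma gsym_le (α : ℚ) {k l : ℕ} (hl : l ≤ N.choose 2) :
    gsym (N := N) (fun G => (mcut α G : ℝ)) l ≤ gsym (N := N) (fun G => (mcut α G : ℝ)) k + (l - k : ℕ) := by
  have : gsym (N := N) (fun G => (mcut α G : ℝ)) k + (l - k : ℕ) = 𝔼 π : Equiv.Perm (EE N),
      ((mcut α (toG ((Sk N k).map π.toEmbedding)) : ℝ) + (l - k : ℕ)) := by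
    rw [expect_add_distrib, expect_const univ_nonempty]; rfl
  rw [this]
  refine expect_le_expect fun π _ => ?_
  have h1 := mcut_toG_le α ((Sk N l).map π.toEmbedding) ((Sk N k).map π.toEmbedding)
  have h2 : #((Sk N l).map π.toEmbedding \ (Sk N k).map π.toEmbedding) ≤ l - k := by
    rw [← Finset.map_sdiff, card_map]
    exact card_Sk_sdiff hl
  have h3 := h1.trans (Nat.add_le_add_left h2 _)
  dsimp only
  exact_mod_cast h3

lemma numEdges_le (G : SimpleGraph (Fin N)) : numEdges G ≤ N.choose 2 := by
  obtain ⟨s, rfl⟩ := toG_bij.2 G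
  rw [numEdges_toG, ← card_EE]; exact card_le_univ _

/-- ER moments -/
lemma er_sum (p : ℝ) (φ : ℕ → ℝ) : erExp N p (fun G => φ (numEdges G)) =
    ∑ k ∈ range (N.choose 2 + 1), ((N.choose 2).choose k : ℝ) * p ^ k * (1 - p) ^ (N.choose 2 - k) * φ k := by
  classical
  rw [erExp]
  have h := sum_graph_eq (N := N) (fun G => p ^ numEdges G * (1 - p) ^ (N.choose 2 - numEdges G) * φ (numEdges G))
  have h2 := sum_powerset_apply_card (fun k => p ^ k * (1 - p) ^ (N.choose 2 - k) * φ k)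
    (x := (univ : Finset (EE N)))
  simp only [numEdges_toG] at h
  rw [powerset_univ, card_univ, card_EE] at h2
  have h3 : ∑ m ∈ range (N.choose 2 + 1), (N.choose 2).choose m • (p ^ m * (1 - p) ^ (N.choose 2 - m) * φ m) =
    ∑ k ∈ range (N.choose 2 + 1), ((N.choose 2).choose k : ℝ) * p ^ k * (1 - p) ^ (N.choose 2 - k) * φ k := by
    refine sum_congr rfl fun k _ => ?_
    rw [nsmul_eq_mul]; ring
  rw [← h3, ← h2, ← h]

lemma er_one (p : ℝ) : erExp N p (fun _ => 1) = 1 := by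
  have := er_sum (N := N) p (fun _ => 1)
  rw [this]
  have h := add_pow p (1 - p) (N.choose 2)
  simp only [add_sub_cancel, one_pow] at h
  refine Eq.trans ?_ h.symm
  refine sum_congr rfl fun k _ => ?_
  ring

lemma er_var (p : ℝ) : erExp N p (fun G => ((N.choose 2 : ℕ) * p - numEdges G) ^ 2) =
    (N.choose 2 : ℕ) * p * (1 - p) := by
  rw [er_sum p (fun k => ((N.choose 2 : ℕ) * p - k) ^ 2)]
  have h := congrArg (Polynomial.eval p) (bernsteinPolynomial.variance ℝ (N.choose 2))
  simp only [bernsteinPolynomial, Polynomial.eval_finsetSum] at h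
  simp at h
  rw [← h]
  refine sum_congr rfl fun k _ => ?_
  ring

lemma er_mono {p : ℝ} (hp : 0 ≤ p) (hp1 : p ≤ 1) {f g : SimpleGraph (Fin N) → ℝ} (h : ∀ G, f G ≤ g G) :
    erExp N p f ≤ erExp N p g := by
  refine sum_le_sum fun G _ => mul_le_mul_of_nonneg_left (h G) ?_
  have : 0 ≤ 1 - p := by linarith
  positivity

lemma er_sym (p : ℝ) (f : SimpleGraph (Fin N) → ℝ) :
    erExp N p f = erExp N p (fun G => gsym f (numEdges G)) := by
  classical
  have := sum_sym (N := N) (fun G => p ^ numEdges G * (1 - p) ^ (N.choose 2 - numEdges G)) f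
    (fun G G' h => by rw [h])
  rw [erExp, erExp]
  convert this using 1

lemma er_add (p : ℝ) (f g : SimpleGraph (Fin N) → ℝ) :
    erExp N p (fun G => f G + g G) = erExp N p f + erExp N p g := by
  simp only [erExp, mul_add, sum_add_distrib]

lemma er_smul (p c : ℝ) (f : SimpleGraph (Fin N) → ℝ) :
    erExp N p (fun G => c * f G) = c * erExp N p f := by
  simp only [erExp, mul_sum]
  refine sum_congr rfl fun G _ => ?_
  ring

lemma er_const (p c : ℝ) : erExp N p (fun _ => c) = c := by
  have := er_smul (N := N) p c (fun _ => 1)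
  simpa [er_one] using this

/-- mean absolute deviation of the number of edges -/
lemma er_dev {p : ℝ} (hp : 0 ≤ p) (hp1 : p ≤ 1) (c A : ℝ) (hA : 0 < A) :
    erExp N p (fun G => |c - numEdges G|) ≤
      |c - (N.choose 2 : ℕ) * p| + (A + (N.choose 2 : ℕ) * p / A) / 2 := by
  have h1 : erExp N p (fun G => |c - numEdges G|) ≤ erExp N p (fun G =>
      (|c - (N.choose 2 : ℕ) * p| + A / 2) + 1 / (2 * A) * ((N.choose 2 : ℕ) * p - numEdges G) ^ 2) := by
    refine er_mono hp hp1 fun G => ?_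
    have h2 : |c - numEdges G| ≤ |c - (N.choose 2 : ℕ) * p| + |(N.choose 2 : ℕ) * p - numEdges G| := by
      refine le_trans (le_of_eq ?_) (abs_add_le _ _)
      congr 1; ring
    have h3 : |((N.choose 2 : ℕ) : ℝ) * p - numEdges G| ≤ A / 2 + 1 / (2 * A) * ((N.choose 2 : ℕ) * p - numEdges G) ^ 2 := by
      rw [← sq_abs (((N.choose 2 : ℕ) : ℝ) * p - numEdges G)]
      set z := |((N.choose 2 : ℕ) : ℝ) * p - numEdges G|
      have : A / 2 + 1 / (2 * A) * z ^ 2 - z = (A - z) ^ 2 / (2 * A) := by field_simp; ring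
      have : 0 ≤ (A - z) ^ 2 / (2 * A) := by positivity
      linarith
    linarith
  refine h1.trans ?_
  rw [er_add, er_const, er_smul, er_var]
  have h4 : (N.choose 2 : ℕ) * p * (1 - p) ≤ ((N.choose 2 : ℕ) : ℝ) * p := by
    have : 0 ≤ ((N.choose 2 : ℕ) : ℝ) * p := by positivity
    nlinarith
  have h5 : 1 / (2 * A) * ((N.choose 2 : ℕ) * p * (1 - p)) ≤ 1 / (2 * A) * ((N.choose 2 : ℕ) * p) :=
    mul_le_mul_of_nonneg_left h4 (by positivity)
  have h6 : 1 / (2 * A) * (((N.choose 2 : ℕ) : ℝ) * p) = (N.choose 2 : ℕ) * p / A / 2 := by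
    field_simp
  linarith

/-- comparison of the ER expectation with `gsym` at `m` edges -/
lemma er_gsym (α : ℚ) {p : ℝ} (hp : 0 ≤ p) (hp1 : p ≤ 1) (hm : m ≤ N.choose 2) :
    |erExp N p (fun G => (mcut α G : ℝ)) - gsym (N := N) (fun G => (mcut α G : ℝ)) m| ≤
      erExp N p (fun G => |(m : ℝ) - numEdges G|) := by
  rw [er_sym, abs_sub_le_iff]
  constructor
  · rw [sub_le_iff_le_add, ← er_const (N := N) p (gsym (N := N) (fun G => (mcut α G : ℝ)) m), ← er_add]
    refine er_mono hp hp1 fun G => ?_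
    have h1 := gsym_le (N := N) α (k := m) (numEdges_le G)
    have h2 : ((numEdges G - m : ℕ) : ℝ) ≤ |(m : ℝ) - numEdges G| := by
      rcases le_total m (numEdges G) with h | h
      · rw [Nat.cast_sub h, abs_sub_comm]; exact le_abs_self _
      · rw [Nat.sub_eq_zero_of_le h]; simp
    linarith
  · rw [sub_le_iff_le_add]
    rw [← er_const (N := N) p (gsym (N := N) (fun G => (mcut α G : ℝ)) m), ← er_add]
    refine er_mono hp hp1 fun G => ?_
    have h1 := gsym_le (N := N) α (k := numEdges G) hm
    have h2 : ((m - numEdges G : ℕ) : ℝ) ≤ |(m : ℝ) - numEdges G| := by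
      rcases le_total m (numEdges G) with h | h
      · rw [Nat.sub_eq_zero_of_le h]; simp
      · rw [Nat.cast_sub h]; exact le_abs_self _
    linarith

/-- number of coincidences -/
noncomputable def coin (y : Fin m × Bool → Fin N) : ℕ :=
  #{i : Fin m | y (i, false) = y (i, true)} +
    #{q : Fin m × Fin m | q.1 ≠ q.2 ∧ ed y q.1 = ed y q.2}

/-- first indices -/
def goodI (y : Fin m × Bool → Fin N) : Finset (Fin m) :=
  univ.filter fun i => y (i, false) ≠ y (i, true) ∧ ∀ j, j < i → ed y j ≠ ed y i

lemma card_compl_goodI (y : Fin m × Bool → Fin N) : #(goodI y)ᶜ ≤ coin y := by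
  classical
  have hsub : (goodI y)ᶜ ⊆ (univ.filter fun i : Fin m => y (i, false) = y (i, true)) ∪
      (univ.filter fun q : Fin m × Fin m => q.1 ≠ q.2 ∧ ed y q.1 = ed y q.2).image Prod.snd := by
    intro i hi
    simp only [goodI, mem_compl, mem_filter, mem_univ, true_and, not_and] at hi
    simp only [mem_union, mem_filter, mem_univ, true_and, mem_image]
    by_cases h : y (i, false) = y (i, true)
    · exact Or.inl h
    · have := hi h
      push Not at this
      obtain ⟨j, hj, hj'⟩ := this
      exact Or.inr ⟨(j, i), ⟨hj.ne, hj'⟩, rfl⟩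
  refine (card_le_card hsub).trans ((card_union_le _ _).trans ?_)
  exact Nat.add_le_add_left card_image_le _

lemma goodI_inj (y : Fin m × Bool → Fin N) : Set.InjOn (ed y) (goodI y) := by
  intro i hi j hj h
  simp only [goodI, coe_filter, mem_univ, true_and] at hi hj
  rcases lt_trichotomy i j with h1 | h1 | h1
  · exact absurd h (hj.2 i h1)
  · exact h1
  · exact absurd h.symm (hi.2 j h1)

lemma goodI_edge (y : Fin m × Bool → Fin N) {i : Fin m} (hi : i ∈ goodI y) : ed y i ∈ (gam y).edgeSet := by
  simp only [goodI, mem_filter, mem_univ, true_and] at hi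
  rw [ed, SimpleGraph.mem_edgeSet, gam_adj]
  exact ⟨⟨i, rfl⟩, hi.1⟩

lemma numEdges_gam_ge (y : Fin m × Bool → Fin N) : m ≤ numEdges (gam y) + coin y := by
  classical
  have h1 : #(goodI y) ≤ numEdges (gam y) := by
    rw [numEdges, Nat.card_eq_fintype_card, ← SimpleGraph.edgeFinset_card]
    refine card_le_card_of_injOn (ed y) (fun i hi => ?_) (goodI_inj y)
    simpa using goodI_edge y hi
  have h2 := card_compl_goodI y
  have h3 := card_add_card_compl (goodI y)
  rw [Fintype.card_fin] at h3
  omega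

lemma numEdges_gam_le (y : Fin m × Bool → Fin N) : numEdges (gam y) ≤ m := by
  classical
  have h1 : (gam y).edgeFinset ⊆ univ.image (ed y) := by
    intro e he
    rw [SimpleGraph.mem_edgeFinset, gam, SimpleGraph.edgeSet_fromEdgeSet] at he
    simpa using he.1
  rw [numEdges, Nat.card_eq_fintype_card, ← SimpleGraph.edgeFinset_card]
  refine (card_le_card h1).trans (card_image_le.trans ?_)
  simp

lemma cutS_le_cutCount (y : Fin m × Bool → Fin N) (S : Finset (Fin N)) :
    cutS y S ≤ cutCount (gam y) S + coin y := by
  classical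
  rw [cutS]
  have hsub : (univ.filter fun i : Fin m => ¬ (y (i, false) ∈ S ↔ y (i, true) ∈ S)) ⊆
      ((goodI y).filter fun i : Fin m => ¬ (y (i, false) ∈ S ↔ y (i, true) ∈ S)) ∪ (goodI y)ᶜ := by
    intro i hi
    simp only [mem_filter, mem_univ, true_and, mem_union, mem_compl] at hi ⊢
    tauto
  refine (card_le_card hsub).trans ((card_union_le _ _).trans (Nat.add_le_add ?_ (card_compl_goodI y)))
  rw [cutCount_eq]
  refine card_le_card_of_injOn
    (fun i => if y (i, false) ∈ S then (y (i, false), y (i, true)) else (y (i, true), y (i, false))) ?_ ?_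
  · intro i hi
    simp only [coe_filter, Set.mem_ofPred_eq] at hi
    have he := goodI_edge y hi.1
    rw [ed, SimpleGraph.mem_edgeSet] at he
    simp only [coe_filter, mem_univ, true_and, Set.mem_ofPred_eq]
    by_cases h : y (i, false) ∈ S
    · simp only [h, if_true]
      exact ⟨trivial, by tauto, he⟩
    · simp only [h, if_false]
      exact ⟨by tauto, by tauto, he.symm⟩
  · intro i hi j hj h
    simp only [coe_filter, Set.mem_ofPred_eq] at hi hj
    refine goodI_inj y hi.1 hj.1 ?_
    have hk : ∀ i, ed y i = s((if y (i, false) ∈ S then (y (i, false), y (i, true)) else (y (i, true), y (i, false))).1,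
      (if y (i, false) ∈ S then (y (i, false), y (i, true)) else (y (i, true), y (i, false))).2) := by
      intro i
      by_cases h : y (i, false) ∈ S
      · simp [h, ed]
      · simp [h, ed, Sym2.eq_swap]
    rw [hk i, hk j]
    dsimp only at h
    rw [h]

lemma fS_le_mcut {α : ℚ} (hn : ⌊α * (N : ℚ)⌋₊ = n) (y : Fin m × Bool → Fin N) :
    fS n y ≤ mcut α (gam y) + coin y := by
  rw [mcut, hn]
  refine Finset.sup_le fun S hS => ?_
  exact (cutS_le_cutCount y S).trans (Nat.add_le_add_right
    (le_sup (f := fun s => cutCount (gam y) s) hS) _)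

lemma expect_gam_sym (f : SimpleGraph (Fin N) → ℝ) :
    𝔼 y : Fin m × Bool → Fin N, f (gam y) = 𝔼 y : Fin m × Bool → Fin N, gsym f (numEdges (gam y)) := by
  classical
  have h1 : ∀ g : SimpleGraph (Fin N) → ℝ, ∑ y : Fin m × Bool → Fin N, g (gam y) =
      ∑ G, (#{y : Fin m × Bool → Fin N | gam y = G} : ℝ) * g G := by
    intro g
    rw [← sum_fiberwise_of_maps_to (t := univ) (g := gam) (fun _ _ => mem_univ _)]
    refine sum_congr rfl fun G _ => ?_
    rw [← nsmul_eq_mul, ← sum_const]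
    refine sum_congr rfl fun y hy => ?_
    rw [(mem_filter.mp hy).2]
  rw [Fintype.expect_eq_sum_div_card, Fintype.expect_eq_sum_div_card, h1,
    h1 (fun G => gsym f (numEdges G))]
  congr 1
  exact sum_sym (fun G => (#{y : Fin m × Bool → Fin N | gam y = G} : ℝ)) f
    (fun G G' h => by exact_mod_cast card_gam_eq G G' h)

lemma seq_le_gsym [NeZero N] {α : ℚ} (hn : ⌊α * (N : ℚ)⌋₊ = n) (hm : m ≤ N.choose 2) :
    𝔼 y : Fin m × Bool → Fin N, (fS n y : ℝ) ≤ gsym (N := N) (fun G => (mcut α G : ℝ)) m +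
      𝔼 y : Fin m × Bool → Fin N, (coin y : ℝ) := by
  have h1 : 𝔼 y : Fin m × Bool → Fin N, (fS n y : ℝ) ≤ 𝔼 y : Fin m × Bool → Fin N, ((mcut α (gam y) : ℝ) + coin y) :=
    expect_le_expect fun y _ => by exact_mod_cast fS_le_mcut hn y
  refine h1.trans ?_
  rw [expect_add_distrib, expect_gam_sym (fun G => (mcut α G : ℝ))]
  refine add_le_add ?_ le_rfl
  refine (expect_le_expect fun y _ => ?_).trans (expect_const univ_nonempty
    (gsym (N := N) (fun G => (mcut α G : ℝ)) m)).le
  have h2 := gsym_le (N := N) α (k := m) (numEdges_le (gam y))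
  rw [Nat.sub_eq_zero_of_le (numEdges_gam_le y)] at h2
  simpa using h2

lemma gsym_le_seq [NeZero N] {α : ℚ} (hn : ⌊α * (N : ℚ)⌋₊ = n) (hm : m ≤ N.choose 2) :
    gsym (N := N) (fun G => (mcut α G : ℝ)) m ≤ 𝔼 y : Fin m × Bool → Fin N, (fS n y : ℝ) +
      𝔼 y : Fin m × Bool → Fin N, (coin y : ℝ) := by
  have h1 : 𝔼 y : Fin m × Bool → Fin N, (mcut α (gam y) : ℝ) ≤ 𝔼 y : Fin m × Bool → Fin N, (fS n y : ℝ) :=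
    expect_le_expect fun y _ => by exact_mod_cast mcut_gam_le hn y
  rw [expect_gam_sym (fun G => (mcut α G : ℝ))] at h1
  refine le_trans ?_ (add_le_add h1 le_rfl)
  rw [← expect_add_distrib]
  refine (expect_const univ_nonempty
    (gsym (N := N) (fun G => (mcut α G : ℝ)) m)).ge.trans (expect_le_expect fun y _ => ?_)
  have h2 := gsym_le (N := N) α (k := numEdges (gam y)) hm
  have h3 : ((m - numEdges (gam y) : ℕ) : ℝ) ≤ coin y := by
    have := numEdges_gam_ge y
    have : m - numEdges (gam y) ≤ coin y := by omega
    exact_mod_cast this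
  linarith

end ER


/-! ### Part 10: expectations over uniform label sequences -/

section Seq
variable {m N n d : ℕ}

lemma card_pair_le {p q : Fin m × Bool} (h : p ≠ q) :
    #{y : Fin m × Bool → Fin N | y p = y q} * N ≤ N ^ (2 * m) := by
  have h1 : #((univ.filter fun y : Fin m × Bool → Fin N => y p = y q) ×ˢ (univ : Finset (Fin N))) ≤
      #(univ : Finset (Fin m × Bool → Fin N)) := by
    refine card_le_card_of_injOn (fun z => Function.update z.1 p z.2) (fun _ _ => by simp) ?_
    rintro ⟨y, c⟩ hy ⟨y', c'⟩ hy' heq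
    simp only [coe_product, Set.mem_prod, coe_filter, mem_univ, true_and, Set.mem_ofPred_eq] at hy hy'
    dsimp only at heq
    have hoff : ∀ r, r ≠ p → y r = y' r := by
      intro r hr
      have := congrFun heq r
      simpa [Function.update_of_ne hr] using this
    have hc : c = c' := by simpa using congrFun heq p
    have hyy : y = y' := by
      funext r
      by_cases hr : r = p
      · rw [hr, hy.1, hy'.1, hoff q h.symm]
      · exact hoff r hr
    rw [hc, hyy]
  rw [card_product, card_univ, card_univ] at h1
  simpa [mul_comm] using h1

lemma card_pair2_le {p q p' q' : Fin m × Bool} (h1 : p ≠ p') (h2 : q ≠ p) (h3 : q ≠ p')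
    (h4 : q' ≠ p) (h5 : q' ≠ p') :
    #{y : Fin m × Bool → Fin N | y p = y q ∧ y p' = y q'} * N ^ 2 ≤ N ^ (2 * m) := by
  have h1 : #((univ.filter fun y : Fin m × Bool → Fin N => y p = y q ∧ y p' = y q') ×ˢ
      (univ : Finset (Fin N × Fin N))) ≤ #(univ : Finset (Fin m × Bool → Fin N)) := by
    refine card_le_card_of_injOn (fun z => Function.update (Function.update z.1 p z.2.1) p' z.2.2)
      (fun _ _ => by simp) ?_
    rintro ⟨y, c⟩ hy ⟨y', c'⟩ hy' heq
    simp only [coe_product, Set.mem_prod, coe_filter, mem_univ, true_and, Set.mem_ofPred_eq] at hy hy'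
    dsimp only at heq
    have hoff : ∀ r, r ≠ p → r ≠ p' → y r = y' r := by
      intro r hr hr'
      have := congrFun heq r
      simpa [Function.update_of_ne hr, Function.update_of_ne hr'] using this
    have hc : c.2 = c'.2 := by simpa using congrFun heq p'
    have hc1 : c.1 = c'.1 := by simpa [Function.update_of_ne h1] using congrFun heq p
    have hyy : y = y' := by
      funext r
      by_cases hr : r = p
      · rw [hr, hy.1.1, hy'.1.1, hoff q h2 h3]
      · by_cases hr' : r = p'
        · rw [hr', hy.1.2, hy'.1.2, hoff q' h4 h5]
        · exact hoff r hr hr'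
    rw [hyy]
    congr 1
    exact Prod.ext hc1 hc
  rw [card_product, card_univ, card_univ] at h1
  have : Fintype.card (Fin N × Fin N) = N ^ 2 := by simp [sq]
  rw [this] at h1
  simpa [mul_comm] using h1

lemma expect_ind [NeZero N] (P : (Fin m × Bool → Fin N) → Prop) [DecidablePred P] (k : ℕ)
    (h : #{y : Fin m × Bool → Fin N | P y} * N ^ k ≤ N ^ (2 * m)) :
    𝔼 y : Fin m × Bool → Fin N, (if P y then (1 : ℝ) else 0) ≤ 1 / N ^ k := by
  have hN : (0 : ℝ) < N := by exact_mod_cast Nat.pos_of_ne_zero (NeZero.ne N)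
  rw [Fintype.expect_eq_sum_div_card, sum_boole]
  have hc : Fintype.card (Fin m × Bool → Fin N) = N ^ (2 * m) := by simp [mul_comm]
  rw [hc]
  push_cast
  rw [div_le_div_iff₀ (by positivity) (by positivity), one_mul]
  exact_mod_cast h

lemma expect_coin_le [NeZero N] :
    𝔼 y : Fin m × Bool → Fin N, (coin y : ℝ) ≤ m / N + 2 * m ^ 2 / N ^ 2 := by
  classical
  have h1 : ∀ y : Fin m × Bool → Fin N, (coin y : ℝ) ≤
      ∑ i : Fin m, (if y (i, false) = y (i, true) then (1 : ℝ) else 0) +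
      ∑ q ∈ (univ : Finset (Fin m)).offDiag,
        ((if y (q.1, false) = y (q.2, false) ∧ y (q.1, true) = y (q.2, true) then (1 : ℝ) else 0) +
        (if y (q.1, false) = y (q.2, true) ∧ y (q.1, true) = y (q.2, false) then (1 : ℝ) else 0)) := by
    intro y
    rw [coin]
    push_cast
    refine add_le_add (by rw [sum_boole]) ?_
    have h2 : (#{q : Fin m × Fin m | q.1 ≠ q.2 ∧ ed y q.1 = ed y q.2} : ℝ) =
        ∑ q ∈ (univ : Finset (Fin m)).offDiag, if ed y q.1 = ed y q.2 then (1 : ℝ) else 0 := by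
      rw [sum_boole]
      congr 2
      ext q
      simp
    rw [h2]
    refine sum_le_sum fun q _ => ?_
    by_cases h3 : ed y q.1 = ed y q.2
    · rw [if_pos h3]
      rw [ed, ed, Sym2.eq_iff] at h3
      rcases h3 with h3 | h3
      · rw [if_pos h3]; split_ifs <;> norm_num
      · rw [if_pos h3]; split_ifs <;> norm_num
    · rw [if_neg h3]; split_ifs <;> norm_num
  refine (expect_le_expect fun y _ => h1 y).trans ?_
  rw [expect_add_distrib, expect_sum_comm, expect_sum_comm]
  refine add_le_add ?_ ?_
  · calc _ ≤ ∑ _i : Fin m, (1 : ℝ) / N ^ 1 := sum_le_sum fun i _ =>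
          expect_ind _ 1 (by rw [pow_one]; exact card_pair_le (by simp))
      _ = m / N := by simp; ring
  · have hN : (0 : ℝ) < N := by exact_mod_cast Nat.pos_of_ne_zero (NeZero.ne N)
    calc _ ≤ ∑ q ∈ (univ : Finset (Fin m)).offDiag, ((1 : ℝ) / N ^ 2 + 1 / N ^ 2) := by
          refine sum_le_sum fun q hq => ?_
          have hne : q.1 ≠ q.2 := (mem_offDiag.mp hq).2.2
          rw [expect_add_distrib]
          refine add_le_add ?_ ?_
          · refine expect_ind _ 2 (card_pair2_le ?_ ?_ ?_ ?_ ?_) <;> simp [hne, hne.symm]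
          · refine expect_ind _ 2 (card_pair2_le ?_ ?_ ?_ ?_ ?_) <;> simp [hne, hne.symm]
      _ ≤ (m : ℝ) ^ 2 * ((1 : ℝ) / (N : ℝ) ^ 2 + 1 / (N : ℝ) ^ 2) := by
          rw [sum_const, nsmul_eq_mul]
          refine mul_le_mul_of_nonneg_right ?_ (by positivity)
          rw [offDiag_card]
          simp only [card_univ, Fintype.card_fin]
          have : m * m - m ≤ m ^ 2 := by rw [sq]; omega
          exact_mod_cast this
      _ = _ := by ring

lemma sum_deg (y : Fin m × Bool → Fin N) : ∑ v, (deg y v : ℝ) = 2 * m := by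
  have := card_eq_sum_card_fiberwise (f := y) (s := univ) (t := univ) (fun p _ => by simp)
  rw [card_univ] at this
  simp only [Fintype.card_prod, Fintype.card_fin, Fintype.card_bool] at this
  have h3 : (∑ v, deg y v) = 2 * m := by rw [mul_comm, this]; rfl
  exact_mod_cast h3

lemma sum_deg_sq (y : Fin m × Bool → Fin N) : ∑ v, (deg y v : ℝ) ^ 2 =
    ∑ p : Fin m × Bool, ∑ q : Fin m × Bool, if y p = y q then (1 : ℝ) else 0 := by
  have h1 : ∀ v, (deg y v : ℝ) ^ 2 = ∑ p : Fin m × Bool, ∑ q : Fin m × Bool,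
      (if y p = v then (1 : ℝ) else 0) * (if y q = v then (1 : ℝ) else 0) := by
    intro v
    rw [← sum_mul_sum, sum_boole, sq]; rfl
  simp_rw [h1]
  rw [sum_comm]
  refine sum_congr rfl fun p _ => ?_
  rw [sum_comm]
  refine sum_congr rfl fun q _ => ?_
  rw [sum_eq_single (y p)]
  · simp [eq_comm]
  · intro v _ hv
    simp [hv.symm]
  · simp

lemma expect_Q_le [NeZero N] (hc : 2 * m = N * d) :
    𝔼 y : Fin m × Bool → Fin N, ∑ v, ((deg y v : ℝ) - d) ^ 2 ≤ d * N := by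
  have hN : (0 : ℝ) < N := by exact_mod_cast Nat.pos_of_ne_zero (NeZero.ne N)
  have hc' : (2 : ℝ) * m = N * d := by exact_mod_cast hc
  have h1 : ∀ y : Fin m × Bool → Fin N, ∑ v, ((deg y v : ℝ) - d) ^ 2 =
      ∑ p : Fin m × Bool, ∑ q : Fin m × Bool, (if y p = y q then (1 : ℝ) else 0) - N * d ^ 2 := by
    intro y
    rw [← sum_deg_sq]
    have : ∀ v, ((deg y v : ℝ) - d) ^ 2 = (deg y v : ℝ) ^ 2 - 2 * d * deg y v + d ^ 2 := fun v => by ring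
    simp_rw [this]
    rw [sum_add_distrib, sum_sub_distrib, ← mul_sum, sum_deg, hc']
    simp
    ring
  simp_rw [h1]
  rw [expect_sub_distrib, expect_const univ_nonempty, expect_sum_comm]
  have h2 : ∀ p : Fin m × Bool, 𝔼 y : Fin m × Bool → Fin N,
      ∑ q : Fin m × Bool, (if y p = y q then (1 : ℝ) else 0) ≤ 1 + d := by
    intro p
    rw [expect_sum_comm, ← add_sum_erase _ _ (mem_univ p)]
    refine add_le_add (by simp) ?_
    calc _ ≤ ∑ q ∈ univ.erase p, (1 : ℝ) / N ^ 1 := sum_le_sum fun q hq =>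
          expect_ind _ 1 (by rw [pow_one]; exact card_pair_le (ne_of_mem_erase hq).symm)
      _ ≤ (2 * m) * ((1 : ℝ) / N ^ 1) := by
          rw [sum_const, nsmul_eq_mul]
          refine mul_le_mul_of_nonneg_right ?_ (by positivity)
          have : #(univ.erase p) ≤ 2 * m := by
            rw [card_erase_of_mem (mem_univ _), card_univ]
            simp; omega
          exact_mod_cast this
      _ = d := by rw [hc', pow_one]; field_simp
  have h3 := sum_le_sum (s := univ) fun p _ => h2 p
  rw [sum_const, card_univ] at h3
  have h4 : ((Fintype.card (Fin m × Bool) : ℕ) : ℝ) = N * d := by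
    rw [← hc']; simp; ring
  rw [nsmul_eq_mul, h4] at h3
  linarith

lemma expect_perm_inv [NeZero N] (n : ℕ) :
    𝔼 y : Fin m × Bool → Fin N, 𝔼 σ : Equiv.Perm (Fin m × Bool), (fS n (y ∘ σ) : ℝ) =
    𝔼 y : Fin m × Bool → Fin N, (fS n y : ℝ) := by
  rw [expect_comm]
  have : ∀ σ : Equiv.Perm (Fin m × Bool), 𝔼 y : Fin m × Bool → Fin N, (fS n (y ∘ σ) : ℝ) =
      𝔼 y : Fin m × Bool → Fin N, (fS n y : ℝ) := by
    intro σ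
    refine Fintype.expect_equiv (σ.symm.arrowCongr (Equiv.refl _)) _ _ fun y => ?_
    rfl
  simp_rw [this]
  simp

/-- crossing indicator -/
def crs (S : Finset (Fin N)) (w : Bool → Fin N) : ℝ :=
  if ¬ (w false ∈ S ↔ w true ∈ S) then 1 else 0

lemma sum_crs (S : Finset (Fin N)) (hS : #S = n) : ∑ w : Bool → Fin N, crs S w = 2 * n * (N - n) := by
  have h1 : ∑ w : Bool → Fin N, crs S w = ∑ a : Fin N, ∑ b : Fin N,
      ((if a ∈ S then (1 : ℝ) else 0) * (if b ∈ S then (0 : ℝ) else 1) +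
       (if a ∈ S then (0 : ℝ) else 1) * (if b ∈ S then (1 : ℝ) else 0)) := by
    rw [← Fintype.sum_prod_type' (f := fun a b => ((if a ∈ S then (1 : ℝ) else 0) * (if b ∈ S then (0 : ℝ) else 1) +
       (if a ∈ S then (0 : ℝ) else 1) * (if b ∈ S then (1 : ℝ) else 0)))]
    refine Fintype.sum_equiv (Equiv.boolArrowEquivProd (Fin N)) _ _ fun w => ?_
    simp only [crs, Equiv.boolArrowEquivProd]
    by_cases h1 : w false ∈ S <;> by_cases h2 : w true ∈ S <;> simp [h1, h2]
  rw [h1]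
  simp_rw [sum_add_distrib]
  rw [← sum_mul_sum, ← sum_mul_sum]
  have h2 : ∑ a : Fin N, (if a ∈ S then (1 : ℝ) else 0) = n := by rw [sum_boole]; simp [hS]
  have h3 : ∑ a : Fin N, (if a ∈ S then (0 : ℝ) else 1) = N - n := by
    have : ∀ a : Fin N, (if a ∈ S then (0 : ℝ) else 1) = 1 - (if a ∈ S then (1 : ℝ) else 0) := by
      intro a; split_ifs <;> norm_num
    simp_rw [this]
    rw [sum_sub_distrib, h2]; simp
  rw [h2, h3]; ring

lemma expect_exp_cut [NeZero N] (hc : 2 * m = N * d) (S : Finset (Fin N)) (hS : #S = n) {l : ℝ} (hl : 0 ≤ l)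
    (hl1 : l ≤ 1) :
    𝔼 y : Fin m × Bool → Fin N, Real.exp (l * cutS y S) ≤
      Real.exp (d * n * (N - n) / N * (l + l ^ 2)) := by
  have hN : (0 : ℝ) < N := by exact_mod_cast Nat.pos_of_ne_zero (NeZero.ne N)
  have hc' : (m : ℝ) = N * d / 2 := by
    have : (2 : ℝ) * m = N * d := by exact_mod_cast hc
    linarith
  have h1 : ∑ y : Fin m × Bool → Fin N, Real.exp (l * cutS y S) =
      (∑ w : Bool → Fin N, Real.exp (l * crs S w)) ^ m := by
    rw [Fintype.sum_pow]
    refine Fintype.sum_equiv (Equiv.curry _ _ _) _ _ fun y => ?_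
    rw [← Real.exp_sum, ← mul_sum]
    congr 2
    rw [cutS]
    simp only [crs]
    rw [sum_boole]
    rfl
  have h2 : ∑ w : Bool → Fin N, Real.exp (l * crs S w) = N ^ 2 + 2 * n * (N - n) * (Real.exp l - 1) := by
    have : ∀ w : Bool → Fin N, Real.exp (l * crs S w) = 1 + crs S w * (Real.exp l - 1) := by
      intro w
      rw [crs]; split_ifs <;> simp
    simp_rw [this]
    rw [sum_add_distrib, ← sum_mul, sum_crs S hS]
    simp
  rw [Fintype.expect_eq_sum_div_card, h1, h2]
  have hcd : ((Fintype.card (Fin m × Bool → Fin N) : ℕ) : ℝ) = ((N : ℝ) ^ 2) ^ m := by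
    rw [← pow_mul]; simp [mul_comm]
  rw [hcd, ← div_pow]
  have hnN : (0 : ℝ) ≤ N - n := by
    have : n ≤ N := by rw [← hS]; exact (card_le_univ _).trans (by simp)
    rw [sub_nonneg]; exact_mod_cast this
  have h3 : Real.exp l - 1 ≤ l + l ^ 2 := by
    have := Real.abs_exp_sub_one_sub_id_le (x := l) (by rw [abs_of_nonneg hl]; exact hl1)
    have := (abs_le.mp this).2
    linarith
  have h4 : ((N : ℝ) ^ 2 + 2 * n * (N - n) * (Real.exp l - 1)) / N ^ 2 ≤
      Real.exp (2 * n * (N - n) / N ^ 2 * (l + l ^ 2)) := by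
    refine le_trans ?_ (Real.add_one_le_exp _)
    rw [add_div, div_self (by positivity), add_comm, add_le_add_iff_right, div_mul_eq_mul_div]
    exact div_le_div_of_nonneg_right (mul_le_mul_of_nonneg_left h3 (by positivity)) (by positivity)
  have h5 : 0 ≤ ((N : ℝ) ^ 2 + 2 * n * (N - n) * (Real.exp l - 1)) / N ^ 2 := by
    have : 0 ≤ Real.exp l - 1 := by have := Real.add_one_le_exp l; linarith
    positivity
  refine (pow_le_pow_left₀ h5 h4 m).trans (le_of_eq ?_)
  rw [← Real.exp_nat_mul, hc']
  congr 1
  field_simp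

lemma expect_fS_le [NeZero N] (hc : 2 * m = N * d) (hnN : n ≤ N) {l : ℝ} (hl : 0 < l) (hl1 : l ≤ 1) :
    𝔼 y : Fin m × Bool → Fin N, (fS n y : ℝ) ≤
      d * n * (N - n) / N * (1 + l) + N * Real.log 2 / l := by
  set a : ℝ := d * n * (N - n) / N with ha
  set c : ℝ := a * (l + l ^ 2) + N * Real.log 2 with hcc
  have h1 : ∀ y : Fin m × Bool → Fin N, l * (fS n y : ℝ) - c + 1 ≤
      Real.exp (-c) * ∑ S ∈ powersetCard n univ, Real.exp (l * cutS y S) := by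
    intro y
    refine (Real.add_one_le_exp _).trans ?_
    have hne : (powersetCard n (univ : Finset (Fin N))).Nonempty :=
      powersetCard_nonempty.mpr (by simpa using hnN)
    obtain ⟨S, hS, hSf⟩ := exists_mem_eq_sup _ hne (cutS y)
    have : (fS n y : ℝ) = cutS y S := by exact_mod_cast hSf
    rw [this, sub_eq_add_neg, Real.exp_add, mul_comm]
    refine mul_le_mul_of_nonneg_left ?_ (Real.exp_pos _).le
    exact single_le_sum (f := fun S => Real.exp (l * cutS y S)) (fun S _ => (Real.exp_pos _).le) hS
  have h2 := expect_le_expect (s := univ) fun y _ => h1 y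
  rw [← mul_expect, expect_sum_comm, expect_add_distrib, expect_sub_distrib, ← mul_expect,
    expect_const univ_nonempty, expect_const univ_nonempty] at h2
  have h3 : ∑ S ∈ powersetCard n (univ : Finset (Fin N)),
      𝔼 y : Fin m × Bool → Fin N, Real.exp (l * cutS y S) ≤ Real.exp c := by
    calc _ ≤ ∑ S ∈ powersetCard n (univ : Finset (Fin N)), Real.exp (a * (l + l ^ 2)) :=
          sum_le_sum fun S hS => expect_exp_cut hc S (mem_powersetCard.mp hS).2 hl.le hl1
      _ ≤ 2 ^ N * Real.exp (a * (l + l ^ 2)) := by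
          rw [sum_const, nsmul_eq_mul]
          refine mul_le_mul_of_nonneg_right ?_ (Real.exp_pos _).le
          rw [card_powersetCard, card_univ, Fintype.card_fin]
          exact_mod_cast Nat.choose_le_two_pow N n
      _ = Real.exp c := by
          rw [hcc, Real.exp_add, mul_comm (Real.exp _), Real.exp_nat_mul, Real.exp_log (by norm_num)]
  have h4 : Real.exp (-c) * ∑ S ∈ powersetCard n (univ : Finset (Fin N)),
      𝔼 y : Fin m × Bool → Fin N, Real.exp (l * cutS y S) ≤ 1 := by
    calc _ ≤ Real.exp (-c) * Real.exp c := mul_le_mul_of_nonneg_left h3 (Real.exp_pos _).le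
      _ = 1 := by rw [← Real.exp_add]; simp
  have h5 : l * 𝔼 y : Fin m × Bool → Fin N, (fS n y : ℝ) ≤ c := by linarith
  have h6 : a * (1 + l) + N * Real.log 2 / l = c / l := by
    rw [hcc]; field_simp
  rw [h6, le_div_iff₀ hl]
  linarith

end Seq


section Joint
variable {N m : ℕ}

lemma card_joint (v w : Fin N) (hvw : v ≠ w) (j k : ℕ) :
    (2 * m).choose j * ((2 * m - j).choose k * (N - 2) ^ (2 * m - j - k)) ≤
      #{y : Fin m × Bool → Fin N | deg y v = j ∧ deg y w = k} := by
  classical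
  set T : Finset (Σ _ : Finset (Fin m × Bool), Finset (Fin m × Bool)) :=
    (powersetCard j univ).sigma (fun A => powersetCard k Aᶜ) with hT
  let f : (Fin m × Bool → Fin N) → (Σ _ : Finset (Fin m × Bool), Finset (Fin m × Bool)) :=
    fun y => ⟨({p | y p = v} : Finset _), ({p | y p = w} : Finset _)⟩
  have hmaps : ∀ y ∈ ({y : Fin m × Bool → Fin N | deg y v = j ∧ deg y w = k} : Finset _),
      f y ∈ T := by
    intro y hy
    rw [mem_filter] at hy
    rw [hT, mem_sigma, mem_powersetCard, mem_powersetCard]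
    refine ⟨⟨subset_univ _, hy.2.1⟩, ?_, hy.2.2⟩
    intro p hp
    simp only [f, mem_filter, mem_univ, true_and, mem_compl] at hp ⊢
    rw [hp]; exact hvw.symm
  rw [card_eq_sum_card_fiberwise hmaps, hT, sum_sigma]
  have key : ∀ A ∈ powersetCard j (univ : Finset (Fin m × Bool)), ∀ B ∈ powersetCard k Aᶜ,
      (N - 2) ^ (2 * m - j - k) ≤ #{y ∈ ({y : Fin m × Bool → Fin N | deg y v = j ∧ deg y w = k} : Finset _) | f y = ⟨A, B⟩} := by
    intro A hA B hB
    rw [mem_powersetCard] at hA hB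
    let t : Fin m × Bool → Finset (Fin N) := fun p =>
      if p ∈ A then {v} else if p ∈ B then {w} else {v, w}ᶜ
    have hAB : ∀ p ∈ B, p ∉ A := fun p hp => mem_compl.mp (hB.1 hp)
    have hct : #(Fintype.piFinset t) = (N - 2) ^ (2 * m - j - k) := by
      rw [Fintype.card_piFinset]
      have h1 : ∀ p, #(t p) = if p ∈ (A ∪ B)ᶜ then (N - 2) else 1 := by
        intro p
        by_cases h1 : p ∈ A
        · simp [t, h1]
        · by_cases h2 : p ∈ B
          · simp [t, h1, h2]
          · simp only [t, h1, h2, if_false]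
            rw [card_compl, card_pair hvw]
            simp [h1, h2]
      rw [prod_congr rfl fun p _ => h1 p, prod_ite_mem, univ_inter, prod_const, card_compl,
        card_union_of_disjoint, hA.2, hB.2]
      · congr 1; simp; omega
      · rw [disjoint_right]; exact hAB
    rw [← hct]
    refine card_le_card fun y hy => ?_
    rw [Fintype.mem_piFinset] at hy
    have hv : ({p | y p = v} : Finset _) = A := by
      ext p
      have := hy p
      simp only [mem_filter, mem_univ, true_and]
      by_cases h1 : p ∈ A
      · simpa [t, h1] using this
      · by_cases h2 : p ∈ B
        · simp only [t, h1, h2, if_false, if_true, mem_singleton] at this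
          simp [h1, this, hvw.symm]
        · simp only [t, h1, h2, if_false, mem_compl, mem_insert, mem_singleton, not_or] at this
          simp [h1, this]
    have hw : ({p | y p = w} : Finset _) = B := by
      ext p
      have := hy p
      simp only [mem_filter, mem_univ, true_and]
      by_cases h2 : p ∈ B
      · have h1 := hAB p h2
        simpa [t, h1, h2] using this
      · by_cases h1 : p ∈ A
        · simp only [t, h1, if_true, mem_singleton] at this
          simp [h2, this, hvw]
        · simp only [t, h1, h2, if_false, mem_compl, mem_insert, mem_singleton, not_or] at this
          simp [h2, this]
    rw [mem_filter, mem_filter]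
    refine ⟨⟨mem_univ _, ?_, ?_⟩, ?_⟩
    · rw [deg, hv, hA.2]
    · rw [deg, hw, hB.2]
    · simp only [f]; rw [hv, hw]
  calc _ = ∑ A ∈ powersetCard j (univ : Finset (Fin m × Bool)), ∑ B ∈ powersetCard k Aᶜ,
        (N - 2) ^ (2 * m - j - k) := by
        rw [sum_congr rfl (g := fun _ => (2 * m - j).choose k * (N - 2) ^ (2 * m - j - k))]
        · rw [sum_const, card_powersetCard, smul_eq_mul]
          congr 2; simp [mul_comm]
        · intro A hA
          rw [mem_powersetCard] at hA
          rw [sum_const, card_powersetCard, card_compl, hA.2, smul_eq_mul]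
          congr 2; simp [mul_comm]
    _ ≤ _ := sum_le_sum fun A hA => sum_le_sum fun B hB => key A hA B hB

/-- lower bound for the joint degree probability. -/
noncomputable def qlow (d N j k : ℕ) : ℝ :=
  ((d : ℝ) - (j + k : ℕ) / N) ^ (j + k) / (j.factorial * k.factorial) * ((1 - 2 / (N : ℝ)) ^ N) ^ d

lemma prob_joint (d : ℕ) (hc : 2 * m = N * d) (hN : 2 ≤ N) (v w : Fin N) (hvw : v ≠ w) (j k : ℕ)
    (hjk : j + k ≤ N * d) :
    qlow d N j k ≤ 𝔼 y : Fin m × Bool → Fin N, (if deg y v = j ∧ deg y w = k then (1 : ℝ) else 0) := by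
  have hNp : (0 : ℝ) < N := by positivity
  rw [Fintype.expect_eq_sum_div_card, sum_boole]
  have hcd : Fintype.card (Fin m × Bool → Fin N) = N ^ (2 * m) := by simp [mul_comm]
  rw [hcd, le_div_iff₀ (by positivity)]
  have h0 : (((2 * m).choose j * ((2 * m - j).choose k * (N - 2) ^ (2 * m - j - k)) : ℕ) : ℝ) ≤
      #{y : Fin m × Bool → Fin N | deg y v = j ∧ deg y w = k} := by
    exact_mod_cast card_joint v w hvw j k
  refine le_trans ?_ h0
  rw [hc]
  have h1 : ((N * d - (j + k) : ℕ) : ℝ) ^ j ≤ j.factorial * (N * d).choose j := by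
    have h := Nat.pow_sub_le_descFactorial (N * d) j
    rw [Nat.descFactorial_eq_factorial_mul_choose] at h
    have h' : (N * d - (j + k)) ^ j ≤ (N * d + 1 - j) ^ j := Nat.pow_le_pow_left (by omega) _
    exact_mod_cast h'.trans h
  have h2 : ((N * d - (j + k) : ℕ) : ℝ) ^ k ≤ k.factorial * (N * d - j).choose k := by
    have h := Nat.pow_sub_le_descFactorial (N * d - j) k
    rw [Nat.descFactorial_eq_factorial_mul_choose] at h
    have h' : (N * d - (j + k)) ^ k ≤ (N * d - j + 1 - k) ^ k := Nat.pow_le_pow_left (by omega) _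
    exact_mod_cast h'.trans h
  have h3 : ((N - 2 : ℕ) : ℝ) ^ (N * d) ≤ N ^ (j + k) * ((N - 2 : ℕ) : ℝ) ^ (N * d - j - k) := by
    have : N * d = (j + k) + (N * d - j - k) := by omega
    conv_lhs => rw [this, pow_add]
    refine mul_le_mul_of_nonneg_right (pow_le_pow_left₀ (by positivity) ?_ _) (by positivity)
    exact_mod_cast Nat.sub_le _ _
  have e1 : (d : ℝ) - (j + k : ℕ) / N = ((N * d - (j + k) : ℕ) : ℝ) / N := by
    rw [Nat.cast_sub hjk]; push_cast; field_simp
  have e2 : (1 : ℝ) - 2 / N = ((N - 2 : ℕ) : ℝ) / N := by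
    rw [Nat.cast_sub hN]; push_cast; field_simp
  have hj : (0 : ℝ) < j.factorial := by positivity
  have hk : (0 : ℝ) < k.factorial := by positivity
  rw [qlow, e1, e2, ← pow_mul, div_pow, div_pow]
  push_cast
  set a : ℝ := ((N * d - (j + k) : ℕ) : ℝ)
  set b : ℝ := ((N - 2 : ℕ) : ℝ)
  have ha : 0 ≤ a := Nat.cast_nonneg _
  have hb : 0 ≤ b := Nat.cast_nonneg _
  have e3 : a ^ (j + k) / (N : ℝ) ^ (j + k) / (j.factorial * k.factorial) * (b ^ (N * d) / (N : ℝ) ^ (N * d)) *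
      (N : ℝ) ^ (N * d) = (a ^ j * a ^ k * b ^ (N * d)) / ((N : ℝ) ^ (j + k) * (j.factorial * k.factorial)) := by
    field_simp; ring
  rw [e3, div_le_iff₀ (by positivity)]
  calc a ^ j * a ^ k * b ^ (N * d) ≤ (j.factorial * (N * d).choose j) * (k.factorial * (N * d - j).choose k) *
        (N ^ (j + k) * b ^ (N * d - j - k)) := by gcongr
    _ = _ := by ring

lemma qlow_tendsto (d j k : ℕ) : Filter.Tendsto (fun N : ℕ => qlow d N j k) Filter.atTop
    (nhds ((Real.exp (-d) * d ^ j / j.factorial) * (Real.exp (-d) * d ^ k / k.factorial))) := by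
  have h1 : Filter.Tendsto (fun N : ℕ => (d : ℝ) - (j + k : ℕ) / N) Filter.atTop (nhds ((d : ℝ) - 0)) :=
    tendsto_const_nhds.sub (tendsto_const_div_atTop_nhds_zero_nat _)
  have h2 : Filter.Tendsto (fun N : ℕ => (1 - 2 / (N : ℝ)) ^ N) Filter.atTop (nhds (Real.exp (-2))) := by
    have := Real.tendsto_one_add_div_pow_exp (-2)
    refine this.congr fun N => ?_
    congr 1; ring
  have h3 := ((h1.pow (j + k)).div_const ((j.factorial : ℝ) * k.factorial)).mul (h2.pow d)
  refine (h3.congr fun N => rfl).trans (le_of_eq ?_)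
  congr 1
  rw [sub_zero, ← Real.exp_nat_mul]
  have : Real.exp (d * -2) = Real.exp (-d) * Real.exp (-d) := by rw [← Real.exp_add]; congr 1; ring
  rw [this, pow_add]
  field_simp

lemma expect_LH (d : ℕ) (hc : 2 * m = N * d) (hN : 2 ≤ N) (D : ℝ) (JL JH : Finset ℕ)
    (hL : ∀ j ∈ JL, (j : ℝ) - d ≤ -D) (hH : ∀ j ∈ JH, D ≤ (j : ℝ) - d)
    (hjk : ∀ j ∈ JL, ∀ k ∈ JH, j + k ≤ N * d) :
    (N : ℝ) * (N - 1) * ∑ j ∈ JL, ∑ k ∈ JH, qlow d N j k ≤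
      𝔼 y : Fin m × Bool → Fin N, ((#{v | (deg y v : ℝ) - d ≤ -D} : ℝ) *
        (#{v | D ≤ (deg y v : ℝ) - d} : ℝ)) := by
  classical
  have h1 : ∀ y : Fin m × Bool → Fin N, ∑ q ∈ (univ : Finset (Fin N)).offDiag, ∑ j ∈ JL, ∑ k ∈ JH,
      (if deg y q.1 = j ∧ deg y q.2 = k then (1 : ℝ) else 0) ≤
      ((#{v | (deg y v : ℝ) - d ≤ -D} : ℝ) * (#{v | D ≤ (deg y v : ℝ) - d} : ℝ)) := by
    intro y
    have e0 : ((#{v | (deg y v : ℝ) - d ≤ -D} : ℝ) * (#{v | D ≤ (deg y v : ℝ) - d} : ℝ)) =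
        ∑ q ∈ (univ : Finset (Fin N)) ×ˢ (univ : Finset (Fin N)),
          (if (deg y q.1 : ℝ) - d ≤ -D then (1 : ℝ) else 0) *
          (if D ≤ (deg y q.2 : ℝ) - d then (1 : ℝ) else 0) := by
      rw [← sum_boole (fun v => (deg y v : ℝ) - d ≤ -D), ← sum_boole (fun v => D ≤ (deg y v : ℝ) - d),
        sum_mul_sum, ← sum_product']
    rw [e0]
    let g : Fin N × Fin N → ℝ := fun q => (if (deg y q.1 : ℝ) - d ≤ -D then (1 : ℝ) else 0) *
      (if D ≤ (deg y q.2 : ℝ) - d then (1 : ℝ) else 0)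
    have e1 : ∑ q ∈ (univ : Finset (Fin N)).offDiag, g q ≤
        ∑ q ∈ (univ : Finset (Fin N)) ×ˢ (univ : Finset (Fin N)), g q := by
      refine sum_le_sum_of_subset_of_nonneg (fun q _ => by simp) (fun q _ _ => ?_)
      simp only [g]; positivity
    refine le_trans (sum_le_sum ?_) e1
    intro q _
    have e : ∑ j ∈ JL, ∑ k ∈ JH, (if deg y q.1 = j ∧ deg y q.2 = k then (1 : ℝ) else 0) =
        (if deg y q.1 ∈ JL then (1 : ℝ) else 0) * (if deg y q.2 ∈ JH then (1 : ℝ) else 0) := by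
      rw [← sum_ite_eq JL (deg y q.1) (fun _ => (1 : ℝ)), ← sum_ite_eq JH (deg y q.2) (fun _ => (1 : ℝ)),
        sum_mul_sum]
      refine sum_congr rfl fun j _ => sum_congr rfl fun k _ => ?_
      by_cases h1 : deg y q.1 = j <;> by_cases h2 : deg y q.2 = k <;> simp [h1, h2]
    rw [e]
    refine mul_le_mul ?_ ?_ (by positivity) (by positivity)
    · by_cases h : deg y q.1 ∈ JL
      · rw [if_pos h, if_pos (hL _ h)]
      · rw [if_neg h]; positivity
    · by_cases h : deg y q.2 ∈ JH
      · rw [if_pos h, if_pos (hH _ h)]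
      · rw [if_neg h]; positivity
  refine le_trans ?_ (expect_le_expect fun y _ => h1 y)
  rw [expect_sum_comm]
  have h2 : ∀ q ∈ (univ : Finset (Fin N)).offDiag, ∑ j ∈ JL, ∑ k ∈ JH, qlow d N j k ≤
      𝔼 y : Fin m × Bool → Fin N, ∑ j ∈ JL, ∑ k ∈ JH,
      (if deg y q.1 = j ∧ deg y q.2 = k then (1 : ℝ) else 0) := by
    intro q hq
    rw [expect_sum_comm]
    refine sum_le_sum fun j hj => ?_
    rw [expect_sum_comm]
    refine sum_le_sum fun k hk => ?_
    exact prob_joint d hc hN _ _ (mem_offDiag.mp hq).2.2 j k (hjk j hj k hk)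
  refine le_trans (le_of_eq ?_) (sum_le_sum h2)
  rw [sum_const, offDiag_card, nsmul_eq_mul]
  congr 1
  simp only [card_univ, Fintype.card_fin]
  rw [Nat.cast_sub (Nat.le_mul_self N)]
  push_cast; ring

end Joint


section Poi

/-- Poisson weights. -/
noncomputable def poi (d k : ℕ) : ℝ := Real.exp (-d) * d ^ k / k.factorial

lemma poi_self {d : ℕ} (hd : 1 ≤ d) : 1 / (Real.exp 1 * Real.sqrt d) ≤ poi d d := by
  have h := Stirling.stirlingSeq'_antitone (Nat.zero_le (d - 1))
  simp only [Function.comp, Nat.succ_eq_add_one, Nat.sub_add_cancel hd, zero_add,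
    Stirling.stirlingSeq_one] at h
  rw [Stirling.stirlingSeq] at h
  have hdp : (0 : ℝ) < d := by exact_mod_cast hd
  have hs : 0 < Real.sqrt d := Real.sqrt_pos.mpr hdp
  have h2 : 0 < Real.sqrt 2 := by positivity
  rw [div_le_div_iff₀ (by positivity) h2, Real.sqrt_mul (by norm_num)] at h
  have h3 : (d.factorial : ℝ) ≤ Real.exp 1 * (Real.sqrt d * (d / Real.exp 1) ^ d) := by
    have : (d.factorial : ℝ) * Real.sqrt 2 ≤ (Real.exp 1 * (Real.sqrt d * (d / Real.exp 1) ^ d)) * Real.sqrt 2 := by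
      linarith
    exact le_of_mul_le_mul_right this h2
  rw [poi, div_le_div_iff₀ (by positivity) (by positivity), one_mul]
  refine h3.trans (le_of_eq ?_)
  rw [div_pow, ← Real.exp_nat_mul, mul_one, Real.exp_neg]
  field_simp

lemma poi_up {d : ℕ} (hd : 1 ≤ d) (j : ℕ) : poi d d * Real.exp (-((j : ℝ) ^ 2 / d)) ≤ poi d (d + j) := by
  have hdp : (0 : ℝ) < d := by exact_mod_cast hd
  have h1 : ((d + j).factorial : ℝ) ≤ d.factorial * (d + j) ^ j := by
    have := Nat.ascFactorial_le_pow_add d j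
    rw [← Nat.factorial_mul_ascFactorial]
    exact_mod_cast Nat.mul_le_mul_left _ this
  have h2 : ((d : ℝ) + j) ^ j ≤ d ^ j * Real.exp ((j : ℝ) ^ 2 / d) := by
    have : (d : ℝ) + j = d * (j / d + 1) := by field_simp; ring
    rw [this, mul_pow]
    refine mul_le_mul_of_nonneg_left ?_ (by positivity)
    calc ((j : ℝ) / d + 1) ^ j ≤ (Real.exp (j / d)) ^ j :=
          pow_le_pow_left₀ (by positivity) (Real.add_one_le_exp _) _
      _ = _ := by rw [← Real.exp_nat_mul]; congr 1; ring
  rw [poi, poi, Real.exp_neg ((j : ℝ) ^ 2 / d), le_div_iff₀ (by positivity), pow_add]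
  have he := Real.exp_pos ((j : ℝ) ^ 2 / d)
  have hf : (0 : ℝ) < d.factorial := by positivity
  calc _ ≤ Real.exp (-d) * d ^ d / d.factorial * (Real.exp ((j : ℝ) ^ 2 / d))⁻¹ *
        (d.factorial * (d ^ j * Real.exp ((j : ℝ) ^ 2 / d))) := by
        refine mul_le_mul_of_nonneg_left (h1.trans ?_) (by positivity)
        exact mul_le_mul_of_nonneg_left h2 hf.le
    _ = _ := by field_simp

lemma poi_down {d : ℕ} (hd : 1 ≤ d) (j : ℕ) (hj : 2 * j ≤ d) :
    poi d d * Real.exp (-(2 * (j : ℝ) ^ 2 / d)) ≤ poi d (d - j) := by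
  have hdp : (0 : ℝ) < d := by exact_mod_cast hd
  have h1 : ((d - j).factorial : ℝ) * (d - j : ℝ) ^ j ≤ d.factorial := by
    have h := Nat.pow_sub_le_descFactorial d j
    have h' : (d - j) ^ j ≤ (d + 1 - j) ^ j := Nat.pow_le_pow_left (by omega) _
    have h3 := Nat.factorial_mul_descFactorial (n := d) (k := j) (by omega)
    have h4 : (d - j).factorial * (d - j) ^ j ≤ d.factorial := by
      rw [← h3]; exact Nat.mul_le_mul_left _ (h'.trans h)
    have h5 : ((d : ℝ) - j) = ((d - j : ℕ) : ℝ) := by rw [Nat.cast_sub (by omega)]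
    rw [h5]; exact_mod_cast h4
  have hj' : 2 * (j : ℝ) ≤ d := by exact_mod_cast hj
  have hdj : (0 : ℝ) < d - j := by linarith
  have h2 : (d : ℝ) ^ j ≤ (d - j : ℝ) ^ j * Real.exp (2 * (j : ℝ) ^ 2 / d) := by
    have e : (d : ℝ) = (d - j) * (j / (d - j) + 1) := by field_simp; ring
    have hb : (j : ℝ) / (d - j) ≤ 2 * j / d := by
      rw [div_le_div_iff₀ hdj hdp]
      have : (0 : ℝ) ≤ j := Nat.cast_nonneg _
      nlinarith
    calc (d : ℝ) ^ j = (d - j) ^ j * (j / (d - j) + 1) ^ j := by rw [← mul_pow, ← e]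
      _ ≤ (d - j) ^ j * (Real.exp (2 * j / d)) ^ j := by
          refine mul_le_mul_of_nonneg_left ?_ (by positivity)
          refine pow_le_pow_left₀ (by positivity) ?_ _
          exact (Real.add_one_le_exp _).trans (Real.exp_le_exp.mpr hb)
      _ = _ := by rw [← Real.exp_nat_mul]; congr 2; ring
  rw [poi, poi, Real.exp_neg (2 * (j : ℝ) ^ 2 / d), le_div_iff₀ (by positivity)]
  have he := Real.exp_pos (2 * (j : ℝ) ^ 2 / d)
  have hf : (0 : ℝ) < d.factorial := by positivity
  have h6 : (d : ℝ) ^ d = d ^ (d - j) * d ^ j := by rw [← pow_add]; congr 1; omega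
  have h7 : (d : ℝ) ^ j * ((d - j).factorial : ℝ) ≤ d.factorial * Real.exp (2 * (j : ℝ) ^ 2 / d) := by
    calc _ ≤ (d - j : ℝ) ^ j * Real.exp (2 * (j : ℝ) ^ 2 / d) * ((d - j).factorial : ℝ) := by gcongr
      _ = ((d - j).factorial : ℝ) * (d - j : ℝ) ^ j * Real.exp (2 * (j : ℝ) ^ 2 / d) := by ring
      _ ≤ _ := by gcongr
  rw [h6]
  calc _ = Real.exp (-d) * d ^ (d - j) / (d.factorial * Real.exp (2 * (j : ℝ) ^ 2 / d)) *
        (d ^ j * ((d - j).factorial : ℝ)) := by field_simp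
    _ ≤ Real.exp (-d) * d ^ (d - j) / (d.factorial * Real.exp (2 * (j : ℝ) ^ 2 / d)) *
        (d.factorial * Real.exp (2 * (j : ℝ) ^ 2 / d)) := by gcongr
    _ = _ := by field_simp

/-- The window of deviations. -/
noncomputable def win (t : ℝ) (d : ℕ) : Finset ℕ := Icc ⌈t * Real.sqrt d⌉₊ ⌊2 * t * Real.sqrt d⌋₊

lemma win_sum (t : ℝ) (ht : 0 < t) : ∃ d0 : ℕ, ∀ d : ℕ, d0 ≤ d → 1 ≤ d ∧ (∀ j ∈ win t d, 2 * j ≤ d) ∧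
    t / 2 * Real.exp (-(8 * t ^ 2) - 1) ≤ ∑ j ∈ win t d, poi d (d - j) ∧
    t / 2 * Real.exp (-(8 * t ^ 2) - 1) ≤ ∑ j ∈ win t d, poi d (d + j) := by
  refine ⟨⌈16 * t ^ 2⌉₊ + ⌈4 / t ^ 2⌉₊ + 1, fun d hd => ?_⟩
  have hd1 : 1 ≤ d := by omega
  have hdp : (0 : ℝ) < d := by exact_mod_cast hd1
  set s := Real.sqrt d with hs
  have hsp : 0 < s := Real.sqrt_pos.mpr hdp
  have hss : s * s = d := Real.mul_self_sqrt hdp.le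
  have hda : 16 * t ^ 2 ≤ d := (Nat.le_ceil _).trans (by exact_mod_cast (by omega))
  have hdb : 4 / t ^ 2 ≤ d := (Nat.le_ceil _).trans (by exact_mod_cast (by omega))
  have hsa : 4 * t ≤ s := by
    rw [hs]; refine Real.le_sqrt_of_sq_le ?_; nlinarith
  have hsb : 2 / t ≤ s := by
    rw [hs]; refine Real.le_sqrt_of_sq_le ?_
    rw [div_pow]; norm_num; exact hdb
  rw [div_le_iff₀ ht] at hsb
  have hjle : ∀ j ∈ win t d, (j : ℝ) ≤ 2 * t * s := by
    intro j hj
    rw [win, mem_Icc] at hj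
    exact (Nat.le_floor_iff (by positivity)).mp hj.2
  have hj2 : ∀ j ∈ win t d, 2 * j ≤ d := by
    intro j hj
    have := hjle j hj
    have : (2 * j : ℝ) ≤ d := by nlinarith
    exact_mod_cast this
  have hcard : t / 2 * s ≤ #(win t d) := by
    have h1 : (⌈t * s⌉₊ : ℝ) < t * s + 1 := Nat.ceil_lt_add_one (by positivity)
    have h2 : 2 * t * s < (⌊2 * t * s⌋₊ : ℝ) + 1 := Nat.lt_floor_add_one _
    rw [win, Nat.card_Icc]
    have h3 : (⌊2 * t * s⌋₊ : ℝ) + 1 - ⌈t * s⌉₊ ≤ ((⌊2 * t * s⌋₊ + 1 - ⌈t * s⌉₊ : ℕ) : ℝ) := by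
      have : ⌊2 * t * s⌋₊ + 1 ≤ (⌊2 * t * s⌋₊ + 1 - ⌈t * s⌉₊) + ⌈t * s⌉₊ := by omega
      have : ((⌊2 * t * s⌋₊ + 1 : ℕ) : ℝ) ≤ (((⌊2 * t * s⌋₊ + 1 - ⌈t * s⌉₊) + ⌈t * s⌉₊ : ℕ) : ℝ) := by
        exact_mod_cast this
      push_cast at this
      linarith
    nlinarith
  have hpd := poi_self hd1
  have hterm : ∀ j ∈ win t d, Real.exp (-(8 * t ^ 2) - 1) / s ≤ poi d d * Real.exp (-(2 * (j : ℝ) ^ 2 / d)) := by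
    intro j hj
    have h1 := hjle j hj
    have h2 : 2 * (j : ℝ) ^ 2 / d ≤ 8 * t ^ 2 := by
      rw [div_le_iff₀ hdp, ← hss]
      have : (0 : ℝ) ≤ j := Nat.cast_nonneg _
      nlinarith
    calc Real.exp (-(8 * t ^ 2) - 1) / s = 1 / (Real.exp 1 * s) * Real.exp (-(8 * t ^ 2)) := by
          rw [Real.exp_sub]; field_simp
      _ ≤ _ := mul_le_mul hpd (Real.exp_le_exp.mpr (by linarith)) (Real.exp_pos _).le
          ((by positivity : (0:ℝ) ≤ _).trans hpd)
  have hfin : t / 2 * Real.exp (-(8 * t ^ 2) - 1) ≤ ∑ _j ∈ win t d, Real.exp (-(8 * t ^ 2) - 1) / s := by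
    rw [sum_const, nsmul_eq_mul]
    calc t / 2 * Real.exp (-(8 * t ^ 2) - 1) = t / 2 * s * (Real.exp (-(8 * t ^ 2) - 1) / s) := by field_simp
      _ ≤ _ := mul_le_mul_of_nonneg_right hcard (by positivity)
  refine ⟨hd1, hj2, hfin.trans (sum_le_sum fun j hj => ?_), hfin.trans (sum_le_sum fun j hj => ?_)⟩
  · exact (hterm j hj).trans (poi_down hd1 j (hj2 j hj))
  · refine (hterm j hj).trans (le_trans ?_ (poi_up hd1 j))
    refine mul_le_mul_of_nonneg_left (Real.exp_le_exp.mpr ?_) ((by positivity : (0:ℝ) ≤ _).trans hpd)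
    rw [neg_le_neg_iff]
    have : (0:ℝ) ≤ (j:ℝ) ^ 2 / d := by positivity
    rw [mul_div_assoc]; linarith

/-- Many low/high-degree pairs. -/
lemma many_LH (t : ℝ) (ht : 0 < t) : ∃ ε : ℝ, 0 < ε ∧ ∃ d0 : ℕ, ∀ d : ℕ, d0 ≤ d → 
    ∀ᶠ N : ℕ in Filter.atTop, ∀ m : ℕ, 2 * m = N * d → 
      ε * (N : ℝ) ^ 2 ≤ 𝔼 y : Fin m × Bool → Fin N,
        ((#{v | (deg y v : ℝ) - d ≤ -(t * Real.sqrt d)} : ℝ) *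
        (#{v | t * Real.sqrt d ≤ (deg y v : ℝ) - d} : ℝ)) := by
  classical
  obtain ⟨d0, hd0⟩ := win_sum t ht
  set ε := t / 2 * Real.exp (-(8 * t ^ 2) - 1) with hε
  have hεp : 0 < ε := by positivity
  refine ⟨ε ^ 2 / 4, by positivity, d0, fun d hd => ?_⟩
  obtain ⟨hd1, hj2, hs1, hs2⟩ := hd0 d hd
  have hwin : ∀ j ∈ win t d, t * Real.sqrt d ≤ j := by
    intro j hj
    rw [win, mem_Icc] at hj
    exact (Nat.le_ceil _).trans (by exact_mod_cast hj.1)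
  have hlim : Filter.Tendsto (fun N : ℕ => ∑ j ∈ win t d, ∑ k ∈ win t d, qlow d N (d - j) (d + k))
      Filter.atTop (nhds (∑ j ∈ win t d, ∑ k ∈ win t d, poi d (d - j) * poi d (d + k))) :=
    tendsto_finset_sum _ fun j _ => tendsto_finset_sum _ fun k _ => qlow_tendsto d (d - j) (d + k)
  have hgt : ε ^ 2 / 2 < ∑ j ∈ win t d, ∑ k ∈ win t d, poi d (d - j) * poi d (d + k) := by
    rw [← sum_mul_sum]
    have : ε * ε ≤ (∑ j ∈ win t d, poi d (d - j)) * ∑ k ∈ win t d, poi d (d + k) :=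
      mul_le_mul hs1 hs2 hεp.le (hεp.le.trans hs1)
    nlinarith
  filter_upwards [hlim.eventually (lt_mem_nhds hgt), Filter.eventually_ge_atTop 3] with N hN hN3 m hm
  have h1 := expect_LH (N := N) (m := m) d hm (by omega) (t * Real.sqrt d)
    ((win t d).image (fun j => d - j)) ((win t d).image (fun j => d + j)) (by
      intro j hj
      obtain ⟨i, hi, rfl⟩ := mem_image.mp hj
      have := hj2 i hi
      have := hwin i hi
      rw [Nat.cast_sub (by omega)]
      linarith) (by
      intro j hj
      obtain ⟨i, hi, rfl⟩ := mem_image.mp hj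
      have := hwin i hi
      push_cast
      linarith) (by
      intro j hj k hk
      obtain ⟨i, hi, rfl⟩ := mem_image.mp hj
      obtain ⟨i', hi', rfl⟩ := mem_image.mp hk
      have := hj2 i' hi'
      have : 3 * d ≤ N * d := Nat.mul_le_mul_right _ hN3
      omega)
  rw [sum_image (by
    intro a ha b hb hab
    have := hj2 a ha
    have := hj2 b hb
    simp only at hab
    omega)] at h1
  have e : ∀ j ∈ win t d, ∑ k ∈ (win t d).image (fun j => d + j), qlow d N (d - j) k =
      ∑ k ∈ win t d, qlow d N (d - j) (d + k) := by
    intro j _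
    rw [sum_image (by intro a _ b _ hab; simp only at hab; omega)]
  rw [sum_congr rfl e] at h1
  refine le_trans ?_ h1
  have hN3' : (3 : ℝ) ≤ N := by exact_mod_cast hN3
  calc ε ^ 2 / 4 * (N : ℝ) ^ 2 ≤ N * (N - 1) * (ε ^ 2 / 2) := by
        have : (0 : ℝ) ≤ (N : ℝ) * (N - 2) := mul_nonneg (by linarith) (by linarith)
        nlinarith [mul_nonneg this (sq_nonneg ε)]
    _ ≤ _ := mul_le_mul_of_nonneg_left hN.le (mul_nonneg (by linarith) (by linarith))

end Poi


section Comb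
variable {m N d n : ℕ}

open Classical in
lemma mcut_ge {α : ℚ} (hn : ⌊α * (N : ℚ)⌋₊ = n) (hnN : n ≤ N) (hN : 2 ≤ N) {G : SimpleGraph (Fin N)}
    (hG : IsDReg d G) : (d : ℝ) * n * (N - n) / N ≤ mcut α G := by
  have hN' : (2 : ℝ) ≤ N := by exact_mod_cast hN
  have hnN' : (n : ℝ) ≤ N := by exact_mod_cast hnN
  obtain ⟨s0, -, hs0⟩ := exists_subset_card_eq (s := (univ : Finset (Fin N))) (n := n) (by simpa using hnN)
  have h1 : ∀ τ : Equiv.Perm (Fin N), ∑ p ∈ s0 ×ˢ s0ᶜ, (if G.Adj (τ p.1) (τ p.2) then (1 : ℝ) else 0) ≤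
      mcut α G := by
    intro τ
    have h2 : cutCount G (s0.map τ.toEmbedding) ≤ mcut α G := by
      rw [mcut, hn]
      exact le_sup (f := fun s => cutCount G s) (mem_powersetCard.mpr ⟨subset_univ _, by rw [card_map, hs0]⟩)
    rw [sum_boole]
    refine le_trans ?_ (Nat.cast_le.mpr h2)
    rw [cutCount_eq]
    refine Nat.cast_le.mpr (card_le_card_of_injOn (fun p => (τ p.1, τ p.2)) ?_ ?_)
    · rintro ⟨u, v⟩ hp
      simp only [coe_filter, mem_product, mem_compl, Set.mem_ofPred_eq] at hp
      simp only [coe_filter, Set.mem_ofPred_eq, mem_univ, true_and]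
      refine ⟨?_, ?_, hp.2⟩
      · simpa [mem_map_equiv] using hp.1.1
      · simpa [mem_map_equiv] using hp.1.2
    · rintro ⟨u, v⟩ _ ⟨u', v'⟩ _ h
      simpa using h
  have h2 := expect_le_expect (s := univ) fun τ _ => h1 τ
  rw [expect_const univ_nonempty, expect_sum_comm] at h2
  have h3 : ∑ p ∈ (univ : Finset (Fin N)).offDiag, (if G.Adj p.1 p.2 then (1 : ℝ) else 0) = N * d := by
    have h4 : ∑ p ∈ (univ : Finset (Fin N)).offDiag, (if G.Adj p.1 p.2 then (1 : ℝ) else 0) =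
        ∑ p ∈ (univ : Finset (Fin N)) ×ˢ univ, (if G.Adj p.1 p.2 then (1 : ℝ) else 0) := by
      refine sum_subset (fun p _ => by simp) fun p _ hp => ?_
      rw [if_neg]
      intro h
      exact hp (mem_offDiag.mpr ⟨mem_univ _, mem_univ _, h.ne⟩)
    rw [h4, sum_product]
    have h5 : ∀ v : Fin N, ∑ w, (if G.Adj v w then (1 : ℝ) else 0) = d := by
      intro v
      have := hG v
      rw [Nat.card_eq_fintype_card, Fintype.card_subtype] at this
      rw [sum_boole]
      rw [← this]
      rfl
    rw [sum_congr rfl fun v _ => h5 v, sum_const, card_univ, Fintype.card_fin, nsmul_eq_mul]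
  have h4 : (N : ℝ) * (N - 1) * mcut α G ≥ n * (N - n) * (N * d) := by
    calc (N : ℝ) * (N - 1) * mcut α G ≥ (N : ℝ) * (N - 1) * ∑ p ∈ s0 ×ˢ s0ᶜ,
          𝔼 τ : Equiv.Perm (Fin N), (if G.Adj (τ p.1) (τ p.2) then (1 : ℝ) else 0) :=
          mul_le_mul_of_nonneg_left h2 (mul_nonneg (by linarith) (by linarith))
      _ = ∑ p ∈ s0 ×ˢ s0ᶜ, (N * d : ℝ) := by
          rw [mul_sum]
          refine sum_congr rfl fun p hp => ?_
          rw [mem_product, mem_compl] at hp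
          have hne : p.1 ≠ p.2 := fun h => hp.2 (h ▸ hp.1)
          have := expect_perm_pair (fun u v => if G.Adj u v then (1 : ℝ) else 0) hne
          rw [h3] at this
          exact this
      _ = _ := by
          rw [sum_const, card_product, card_compl, hs0, Fintype.card_fin, nsmul_eq_mul, Nat.cast_mul,
            Nat.cast_sub hnN]
  rw [div_le_iff₀ (by linarith)]
  have hm0 : (0 : ℝ) ≤ mcut α G := Nat.cast_nonneg _
  have : (N : ℝ) * ((N - 1) * mcut α G) ≥ N * (n * (N - n) * d) := by linarith
  have := le_of_mul_le_mul_left this (by linarith)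
  nlinarith

lemma reg_ge {α : ℚ} (hn : ⌊α * (N : ℚ)⌋₊ = n) (hnN : n ≤ N) (hN : 2 ≤ N)
    (hne : (regFinset N d).Nonempty) :
    (d : ℝ) * n * (N - n) / N ≤ regExp N d (fun G => (mcut α G : ℝ)) := by
  have hc : (0 : ℝ) < (regFinset N d).card := by exact_mod_cast hne.card_pos
  rw [regExp, le_div_iff₀ hc, mul_comm, ← nsmul_eq_mul]
  refine card_nsmul_le_sum _ _ _ fun G hG => ?_
  classical
  rw [regFinset, mem_filter] at hG
  exact mcut_ge hn hnN hN hG.2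

lemma expect_W_le [NeZero N] (hd : 1 ≤ d) (hc : 2 * m = N * d) :
    𝔼 y : Fin m × Bool → Fin N, ∑ v, |(deg y v : ℝ) - d| ≤ N * Real.sqrt d := by
  have hdp : (0 : ℝ) < d := by exact_mod_cast hd
  set s := Real.sqrt d with hs
  have hsp : 0 < s := Real.sqrt_pos.mpr hdp
  have hss : s * s = d := Real.mul_self_sqrt hdp.le
  have h1 : ∀ y : Fin m × Bool → Fin N, ∑ v, |(deg y v : ℝ) - d| ≤
      N * (s / 2) + 1 / (2 * s) * ∑ v, ((deg y v : ℝ) - d) ^ 2 := by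
    intro y
    have : (N : ℝ) * (s / 2) = ∑ _v : Fin N, s / 2 := by simp
    rw [this, mul_sum, ← sum_add_distrib]
    refine sum_le_sum fun v _ => ?_
    rw [← sq_abs]
    set x := |(deg y v : ℝ) - d|
    have : s / 2 + 1 / (2 * s) * x ^ 2 - x = (x - s) ^ 2 / (2 * s) := by field_simp; ring
    have : 0 ≤ (x - s) ^ 2 / (2 * s) := by positivity
    linarith
  refine (expect_le_expect fun y _ => h1 y).trans ?_
  rw [expect_add_distrib, expect_const univ_nonempty, ← mul_expect]
  have h2 := expect_Q_le (m := m) (N := N) hc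
  calc _ ≤ N * (s / 2) + 1 / (2 * s) * (d * N) := by gcongr
    _ = N * s := by rw [← hss]; field_simp; ring

lemma coupling_avg [NeZero d] [NeZero N] {a : ℝ} (ha0 : 0 < a) (ha : a < 1 / 2) (hna : (n : ℝ) = a * N)
    (e : Fin m × Bool ≃ Fin N × Fin d) (hc : 2 * m = N * d) 
    (L H : (Fin m × Bool → Fin N) → Finset (Fin N)) (D : ℝ)
    (hL : ∀ y, ∀ v ∈ L y, (deg y v : ℝ) - d ≤ -D) (hH : ∀ y, ∀ v ∈ H y, D ≤ (deg y v : ℝ) - d)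
    (hLH : ∀ y, Disjoint (L y) (H y)) (hn : 2 ≤ n) (hm : 1 ≤ m)
    (hbal : IsBal d (fun p => (e p).1)) (K R : ℝ) (hK : 0 ≤ K)
    (hR : R = 𝔼 σ : Equiv.Perm (Fin m × Bool), (fS n ((fun p => (e p).1) ∘ σ) : ℝ))
    (hRK : R ≤ d * n * (N - n) / N + K) (B : ℝ)
    (hB : B ≤ 𝔼 y : Fin m × Bool → Fin N, ((#(L y) : ℝ) * #(H y)))
    (hcoef : 0 ≤ (1 - 2 * a) * (2 * D) - 2 * K / (a * (1 - a) * N)) :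
    R + B * (a * (1 - a)) / N * ((1 - 2 * a) * (2 * D) - 2 * K / (a * (1 - a) * N)) - N
      - 2 * K / (a * (1 - a) * Real.sqrt d) - 7 * d ≤ 𝔼 y : Fin m × Bool → Fin N, (fS n y : ℝ) := by
  have hNp : (0 : ℝ) < N := by exact_mod_cast Nat.pos_of_ne_zero (NeZero.ne N)
  have hd : 1 ≤ d := Nat.one_le_iff_ne_zero.mpr (NeZero.ne d)
  have hdp : (0 : ℝ) < d := by exact_mod_cast hd
  set s := Real.sqrt d with hs
  have hsp : 0 < s := Real.sqrt_pos.mpr hdp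
  have hss : s * s = d := Real.mul_self_sqrt hdp.le
  set g := a * (1 - a) with hg
  have hgp : 0 < g := mul_pos ha0 (by linarith)
  have h2n : 2 * n ≤ N := by
    have : 2 * (n : ℝ) ≤ N := by rw [hna]; nlinarith
    exact_mod_cast this
  have hN2 : 2 ≤ N := by omega
  have e1 : (N : ℝ) / (n * (N - n)) = 1 / (g * N) := by
    rw [hna, hg]
    have : (1 - a) ≠ 0 := by linarith
    have h : (a * N * (N - a * N) : ℝ) = a * (1 - a) * N * N := by ring
    rw [h]; field_simp
  have e2 : (2 : ℝ) * n / N = 2 * a := by rw [hna]; field_simp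
  obtain ⟨s0, -, hs0⟩ := exists_subset_card_eq (s := (univ : Finset (Fin N))) (n := n)
    (by simpa using (by omega : n ≤ N))
  set c := (1 - 2 * a) * (2 * D) - 2 * K / (g * N) with hcd
  have h1 : ∀ y : Fin m × Bool → Fin N, R + g * c / N * ((#(L y) : ℝ) * #(H y))
      - 1 / d * (∑ v, ((deg y v : ℝ) - d) ^ 2) - 2 * K / (g * N * d) * (∑ v, |(deg y v : ℝ) - d|) - 7 * d ≤
      𝔼 σ : Equiv.Perm (Fin m × Bool), (fS n (y ∘ σ) : ℝ) := by
    intro y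
    refine le_trans ?_ (coupling_main e y hc (L y) (H y) D (hL y) (hH y) (hLH y) hn h2n hm hbal s0 hs0
      K R hK hR hRK)
    have hk := kap_ge (L y) (H y) (hLH y) s0 hs0 hN2
    have e3 : (#(L y) : ℝ) * #(H y) * (n * (N - n)) / N ^ 3 = (#(L y) : ℝ) * #(H y) * (g / N) := by
      rw [hna, hg]; field_simp
    rw [e3] at hk
    rw [e1, e2]
    have e4 : (1 - 2 * a) * (2 * D) - 2 * K * (1 / (g * N)) = c := by rw [hcd]; ring
    rw [e4]
    have h3 := mul_le_mul_of_nonneg_right hk hcoef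
    have e5 : 2 * K * ((∑ v, |(deg y v : ℝ) - d|) / d) * (1 / (g * N)) =
        2 * K / (g * N * d) * (∑ v, |(deg y v : ℝ) - d|) := by field_simp
    rw [e5]
    have e6 : (#(L y) : ℝ) * #(H y) * (g / N) * c = g * c / N * ((#(L y) : ℝ) * #(H y)) := by ring
    have e7 : (∑ v, ((deg y v : ℝ) - d) ^ 2) / d = 1 / d * (∑ v, ((deg y v : ℝ) - d) ^ 2) := by ring
    rw [e7]
    linarith
  have h2 := expect_le_expect (s := univ) fun y _ => h1 y
  rw [expect_perm_inv, expect_sub_distrib, expect_sub_distrib, expect_sub_distrib, expect_add_distrib,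
    expect_const univ_nonempty, expect_const univ_nonempty, ← mul_expect, ← mul_expect, ← mul_expect] at h2
  have hQ := expect_Q_le (m := m) (N := N) hc
  have hW := expect_W_le (m := m) (N := N) hd hc
  have f1 : 1 / (d : ℝ) * 𝔼 y : Fin m × Bool → Fin N, ∑ v, ((deg y v : ℝ) - d) ^ 2 ≤ N := by
    calc _ ≤ 1 / (d : ℝ) * (d * N) := by gcongr
      _ = N := by field_simp
  have f2 : 2 * K / (g * N * d) * 𝔼 y : Fin m × Bool → Fin N, ∑ v, |(deg y v : ℝ) - d| ≤ 2 * K / (g * s) := by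
    calc _ ≤ 2 * K / (g * N * d) * (N * s) := by gcongr
      _ = 2 * K / (g * s) := by rw [← hss]; field_simp
  have f3 : B * g / N * c ≤ g * c / N * 𝔼 y : Fin m × Bool → Fin N, ((#(L y) : ℝ) * #(H y)) := by
    calc B * g / N * c = g * c / N * B := by ring
      _ ≤ _ := mul_le_mul_of_nonneg_left hB (by positivity)
  linarith

lemma K_bound [NeZero d] [NeZero N] {a : ℝ} (ha0 : 0 < a) (ha : a < 1 / 2) (hna : (n : ℝ) = a * N)
    (e : Fin m × Bool ≃ Fin N × Fin d) (hc : 2 * m = N * d) (hn : 2 ≤ n) (hm : 1 ≤ m)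
    (hbal : IsBal d (fun p => (e p).1)) (R : ℝ) 
    (hR : R = 𝔼 σ : Equiv.Perm (Fin m × Bool), (fS n ((fun p => (e p).1) ∘ σ) : ℝ))
    (hs : 4 / (a * (1 - a)) ≤ Real.sqrt d) (hNd : 7 * d ≤ N) :
    R ≤ d * n * (N - n) / N + 8 * Real.sqrt d * N ∧
    𝔼 y : Fin m × Bool → Fin N, (fS n y : ℝ) ≤ d * n * (N - n) / N + 2 * Real.sqrt d * N := by
  have hNp : (0 : ℝ) < N := by exact_mod_cast Nat.pos_of_ne_zero (NeZero.ne N)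
  have hd : 1 ≤ d := Nat.one_le_iff_ne_zero.mpr (NeZero.ne d)
  have hdp : (1 : ℝ) ≤ d := by exact_mod_cast hd
  set s := Real.sqrt d with hsd
  have hs1 : 1 ≤ s := by rw [hsd]; exact Real.one_le_sqrt.mpr hdp
  have hsp : 0 < s := by linarith
  have hss : s * s = d := Real.mul_self_sqrt (by linarith)
  set g := a * (1 - a) with hg
  have hgp : 0 < g := mul_pos ha0 (by linarith)
  have hg1 : g ≤ 1 := by nlinarith
  have h2n : n ≤ N := by
    have : (n : ℝ) ≤ N := by rw [hna]; nlinarith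
    exact_mod_cast this
  have hA : (d : ℝ) * n * (N - n) / N = g * d * N := by rw [hna, hg]; field_simp
  have hE := expect_fS_le (m := m) (N := N) (n := n) hc h2n (l := 1 / s) (by positivity)
    (by rw [div_le_one hsp]; exact hs1)
  rw [hA] at hE ⊢
  have hE2 : 𝔼 y : Fin m × Bool → Fin N, (fS n y : ℝ) ≤ g * d * N + 2 * s * N := by
    refine hE.trans ?_
    have e1 : g * d * N * (1 + 1 / s) + N * Real.log 2 / (1 / s) = g * d * N + (g + Real.log 2) * (s * N) := by
      rw [← hss]; field_simp; ring
    rw [e1]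
    have : Real.log 2 ≤ 1 := by have := Real.log_two_lt_d9; linarith
    have hsN : 0 ≤ s * N := by positivity
    nlinarith
  refine ⟨?_, hE2⟩
  by_cases hRA : R ≤ g * d * N
  · have : 0 ≤ 8 * s * N := by positivity
    linarith
  push Not at hRA
  set K := R - g * d * N with hKd
  have hK : 0 < K := by linarith
  have h1a : 0 < 1 - 2 * a := by linarith
  have hcm := coupling_avg ha0 ha hna e hc (fun _ => ∅) (fun _ => ∅)
    (K / (g * N) / (1 - 2 * a)) (by simp) (by simp) (by simp) hn hm hbal K R hK.le hR (by rw [hA]; linarith)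
    0 (by simp) (by
      apply le_of_eq
      rw [← hg]
      field_simp
      ring)
  simp only [zero_mul, zero_div, add_zero] at hcm
  have h7 : (7 : ℝ) * d ≤ N := by exact_mod_cast hNd
  have h4 : 2 * K / (g * s) ≤ K / 2 := by
    rw [div_le_div_iff₀ (by positivity) (by norm_num)]
    rw [div_le_iff₀ hgp] at hs
    nlinarith
  have h5 : K / 2 ≤ 2 * s * N + N + N := by linarith
  have h6 : (N : ℝ) ≤ s * N := by nlinarith
  linarith

lemma main_gain [NeZero d] [NeZero N] {a : ℝ} (ha0 : 0 < a) (ha : a < 1 / 2) (hna : (n : ℝ) = a * N)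
    (e : Fin m × Bool ≃ Fin N × Fin d) (hc : 2 * m = N * d) (hn : 2 ≤ n) (hm : 1 ≤ m)
    (hbal : IsBal d (fun p => (e p).1)) (R : ℝ) 
    (hR : R = 𝔼 σ : Equiv.Perm (Fin m × Bool), (fS n ((fun p => (e p).1) ∘ σ) : ℝ))
    (hs : 4 / (a * (1 - a)) ≤ Real.sqrt d) (hNd : 7 * d ≤ N) (t ε : ℝ) (ht0 : 0 < t)
    (ht : (1 - 2 * a) * (2 * t) - 16 / (a * (1 - a)) = 1)
    (hε : ε * (N : ℝ) ^ 2 ≤ 𝔼 y : Fin m × Bool → Fin N,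
        ((#{v | (deg y v : ℝ) - d ≤ -(t * Real.sqrt d)} : ℝ) *
        (#{v | t * Real.sqrt d ≤ (deg y v : ℝ) - d} : ℝ))) :
    R + ε * (a * (1 - a)) * (Real.sqrt d * N) - (2 + 16 / (a * (1 - a))) * N ≤
      𝔼 y : Fin m × Bool → Fin N, (fS n y : ℝ) := by
  have hKb := (K_bound ha0 ha hna e hc hn hm hbal R hR hs hNd).1
  have hNp : (0 : ℝ) < N := by exact_mod_cast Nat.pos_of_ne_zero (NeZero.ne N)
  have hd : 1 ≤ d := Nat.one_le_iff_ne_zero.mpr (NeZero.ne d)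
  have hdp : (1 : ℝ) ≤ d := by exact_mod_cast hd
  set s := Real.sqrt d with hsd
  have hs1 : 1 ≤ s := by rw [hsd]; exact Real.one_le_sqrt.mpr hdp
  have hsp : 0 < s := by linarith
  set g := a * (1 - a) with hg
  have hgp : 0 < g := mul_pos ha0 (by linarith)
  have ecoef : (1 - 2 * a) * (2 * (t * s)) - 2 * (8 * s * N) / (g * N) = s := by
    calc _ = s * ((1 - 2 * a) * (2 * t) - 16 / g) := by field_simp; ring
      _ = s := by rw [ht, mul_one]
  have hcm := coupling_avg ha0 ha hna e hc
    (fun y => ({v | (deg y v : ℝ) - d ≤ -(t * s)} : Finset (Fin N)))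
    (fun y => ({v | t * s ≤ (deg y v : ℝ) - d} : Finset (Fin N))) (t * s)
    (fun y v hv => (mem_filter.mp hv).2) (fun y v hv => (mem_filter.mp hv).2)
    (fun y => by
      rw [disjoint_left]
      intro v hv hv'
      have h1 := (mem_filter.mp hv).2
      have h2 := (mem_filter.mp hv').2
      have : 0 < t * s := by positivity
      linarith) hn hm hbal (8 * s * N) R (by positivity) hR hKb (ε * (N : ℝ) ^ 2) hε
      (by rw [ecoef]; exact hsp.le)
  rw [ecoef] at hcm
  have e1 : ε * (N : ℝ) ^ 2 * g / N * s = ε * g * (s * N) := by field_simp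
  have e2 : 2 * (8 * s * N) / (g * s) = 16 / g * N := by field_simp; ring
  have h7 : (7 : ℝ) * d ≤ N := by exact_mod_cast hNd
  rw [← hg, e1, e2] at hcm
  linarith

end Comb


section Final

lemma isBal_fst {m N d : ℕ} (e : Fin m × Bool ≃ Fin N × Fin d) : IsBal d (fun p => (e p).1) := by
  intro v
  have h : (univ.filter fun p : Fin m × Bool => (e p).1 = v).map e.toEmbedding =
      ({v} : Finset (Fin N)) ×ˢ (univ : Finset (Fin d)) := by
    ext q
    rw [mem_map_equiv, mem_filter, mem_product, mem_singleton]
    simp only [mem_univ, true_and, and_true, Equiv.apply_symm_apply]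
  rw [← card_map e.toEmbedding, h, card_product, card_singleton, card_univ, Fintype.card_fin, one_mul]

lemma log_err {d N : ℕ} (hd : 1 ≤ d) (hN : 1 ≤ N) :
    Real.log (2 * ((1 + (N * d) ^ 2 : ℕ) : ℝ) ^ (6 * d ^ 2)) ≤ 50 * d ^ 3 * Real.sqrt N := by
  have hdp : (1 : ℝ) ≤ d := by exact_mod_cast hd
  have hNp : (1 : ℝ) ≤ N := by exact_mod_cast hN
  set r := Real.sqrt N with hr
  have hr1 : 1 ≤ r := Real.one_le_sqrt.mpr hNp
  have hrr : r * r = N := Real.mul_self_sqrt (by linarith)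
  rw [Real.log_mul (by norm_num) (by positivity), Real.log_pow]
  have h1 : Real.log ((1 + (N * d) ^ 2 : ℕ) : ℝ) ≤ 8 * (d * r) := by
    have h2 : ((1 + (N * d) ^ 2 : ℕ) : ℝ) ≤ (2 * (d * r)) ^ 4 := by
      push_cast
      have hx : 1 ≤ (d : ℝ) * r := by nlinarith
      have hN4 : ((N : ℝ) * d) ^ 2 ≤ (d * r) ^ 4 := by
        rw [← hrr]
        have : (d:ℝ) ^ 2 ≤ d ^ 4 := pow_le_pow_right₀ hdp (by norm_num)
        calc (r * r * d) ^ 2 = r ^ 4 * (d:ℝ) ^ 2 := by ring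
          _ ≤ r ^ 4 * d ^ 4 := by gcongr
          _ = _ := by ring
      have h14 : (1 : ℝ) ≤ (d * r) ^ 4 := one_le_pow₀ hx
      rw [mul_pow]; linarith
    calc Real.log ((1 + (N * d) ^ 2 : ℕ) : ℝ) ≤ Real.log ((2 * (d * r)) ^ 4) :=
          Real.log_le_log (by positivity) h2
      _ = 4 * Real.log (2 * (d * r)) := by rw [Real.log_pow]; norm_num
      _ ≤ 4 * (2 * (d * r)) := by
          gcongr
          exact Real.log_le_self (by positivity)
      _ = _ := by ring
  have hl2 : Real.log 2 ≤ 1 := by have := Real.log_two_lt_d9; linarith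
  have h3 : ((6 * d ^ 2 : ℕ) : ℝ) * Real.log ((1 + (N * d) ^ 2 : ℕ) : ℝ) ≤ ((6 * d ^ 2 : ℕ) : ℝ) * (8 * (d * r)) := by
    gcongr
  push_cast at h3
  have h5 : 1 ≤ (d : ℝ) ^ 3 * r := by
    have : (1 : ℝ) ≤ d ^ 3 := one_le_pow₀ hdp
    nlinarith
  push_cast
  nlinarith

set_option maxHeartbeats 1600000 in
lemma bounds_core (α : ℚ) (hα0 : 0 < α) (hα : α < 1 / 2) : ∃ C : ℝ, 0 < C ∧ ∃ d0 : ℕ, ∀ d : ℕ, d0 ≤ d →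
    ∀ᶠ N : ℕ in Filter.atTop, alphaIntegral α N → Even (N * d) →
      C ≤ (erExp N ((d : ℝ) / N) (fun G => (mcut α G : ℝ)) - regExp N d (fun G => (mcut α G : ℝ))) /
        (Real.sqrt d * N) ∧
      (erExp N ((d : ℝ) / N) (fun G => (mcut α G : ℝ)) - regExp N d (fun G => (mcut α G : ℝ))) /
        (Real.sqrt d * N) ≤ 4 := by
  set a : ℝ := (α : ℝ) with had
  have ha0 : 0 < a := by rw [had]; exact_mod_cast hα0
  have ha : a < 1 / 2 := by
    have : ((α : ℚ) : ℝ) < ((1 / 2 : ℚ) : ℝ) := by exact_mod_cast hα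
    simpa [had] using this
  set g := a * (1 - a) with hg
  have hgp : 0 < g := mul_pos ha0 (by linarith)
  have h1a : 0 < 1 - 2 * a := by linarith
  set t : ℝ := (1 + 16 / g) / (2 * (1 - 2 * a)) with htd
  have ht0 : 0 < t := by positivity
  have ht : (1 - 2 * a) * (2 * t) - 16 / g = 1 := by rw [htd]; field_simp; ring
  obtain ⟨ε, hε, d1, hd1⟩ := many_LH t ht0
  refine ⟨ε * g / 2, by positivity, d1 + 1 + ⌈(4 / g) ^ 2⌉₊ + ⌈((4 + 16 / g) * 2 / (ε * g)) ^ 2⌉₊, fun d hd => ?_⟩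
  have hdpos : 1 ≤ d := by omega
  have hdp : (1 : ℝ) ≤ d := by exact_mod_cast hdpos
  have : NeZero d := ⟨by omega⟩
  set s := Real.sqrt d with hsd
  have hs1 : 1 ≤ s := Real.one_le_sqrt.mpr hdp
  have hs4 : 4 / g ≤ s := by
    refine Real.le_sqrt_of_sq_le ((Nat.le_ceil _).trans ?_)
    exact_mod_cast (by omega)
  have hs5 : (4 + 16 / g) * 2 / (ε * g) ≤ s := by
    refine Real.le_sqrt_of_sq_le ((Nat.le_ceil _).trans ?_)
    exact_mod_cast (by omega)
  have hsqrt : Filter.Tendsto (fun N : ℕ => Real.sqrt N) Filter.atTop Filter.atTop :=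
    Real.tendsto_sqrt_atTop.comp tendsto_natCast_atTop_atTop
  have hlarge : ∀ᶠ N : ℕ in Filter.atTop, 2 / a ≤ (N : ℝ) :=
    tendsto_natCast_atTop_atTop.eventually_ge_atTop _
  filter_upwards [hd1 d (by omega), hsqrt.eventually_ge_atTop (3200 * (d : ℝ) ^ 4), hlarge,
    Filter.eventually_ge_atTop (22 * d ^ 2 + 7 * d + 10)] with N hLH hr hNa hN10 hint heven
  obtain ⟨n, hn⟩ := hint
  obtain ⟨m, hm⟩ := heven
  have hc : 2 * m = N * d := by omega
  have hc' : (2 : ℝ) * m = N * d := by exact_mod_cast hc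
  have : NeZero N := ⟨by omega⟩
  have hfl : ⌊α * (N : ℚ)⌋₊ = n := by rw [hn, Nat.floor_natCast]
  have hna : (n : ℝ) = a * N := by
    have : ((α * (N : ℚ) : ℚ) : ℝ) = ((n : ℚ) : ℝ) := by rw [hn]
    push_cast at this
    rw [had]; linarith
  have hNp : (0 : ℝ) < N := by exact_mod_cast (by omega : 0 < N)
  have hn2 : 2 ≤ n := by
    rw [div_le_iff₀ ha0] at hNa
    have : (2 : ℝ) ≤ n := by rw [hna]; linarith
    exact_mod_cast this
  have hnN : n ≤ N := by
    have : (n : ℝ) ≤ N := by rw [hna]; nlinarith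
    exact_mod_cast this
  have hmd : 11 * d ^ 2 < m := by
    have : N * 1 ≤ N * d := Nat.mul_le_mul_left _ hdpos
    omega
  have hm1 : 1 ≤ m := by omega
  have hmch : m ≤ N.choose 2 := by
    rw [Nat.choose_two_right, Nat.le_div_iff_mul_le (by norm_num), mul_comm, hc]
    exact Nat.mul_le_mul_left _ (by omega)
  have hcard : Fintype.card (Fin m × Bool) = Fintype.card (Fin N × Fin d) := by
    simp; omega
  set e := Fintype.equivOfCardEq hcard
  have hbal := isBal_fst e
  set R : ℝ := 𝔼 σ : Equiv.Perm (Fin m × Bool), (fS n ((fun p => (e p).1) ∘ σ) : ℝ) with hR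
  set E : ℝ := 𝔼 y : Fin m × Bool → Fin N, (fS n y : ℝ) with hE
  set r := Real.sqrt N with hrd
  have hrr : r * r = N := Real.mul_self_sqrt hNp.le
  have hd4 : (1 : ℝ) ≤ d ^ 4 := one_le_pow₀ hdp
  have hrp : 0 < r := by linarith
  have hdd : (d : ℝ) ≤ d ^ 4 := le_self_pow₀ hdp (by norm_num)
  have hdd2 : (d : ℝ) ^ 2 ≤ d ^ 4 := pow_le_pow_right₀ hdp (by norm_num)
  -- regular side
  obtain ⟨hne, hreg⟩ := regExp_le (α := α) hfl hbal hdpos hmd (1 / (32 * d)) (by positivity)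
    (by rw [div_mul_eq_mul_div, div_le_one (by positivity)]; linarith)
  have hreg2 := reg_ge (α := α) hfl hnN (by omega) hne
  have hregE : regExp N d (fun G => (mcut α G : ℝ)) ≤ R + N := by
    refine hreg.trans (add_le_add le_rfl ?_)
    have hlog := log_err (N := N) hdpos (by omega)
    rw [hc, div_le_iff₀ (by positivity)]
    have e1 : ((N * d : ℕ) : ℝ) * (1 / (32 * d) * 4) ^ 2 = N * (1 / (64 * d)) := by
      push_cast; field_simp; norm_num
    rw [e1]
    have e2 : 50 * (d : ℝ) ^ 3 * r ≤ N * (1 / (64 * d)) := by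
      rw [mul_one_div, le_div_iff₀ (by positivity), ← hrr]
      calc 50 * (d : ℝ) ^ 3 * r * (64 * d) = (3200 * d ^ 4) * r := by ring
        _ ≤ r * r := by gcongr
    have e3 : (N : ℝ) * (1 / (32 * d)) = N * (1 / (64 * d)) + N * (1 / (64 * d)) := by field_simp; norm_num
    rw [e3]
    linarith
  -- Erdos-Renyi side
  have hp0 : (0 : ℝ) ≤ d / N := by positivity
  have hp1 : (d : ℝ) / N ≤ 1 := by
    rw [div_le_one hNp]; exact_mod_cast (by omega : d ≤ N)
  have hdev := er_dev (N := N) hp0 hp1 (m : ℝ) r hrp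
  have hgs := er_gsym (N := N) (m := m) α hp0 hp1 hmch
  have hcoin := expect_coin_le (m := m) (N := N)
  have hseq1 := seq_le_gsym (N := N) (α := α) hfl hmch
  have hseq2 := gsym_le_seq (N := N) (α := α) hfl hmch
  have hcp : ((N.choose 2 : ℕ) : ℝ) * (d / N) = (N - 1) * d / 2 := by
    rw [Nat.cast_choose_two]; field_simp
  have herr : (m : ℝ) / N + 2 * m ^ 2 / N ^ 2 +
      (|(m : ℝ) - (N.choose 2 : ℕ) * (d / N)| + (r + (N.choose 2 : ℕ) * (d / N) / r) / 2) ≤ N := by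
    rw [hcp]
    have hmm : (m : ℝ) = N * d / 2 := by linarith
    have e1 : (m : ℝ) - (N - 1) * d / 2 = d / 2 := by rw [hmm]; ring
    rw [e1, abs_of_nonneg (by positivity), hmm]
    have e2 : (N : ℝ) * d / 2 / N = d / 2 := by field_simp
    have e3 : 2 * ((N : ℝ) * d / 2) ^ 2 / N ^ 2 = d ^ 2 / 2 := by field_simp
    rw [e2, e3]
    have e4 : ((N : ℝ) - 1) * d / 2 / r ≤ r * d := by
      rw [div_le_iff₀ hrp]
      have : r * d * r = N * d := by rw [← hrr]; ring
      rw [this]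
      nlinarith
    have e5 : 3200 * (d : ℝ) ^ 4 * r ≤ N := by rw [← hrr]; gcongr
    have hr1 : 1 ≤ r := by linarith
    have e6 : (d : ℝ) ^ 4 ≤ d ^ 4 * r := le_mul_of_one_le_right (by positivity) hr1
    have e7 : (d : ℝ) * r ≤ d ^ 4 * r := by gcongr
    have e8 : r ≤ d ^ 4 * r := le_mul_of_one_le_left hrp.le hd4
    linarith
  rw [abs_le] at hgs
  have hErl : E - N ≤ erExp N ((d : ℝ) / N) (fun G => (mcut α G : ℝ)) := by linarith [hgs.1]
  have hEru : erExp N ((d : ℝ) / N) (fun G => (mcut α G : ℝ)) ≤ E + N := by linarith [hgs.2]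
  have hEu := (K_bound ha0 ha hna e hc hn2 hm1 hbal R hR hs4 (by omega)).2
  have hEl := main_gain ha0 ha hna e hc hn2 hm1 hbal R hR hs4 (by omega) t ε ht0 ht (hLH m hc)
  have hsN : 0 < s * N := by positivity
  have hNs : (N : ℝ) ≤ s * N := by nlinarith
  constructor
  · rw [le_div_iff₀ hsN]
    rw [div_le_iff₀ (by positivity)] at hs5
    have h9 : (4 + 16 / g) * N ≤ ε * g / 2 * (s * N) := by nlinarith
    have h10 : R + ε * g * (s * N) - (2 + 16 / g) * N ≤ E := hEl
    linarith
  · rw [div_le_iff₀ hsN]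
    have h10 : E ≤ d * n * (N - n) / N + 2 * s * N := hEu
    linarith

lemma filter_neBot (α : ℚ) (hα0 : 0 < α) (d : ℕ) :
    (Filter.atTop ⊓ Filter.principal {N : ℕ | alphaIntegral α N ∧ Even (N * d)}).NeBot := by
  rw [← Filter.frequently_mem_iff_neBot, Filter.frequently_atTop]
  intro b
  refine ⟨2 * α.den * b, ?_, ⟨(2 * b * α.num.toNat), ?_⟩, ?_⟩
  · have := α.den_pos
    nlinarith
  · have h1 : α * α.den = α.num := Rat.mul_den_eq_num α
    have h2 : ((α.num.toNat : ℤ) : ℚ) = α.num := by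
      rw [Int.toNat_of_nonneg (Rat.num_nonneg.mpr hα0.le)]
    push_cast at h2 ⊢
    rw [h2, ← h1]; ring
  · exact ⟨α.den * b * d, by ring⟩

end Final

/-- For every rational `α ∈ (0,1/2)` there is a constant `C(α) > 0` such that
`liminf_{d→∞} liminf_{N→∞} (E_{G(N,d/N)}[MCUT_α] − E_{R(N,d)}[MCUT_α]) / (√d · N) ≥ C(α)`,
where `d` ranges over the positive integers and the inner liminf is over integers `N`
with `αN` an integer and `Nd` even. -/
theorem statement0 (α : ℚ) (hα0 : 0 < α) (hα : α < 1 / 2) :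
    ∃ C : ℝ, 0 < C ∧
      C ≤ Filter.liminf (fun d : ℕ =>
            Filter.liminf (fun N : ℕ =>
                (erExp N ((d : ℝ) / N) (fun G => (mcut α G : ℝ)) -
                  regExp N d (fun G => (mcut α G : ℝ))) / (Real.sqrt d * N))
              (Filter.atTop ⊓ Filter.principal {N | alphaIntegral α N ∧ Even (N * d)}))
          Filter.atTop := by
  obtain ⟨C, hC, d0, hd0⟩ := bounds_core α hα0 hα
  refine ⟨C, hC, ?_⟩
  have key : ∀ d : ℕ, d0 ≤ d →
      C ≤ Filter.liminf (fun N : ℕ => (erExp N ((d : ℝ) / N) (fun G => (mcut α G : ℝ)) -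
        regExp N d (fun G => (mcut α G : ℝ))) / (Real.sqrt d * N))
        (Filter.atTop ⊓ Filter.principal {N | alphaIntegral α N ∧ Even (N * d)}) ∧
      Filter.liminf (fun N : ℕ => (erExp N ((d : ℝ) / N) (fun G => (mcut α G : ℝ)) -
        regExp N d (fun G => (mcut α G : ℝ))) / (Real.sqrt d * N))
        (Filter.atTop ⊓ Filter.principal {N | alphaIntegral α N ∧ Even (N * d)}) ≤ 4 := by
    intro d hd
    have := filter_neBot α hα0 d
    have h := hd0 d hd
    have h' : ∀ᶠ N : ℕ in Filter.atTop ⊓ Filter.principal {N | alphaIntegral α N ∧ Even (N * d)},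
        C ≤ (erExp N ((d : ℝ) / N) (fun G => (mcut α G : ℝ)) - regExp N d (fun G => (mcut α G : ℝ))) /
        (Real.sqrt d * N) ∧
        (erExp N ((d : ℝ) / N) (fun G => (mcut α G : ℝ)) - regExp N d (fun G => (mcut α G : ℝ))) /
        (Real.sqrt d * N) ≤ 4 := by
      rw [Filter.eventually_inf_principal]
      filter_upwards [h] with N hN hN2
      exact hN hN2.1 hN2.2
    constructor
    · exact Filter.le_liminf_of_le
        (Filter.IsBoundedUnder.isCoboundedUnder_ge ⟨4, Filter.eventually_map.mpr (h'.mono fun N hN => hN.2)⟩)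
        (h'.mono fun N hN => hN.1)
    · refine Filter.liminf_le_of_le ⟨C, Filter.eventually_map.mpr (h'.mono fun N hN => hN.1)⟩ ?_
      intro b hb
      obtain ⟨N, hN1, hN2⟩ := (hb.and h').exists
      exact hN1.trans hN2.2
  have hev : ∀ᶠ d : ℕ in Filter.atTop, d0 ≤ d := Filter.eventually_ge_atTop d0
  exact Filter.le_liminf_of_le
    (Filter.IsBoundedUnder.isCoboundedUnder_ge ⟨4, Filter.eventually_map.mpr (hev.mono fun d hd => (key d hd).2)⟩)
    (hev.mono fun d hd => (key d hd).1)
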